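/- Let f : 𝔸 → 𝔸 be a positive twist map that preserves the Lebesgue measure Leb, and let U ⊆ 𝔸 be an f-invariant bounded essential open subannulus. Then the restriction f|U is C⁰-integrable if and only if for Leb-almost every z ∈ U the asymptotic torsion Torsion(f,z) exists and equals 0. -/

import Mathlib

noncomputable section

open MeasureTheory Set Filter Topology Function

/-- The annulus `𝔸 = (ℝ/ℤ) × ℝ`. -/
abbrev Ann : Type := AddCircle (1 : ℝ) × ℝ

/-- The plane `ℝ²`, universal cover of the annulus. -/
abbrev Pl : Type := ℝ × ℝ

/-- The covering projection `π : ℝ² → 𝔸`, `π(x,y) = (x + ℤ, y)`. -/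
def pr : Pl → Ann := fun p => ((p.1 : AddCircle (1 : ℝ)), p.2)

/-- The vertical vector `v = (0,1)`. -/
def vv : Pl := (0, 1)

/-- Data of a `C¹` diffeomorphism `f` of the annulus, isotopic to the identity,
presented through a lifted isotopy `(Ft t)_{t ∈ [0,1]}` of `C¹` diffeomorphisms of the
plane commuting with the deck transformation, with `Ft 0 = id` and `Ft 1` a lift of `f`,
whose derivatives depend continuously on `(t, z)`. -/
structure IsotopySetup where
  f : Ann → Ann
  Ft : ℝ → Pl → Pl
  lift_f : ∀ p, pr (Ft 1 p) = f (pr p)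
  Ft_zero : Ft 0 = id
  Ft_periodic : ∀ t, ∀ p : Pl, Ft t (p + (1, 0)) = Ft t p + (1, 0)
  Ft_smooth : ∀ t ∈ Icc (0:ℝ) 1, ContDiff ℝ 1 (Ft t)
  Ft_diffeo : ∀ t ∈ Icc (0:ℝ) 1, ∃ G : Pl → Pl, ContDiff ℝ 1 G ∧
      Function.LeftInverse G (Ft t) ∧ Function.RightInverse G (Ft t)
  Ft_cont : ContinuousOn (fun q : ℝ × Pl => Ft q.1 q.2) (Icc (0:ℝ) 1 ×ˢ univ)
  DFt_cont : ContinuousOn (fun q : ℝ × Pl => fderiv ℝ (Ft q.1) q.2) (Icc (0:ℝ) 1 ×ˢ univ)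

namespace IsotopySetup

variable (S : IsotopySetup)

/-- The canonical lift `F : ℝ² → ℝ²` of `f`. -/
def F : Pl → Pl := S.Ft 1

/-- The extended linearized isotopy: for `t ≥ 0`, `D t p` is the derivative at `p` of the
extended isotopy `f_t`, determined by `Df_{n+s} = Df_s ∘ Df^n` for `n ∈ ℕ`, `s ∈ [0,1)`. -/
def D (t : ℝ) (p : Pl) : Pl →L[ℝ] Pl :=
  (fderiv ℝ (S.Ft (Int.fract t)) (S.F^[⌊t⌋₊] p)).comp (fderiv ℝ (S.F^[⌊t⌋₊]) p)

/-- `S.AngleVar p w n a` : the total angular variation on `[0,n]` of the vector `w ∈ T_{π(p)}𝔸`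
under the extended linearized isotopy equals `a`; that is, `a = n·Torsionₙ(f, π(p), w)`.
Here `Θ` is a continuous lift of the angle `≺(v, Df_t(z)w)` (so that the direction of
`Df_t(z)w` is `(−sin(2πΘ(t)), cos(2πΘ(t)))`). -/
def AngleVar (p w : Pl) (n : ℕ) (a : ℝ) : Prop :=
  ∃ Θ : ℝ → ℝ, ContinuousOn Θ (Icc 0 (n:ℝ)) ∧
    (∀ t ∈ Icc (0:ℝ) (n:ℝ), ∃ r : ℝ, 0 < r ∧
      S.D t p w = r • (-Real.sin (2 * Real.pi * Θ t), Real.cos (2 * Real.pi * Θ t))) ∧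
    a = Θ n - Θ 0

/-- `S.TorsionFin p w n τ` : the finite-time torsion `Torsionₙ(f, π(p), w)` equals `τ`. -/
def TorsionFin (p w : Pl) (n : ℕ) (τ : ℝ) : Prop :=
  ∃ a : ℝ, S.AngleVar p w n a ∧ τ = a / n

/-- The asymptotic torsion at the lifted point `p` exists and equals `L`
(for every choice of nonzero tangent vector `w`). -/
def TorsionLift (p : Pl) (L : ℝ) : Prop :=
  ∀ w : Pl, w ≠ 0 → ∃ a : ℕ → ℝ, (∀ n : ℕ, 1 ≤ n → S.AngleVar p w n (a n)) ∧
    Tendsto (fun n : ℕ => a n / (n : ℝ)) atTop (nhds L)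

/-- The asymptotic torsion at `z ∈ 𝔸` exists and equals `L`. -/
def Torsion (z : Ann) (L : ℝ) : Prop :=
  ∃ p : Pl, pr p = z ∧ S.TorsionLift p L

open Classical in
/-- The asymptotic torsion as a function on the annulus (defaulting to `0` where undefined). -/
def torsionFun (z : Ann) : ℝ :=
  if h : ∃ L, S.Torsion z L then h.choose else 0

/-- The lifted point `p` has conjugate points: `n·Torsionₙ(f,z,v) = −k/2` for some `n,k ≥ 1`. -/
def ConjLift (p : Pl) : Prop :=
  ∃ n k : ℕ, 1 ≤ n ∧ 1 ≤ k ∧ ∃ a : ℝ, S.AngleVar p vv n a ∧ a = -(k : ℝ) / 2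

/-- The lifted point `p` has over-conjugate points: `n·Torsionₙ(f,z,v) < −1/2` for some `n ≥ 1`. -/
def OverConjLift (p : Pl) : Prop :=
  ∃ n : ℕ, 1 ≤ n ∧ ∃ a : ℝ, S.AngleVar p vv n a ∧ a < -(1:ℝ) / 2

/-- The point `z ∈ 𝔸` has conjugate points. -/
def Conj (z : Ann) : Prop := ∃ p : Pl, pr p = z ∧ S.ConjLift p

/-- The point `z ∈ 𝔸` has over-conjugate points. -/
def OverConj (z : Ann) : Prop := ∃ p : Pl, pr p = z ∧ S.OverConjLift p

/-- `f` is a positive twist map: for every `x`, the map `y ↦ p₁(F(x,y))` is an increasing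
diffeomorphism of `ℝ` onto `ℝ`. -/
def PosTwist : Prop :=
  ∀ x : ℝ, StrictMono (fun y => (S.F (x, y)).1) ∧
    Function.Surjective (fun y => (S.F (x, y)).1) ∧
    ∀ y : ℝ, 0 < deriv (fun y => (S.F (x, y)).1) y

/-- `f` has no conjugate points (linearized-dynamics formulation): for every `z ∈ ℝ²` and
`n ≥ 1`, the first component of `DFⁿ(z)(0,1)` does not vanish. -/
def NoConjPts : Prop :=
  ∀ p : Pl, ∀ n : ℕ, 1 ≤ n → ((fderiv ℝ (S.F^[n]) p) (0, 1)).1 ≠ 0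

/-- `f` is exact symplectic: it preserves the Lebesgue measure and `F*(y dx) − y dx = dS`
for a `C¹` function `S : ℝ² → ℝ` with `S(x+1,y) = S(x,y)`. -/
def ExactSymplectic : Prop :=
  MeasurePreserving S.f volume volume ∧
  ∃ Sg : Pl → ℝ, ContDiff ℝ 1 Sg ∧ (∀ p : Pl, Sg (p + (1, 0)) = Sg p) ∧
    ∀ p : Pl,
      fderiv ℝ Sg p (1, 0) = (S.F p).2 * (fderiv ℝ S.F p (1, 0)).1 - p.2 ∧
      fderiv ℝ Sg p (0, 1) = (S.F p).2 * (fderiv ℝ S.F p (0, 1)).1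

end IsotopySetup

/-- `γ` is an essential curve of the annulus: a topological embedding of the circle which is
not homotopic to a constant map. -/
def EssentialCurve (γ : C(AddCircle (1:ℝ), Ann)) : Prop :=
  Topology.IsEmbedding γ ∧ ∀ z : Ann, ¬ γ.Homotopic (ContinuousMap.const _ z)

/-- An open subset of the annulus is essential if it contains an essential curve. -/
def EssentialSet (U : Set Ann) : Prop :=
  ∃ γ : C(AddCircle (1:ℝ), Ann), EssentialCurve γ ∧ range γ ⊆ U

/-- `f` restricted to `U` is `C⁰`-integrable: `U` is the disjoint union of a family of
`f`-invariant images of essential curves. -/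
def C0IntegrableOn (f : Ann → Ann) (U : Set Ann) : Prop :=
  ∃ (ι : Type) (γ : ι → C(AddCircle (1:ℝ), Ann)),
    (∀ i, EssentialCurve (γ i) ∧ f '' range (γ i) = range (γ i)) ∧
    (⋃ i, range (γ i)) = U ∧
    Pairwise (Disjoint on fun i => range (γ i))

/-- `ℤ`-iterates of a bijection (negative iterates through the inverse map). -/
def iterZ {α : Type*} [Nonempty α] (f : α → α) : ℤ → α → α
  | Int.ofNat n => f^[n]
  | Int.negSucc n => (Function.invFun f)^[n + 1]

/-- `ℐ(f)`: the union of all `f`-invariant essential curves. -/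
def invCurveUnion (f : Ann → Ann) : Set Ann :=
  ⋃ γ ∈ {γ : C(AddCircle (1:ℝ), Ann) | EssentialCurve γ ∧ f '' range γ = range γ}, range γ


set_option linter.all false
noncomputable section
open MeasureTheory Set Filter Topology Function

/-! ### Basic facts on the covering projection -/

lemma pr_quot : IsOpenQuotientMap pr :=
  IsOpenQuotientMap.prodMap QuotientAddGroup.isOpenQuotientMap_mk IsOpenQuotientMap.id

lemma pr_cont : Continuous pr := pr_quot.continuous
lemma pr_open : IsOpenMap pr := pr_quot.isOpenMap
lemma pr_surj : Surjective pr := pr_quot.surjective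

lemma pr_eq_iff {p q : Pl} : pr p = pr q ↔ ∃ n : ℤ, q = p + ((n : ℝ), 0) := by
  unfold pr
  rw [Prod.mk.injEq]
  constructor
  · rintro ⟨h1, h2⟩
    have h1' : ((q.1 - p.1 : ℝ) : AddCircle (1:ℝ)) = 0 := by
      rw [AddCircle.coe_sub, h1, sub_self]
    obtain ⟨n, hn⟩ := (AddCircle.coe_eq_zero_iff (1:ℝ)).1 h1'
    refine ⟨n, ?_⟩
    simp only [zsmul_eq_mul, mul_one] at hn
    ext
    · simp [hn]
    · simp [h2]
  · rintro ⟨n, rfl⟩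
    refine ⟨?_, by simp⟩
    have : (((n:ℝ)) : AddCircle (1:ℝ)) = 0 := (AddCircle.coe_eq_zero_iff (1:ℝ)).2 ⟨n, by simp⟩
    simp [AddCircle.coe_add, this]

lemma pr_add_int (p : Pl) (n : ℤ) : pr (p + ((n : ℝ), 0)) = pr p :=
  (pr_eq_iff.2 ⟨n, rfl⟩).symm

lemma pr_neg (p : Pl) : pr (-p) = - pr p := by
  unfold pr; simp

@[simp] lemma pr_snd (p : Pl) : (pr p).2 = p.2 := rfl

/-- Translate a point so that its first coordinate lies in `[0,1)`. -/
lemma exists_shift (p : Pl) : ∃ n : ℤ, (p + ((n : ℝ), 0)).1 ∈ Icc (0:ℝ) 1 := by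
  refine ⟨-⌊p.1⌋, ?_⟩
  have h1 := Int.floor_le p.1
  have h2 := Int.lt_floor_add_one p.1
  constructor <;> simp <;> linarith

lemma per_int {H : Pl → Pl} (hper : ∀ p : Pl, H (p + (1, 0)) = H p + (1, 0)) (p : Pl) (n : ℤ) :
    H (p + ((n : ℝ), 0)) = H p + ((n : ℝ), 0) := by
  have hnat : ∀ (n : ℕ) (p : Pl), H (p + ((n : ℝ), 0)) = H p + ((n : ℝ), 0) := by
    intro n
    induction n with
    | zero => intro p; have e : (((0:ℕ):ℝ), (0:ℝ)) = (0 : Pl) := by ext <;> simp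
              rw [e]; simp
    | succ k ih =>
      intro p
      have e : (((k + 1 : ℕ) : ℝ), (0:ℝ)) = ((k : ℝ), (0:ℝ)) + (1, 0) := by ext <;> simp
      rw [e, ← add_assoc, hper, ih, add_assoc]
  obtain ⟨k, rfl | rfl⟩ := n.eq_nat_or_neg
  · exact_mod_cast hnat k p
  · have h := hnat k (p + (((-(k:ℤ) : ℤ) : ℝ), 0))
    have e : (p + (((-(k:ℤ) : ℤ) : ℝ), (0:ℝ))) + ((k:ℝ), 0) = p := by ext <;> simp
    rw [e] at h
    rw [h]
    ext <;> simp

lemma per_neg {H : Pl → Pl} (hper : ∀ p : Pl, H (p + (1, 0)) = H p + (1, 0)) (p : Pl) :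
    - H (-(p + (1, 0))) = - H (-p) + (1, 0) := by
  have h := hper (-(p + (1, 0)))
  rw [neg_add, neg_add_cancel_right] at h
  rw [neg_add, h]
  abel

/-- The map of the annulus induced by a periodic map of the plane. -/
def desc (H : Pl → Pl) (z : Ann) : Ann := pr (H (Function.surjInv pr_surj z))

lemma desc_pr {H : Pl → Pl} (hper : ∀ p : Pl, H (p + (1, 0)) = H p + (1, 0)) (p : Pl) :
    desc H (pr p) = pr (H p) := by
  unfold desc
  have h := Function.surjInv_eq pr_surj (pr p)
  obtain ⟨n, hn⟩ := pr_eq_iff.1 h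
  conv_rhs => rw [hn, per_int hper, pr_add_int]

lemma desc_cont {H : Pl → Pl} (hper : ∀ p : Pl, H (p + (1, 0)) = H p + (1, 0))
    (hc : Continuous H) : Continuous (desc H) := by
  rw [pr_quot.isQuotientMap.continuous_iff]
  have : desc H ∘ pr = pr ∘ H := funext fun p => desc_pr hper p
  rw [this]; exact pr_cont.comp hc

/-- Abstract (topological) data of a lifted positive twist map preserving area. -/
structure TwistLift where
  F : Pl → Pl
  G : Pl → Pl
  contF : Continuous F
  contG : Continuous G
  GF : ∀ p, G (F p) = p
  FG : ∀ p, F (G p) = p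
  perF : ∀ p : Pl, F (p + (1, 0)) = F p + (1, 0)
  perG : ∀ p : Pl, G (p + (1, 0)) = G p + (1, 0)
  tw : ∀ x : ℝ, StrictMono (fun y => (F (x, y)).1)
  itw : ∀ x : ℝ, StrictAnti (fun y => (G (x, y)).1)
  endF : ∀ M : ℝ, ∃ M' : ℝ, ∀ p : Pl, (M' ≤ p.2 → M ≤ (F p).2) ∧ (p.2 ≤ -M' → (F p).2 ≤ -M)
  endG : ∀ M : ℝ, ∃ M' : ℝ, ∀ p : Pl, (M' ≤ p.2 → M ≤ (G p).2) ∧ (p.2 ≤ -M' → (G p).2 ≤ -M)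
  meas : ∀ s : Set Ann, MeasurableSet s → volume (desc F ⁻¹' s) = volume s

namespace TwistLift
variable (T : TwistLift)

def f : Ann → Ann := desc T.F
def g : Ann → Ann := desc T.G

lemma f_pr (p : Pl) : T.f (pr p) = pr (T.F p) := desc_pr T.perF p
lemma g_pr (p : Pl) : T.g (pr p) = pr (T.G p) := desc_pr T.perG p
lemma f_cont : Continuous T.f := desc_cont T.perF T.contF
lemma g_cont : Continuous T.g := desc_cont T.perG T.contG
lemma gf (z : Ann) : T.g (T.f z) = z := by
  obtain ⟨p, rfl⟩ := pr_surj z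
  rw [f_pr, g_pr, T.GF]
lemma fg (z : Ann) : T.f (T.g z) = z := by
  obtain ⟨p, rfl⟩ := pr_surj z
  rw [g_pr, f_pr, T.FG]

/-- the homeomorphism of the annulus -/
def homeo : Ann ≃ₜ Ann where
  toFun := T.f
  invFun := T.g
  left_inv := T.gf
  right_inv := T.fg
  continuous_toFun := T.f_cont
  continuous_invFun := T.g_cont

lemma measG (s : Set Ann) (hs : MeasurableSet s) : volume (T.g ⁻¹' s) = volume s := by
  have h := T.meas (T.g ⁻¹' s) (T.g_cont.measurable hs)
  have e : desc T.F ⁻¹' (T.g ⁻¹' s) = s := by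
    ext z
    have := T.gf z
    simp only [mem_preimage]
    change T.g (T.f z) ∈ s ↔ _
    rw [this]
  rw [e] at h
  exact h.symm

end TwistLift

/-- symmetry of the plane by `(x,y) ↦ (a x, b y)`, for signs `a b` -/
def sgn2 (a b : ℝ) (p : Pl) : Pl := (a * p.1, b * p.2)

lemma negAnn_mp : MeasurePreserving (fun z : Ann => ((-z.1, -z.2) : Ann)) volume volume :=
  (Measure.measurePreserving_neg (volume : Measure (AddCircle (1:ℝ)))).prod
    (Measure.measurePreserving_neg (volume : Measure ℝ))

lemma negAnn_meas (s : Set Ann) (hs : MeasurableSet s) :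
    volume (Neg.neg ⁻¹' s) = volume s :=
  negAnn_mp.measure_preimage hs.nullMeasurableSet

lemma reflAnn_mp : MeasurePreserving (fun z : Ann => ((-z.1, z.2) : Ann)) volume volume :=
  (Measure.measurePreserving_neg (volume : Measure (AddCircle (1:ℝ)))).prod
    (MeasurePreserving.id (volume : Measure ℝ))

namespace TwistLift
variable (T : TwistLift)

/-- Conjugation by `p ↦ -p`. -/
def negc : TwistLift where
  F p := - T.F (-p)
  G p := - T.G (-p)
  contF := (T.contF.comp continuous_neg).neg
  contG := (T.contG.comp continuous_neg).neg
  GF p := by simp [T.GF]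
  FG p := by simp [T.FG]
  perF p := per_neg T.perF p
  perG p := per_neg T.perG p
  tw x := by
    intro y y' h
    have := T.tw (-x) (neg_lt_neg h)
    simpa using this
  itw x := by
    intro y y' h
    have := T.itw (-x) (neg_lt_neg h)
    simpa using this
  endF M := by
    obtain ⟨M', h⟩ := T.endF M
    refine ⟨M', fun p => ⟨fun hp => ?_, fun hp => ?_⟩⟩
    · have := (h (-p)).2 (by simpa using hp)
      simp; linarith
    · have := (h (-p)).1 (by simp; linarith)
      simpa using this
  endG M := by
    obtain ⟨M', h⟩ := T.endG M
    refine ⟨M', fun p => ⟨fun hp => ?_, fun hp => ?_⟩⟩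
    · have := (h (-p)).2 (by simpa using hp)
      simp; linarith
    · have := (h (-p)).1 (by simp; linarith)
      simpa using this
  meas s hs := by
    have e : ∀ z, desc (fun p => - T.F (-p)) z = - T.f (- z) := by
      intro z
      obtain ⟨p, rfl⟩ := pr_surj z
      rw [desc_pr, pr_neg, ← pr_neg p, f_pr]
      exact per_neg T.perF
    have e2 : desc (fun p => - T.F (-p)) ⁻¹' s = Neg.neg ⁻¹' (T.f ⁻¹' (Neg.neg ⁻¹' s)) := by
      ext z; simp [e]
    have h1 : MeasurableSet ((Neg.neg : Ann → Ann) ⁻¹' s) := negAnn_mp.measurable hs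
    rw [e2, negAnn_meas _ (T.f_cont.measurable h1)]
    have := T.meas _ h1
    rw [negAnn_meas _ hs] at this
    exact this

/-- Conjugation of the inverse by `(x,y) ↦ (-x,y)`. -/
def refl : TwistLift where
  F p := sgn2 (-1) 1 (T.G (sgn2 (-1) 1 p))
  G p := sgn2 (-1) 1 (T.F (sgn2 (-1) 1 p))
  contF := by
    have := T.contG
    unfold sgn2; fun_prop
  contG := by
    have := T.contF
    unfold sgn2; fun_prop
  GF p := by simp [T.FG, sgn2]
  FG p := by simp [T.GF, sgn2]
  perF p := by
    have h := T.perG (sgn2 (-1) 1 (p + (1, 0)))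
    have e : sgn2 (-1) 1 (p + (1, 0)) + (1, 0) = sgn2 (-1) 1 p := by ext <;> simp [sgn2]
    rw [e] at h
    rw [h]; ext <;> simp [sgn2]
  perG p := by
    have h := T.perF (sgn2 (-1) 1 (p + (1, 0)))
    have e : sgn2 (-1) 1 (p + (1, 0)) + (1, 0) = sgn2 (-1) 1 p := by ext <;> simp [sgn2]
    rw [e] at h
    rw [h]; ext <;> simp [sgn2]
  tw x := by
    intro y y' h
    have := T.itw (-x) h
    simpa [sgn2] using this
  itw x := by
    intro y y' h
    have := T.tw (-x) h
    simpa [sgn2] using this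
  endF M := by
    obtain ⟨M', h⟩ := T.endG M
    refine ⟨M', fun p => ⟨fun hp => ?_, fun hp => ?_⟩⟩
    · have := (h (sgn2 (-1) 1 p)).1 (by simpa [sgn2] using hp)
      simpa [sgn2] using this
    · have := (h (sgn2 (-1) 1 p)).2 (by simpa [sgn2] using hp)
      simpa [sgn2] using this
  endG M := by
    obtain ⟨M', h⟩ := T.endF M
    refine ⟨M', fun p => ⟨fun hp => ?_, fun hp => ?_⟩⟩
    · have := (h (sgn2 (-1) 1 p)).1 (by simpa [sgn2] using hp)
      simpa [sgn2] using this
    · have := (h (sgn2 (-1) 1 p)).2 (by simpa [sgn2] using hp)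
      simpa [sgn2] using this
  meas s hs := by
    set r : Ann → Ann := fun z => (-z.1, z.2) with hr
    have rpr : ∀ p, pr (sgn2 (-1) 1 p) = r (pr p) := by
      intro p; simp [pr, sgn2, hr]
    have e : ∀ z, desc (fun p => sgn2 (-1) 1 (T.G (sgn2 (-1) 1 p))) z = r (T.g (r z)) := by
      intro z
      obtain ⟨p, rfl⟩ := pr_surj z
      rw [desc_pr, rpr, ← g_pr, rpr]
      intro p
      have h := T.perG (sgn2 (-1) 1 (p + (1, 0)))
      have e : sgn2 (-1) 1 (p + (1, 0)) + (1, 0) = sgn2 (-1) 1 p := by ext <;> simp [sgn2]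
      rw [e] at h
      rw [h]; ext <;> simp [sgn2]
    have e2 : desc (fun p => sgn2 (-1) 1 (T.G (sgn2 (-1) 1 p))) ⁻¹' s
        = r ⁻¹' (T.g ⁻¹' (r ⁻¹' s)) := by
      ext z; simp [e]
    have h1 : MeasurableSet (r ⁻¹' s) := reflAnn_mp.measurable hs
    rw [e2, reflAnn_mp.measure_preimage (T.g_cont.measurable h1).nullMeasurableSet,
      T.measG _ h1, reflAnn_mp.measure_preimage hs.nullMeasurableSet]

end TwistLift
end

set_option linter.all false
noncomputable section
open MeasureTheory Set Filter Topology Function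

/-! ### Jacobians -/

/-- determinant of a linear map of the plane in coordinates -/
def jac (L : Pl →L[ℝ] Pl) : ℝ := (L (1,0)).1 * (L (0,1)).2 - (L (0,1)).1 * (L (1,0)).2

lemma lin_expand (L : Pl →L[ℝ] Pl) (w : Pl) : L w = w.1 • L (1,0) + w.2 • L (0,1) := by
  rw [← map_smul, ← map_smul, ← map_add]
  congr 1
  ext <;> simp

lemma det_eq_jac (L : Pl →L[ℝ] Pl) : L.det = jac L := by
  unfold ContinuousLinearMap.det jac
  rw [← LinearMap.det_toMatrix (Module.Basis.finTwoProd ℝ), Matrix.det_fin_two]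
  simp [LinearMap.toMatrix_apply]

lemma jac_comp (L M : Pl →L[ℝ] Pl) : jac (L.comp M) = jac L * jac M := by
  unfold jac
  simp only [ContinuousLinearMap.comp_apply]
  rw [lin_expand L (M (1,0)), lin_expand L (M (0,1))]
  simp
  ring

lemma jac_id : jac (ContinuousLinearMap.id ℝ Pl) = 1 := by simp [jac]

lemma jac_continuous : Continuous jac := by
  unfold jac
  fun_prop

/-! ### Differential data of a twist map -/
namespace IsotopySetup
variable (S : IsotopySetup)

lemma F_smooth : ContDiff ℝ 1 S.F := S.Ft_smooth 1 (by simp)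

lemma F_per (p : Pl) : S.F (p + (1, 0)) = S.F p + (1, 0) := S.Ft_periodic 1 p

def G : Pl → Pl := (S.Ft_diffeo 1 (by simp)).choose
lemma G_smooth : ContDiff ℝ 1 S.G := (S.Ft_diffeo 1 (by simp)).choose_spec.1
lemma GF (p : Pl) : S.G (S.F p) = p := (S.Ft_diffeo 1 (by simp)).choose_spec.2.1 p
lemma FG (p : Pl) : S.F (S.G p) = p := (S.Ft_diffeo 1 (by simp)).choose_spec.2.2 p

lemma G_per (p : Pl) : S.G (p + (1, 0)) = S.G p + (1, 0) := by
  have h := S.F_per (S.G p)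
  rw [S.FG] at h
  rw [← h, S.GF]

lemma F_hasF (p : Pl) : HasFDerivAt S.F (fderiv ℝ S.F p) p :=
  (S.F_smooth.differentiable (by simp) p).hasFDerivAt
lemma G_hasF (p : Pl) : HasFDerivAt S.G (fderiv ℝ S.G p) p :=
  (S.G_smooth.differentiable (by simp) p).hasFDerivAt

lemma jac_Ft_ne (t : ℝ) (ht : t ∈ Icc (0:ℝ) 1) (p : Pl) : jac (fderiv ℝ (S.Ft t) p) ≠ 0 := by
  obtain ⟨G, hG, hl, hr⟩ := S.Ft_diffeo t ht
  have h1 : HasFDerivAt (S.Ft t) (fderiv ℝ (S.Ft t) p) p :=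
    ((S.Ft_smooth t ht).differentiable (by simp) p).hasFDerivAt
  have h2 : HasFDerivAt G (fderiv ℝ G (S.Ft t p)) (S.Ft t p) :=
    (hG.differentiable (by simp) _).hasFDerivAt
  have h3 := h2.comp p h1
  have e : G ∘ S.Ft t = id := funext hl
  rw [e] at h3
  have h4 := h3.unique (hasFDerivAt_id p)
  have h5 := congrArg jac h4
  rw [jac_comp, jac_id] at h5
  intro h
  rw [h] at h5; simp at h5

lemma jac_F_pos (p : Pl) : 0 < jac (fderiv ℝ S.F p) := by
  have hc : ContinuousOn (fun t : ℝ => jac (fderiv ℝ (S.Ft t) p)) (Icc 0 1) := by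
    have h1 : ContinuousOn (fun t : ℝ => ((t, p) : ℝ × Pl)) (Icc (0:ℝ) 1) := by fun_prop
    have h2 := S.DFt_cont.comp h1 (fun t ht => ⟨ht, mem_univ _⟩)
    exact jac_continuous.comp_continuousOn h2
  by_contra hneg
  push Not at hneg
  have h0 : jac (fderiv ℝ (S.Ft 0) p) = 1 := by
    rw [S.Ft_zero, fderiv_id]; exact jac_id
  have hiv := intermediate_value_Icc' (zero_le_one' ℝ) hc
  have : (0:ℝ) ∈ Icc (jac (fderiv ℝ (S.Ft 1) p)) (jac (fderiv ℝ (S.Ft 0) p)) :=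
    ⟨hneg, by rw [h0]; exact zero_le_one⟩
  obtain ⟨t, ht, h⟩ := hiv this
  exact S.jac_Ft_ne t ht p h

lemma desc_F : desc S.F = S.f := by
  funext z
  obtain ⟨p, rfl⟩ := pr_surj z
  rw [desc_pr S.F_per]
  exact S.lift_f p

lemma f_inj : Injective S.f := by
  intro z w h
  obtain ⟨p, rfl⟩ := pr_surj z
  obtain ⟨q, rfl⟩ := pr_surj w
  rw [← S.desc_F, desc_pr S.F_per, desc_pr S.F_per] at h
  obtain ⟨n, hn⟩ := pr_eq_iff.1 h
  rw [← per_int S.F_per] at hn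
  have := congrArg S.G hn
  rw [S.GF, S.GF] at this
  exact pr_eq_iff.2 ⟨n, this⟩

lemma f_surj : Surjective S.f := by
  intro z
  obtain ⟨p, rfl⟩ := pr_surj z
  refine ⟨pr (S.G p), ?_⟩
  rw [← S.desc_F, desc_pr S.F_per, S.FG]

end IsotopySetup

lemma pr_mp (a : ℝ) : MeasurePreserving pr (volume.restrict (Ioc a (a+1) ×ˢ univ)) volume := by
  have h := (AddCircle.measurePreserving_mk (1:ℝ) a).prod (MeasurePreserving.id (volume : Measure ℝ))
  have e : (volume.restrict (Ioc a (a+1) ×ˢ (univ : Set ℝ)) : Measure Pl)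
      = (volume.restrict (Ioc a (a+1))).prod volume := by
    rw [Measure.volume_eq_prod, ← Measure.prod_restrict, Measure.restrict_univ]
  rw [e]
  exact h

lemma vol_pr_image (a : ℝ) (s : Set Pl) (hs : IsOpen s) (hsub : s ⊆ Ioo a (a+1) ×ˢ univ) :
    volume (pr '' s) = volume s := by
  have hm : MeasurableSet (pr '' s) := (pr_open s hs).measurableSet
  rw [← (pr_mp a).measure_preimage hm.nullMeasurableSet,
    Measure.restrict_apply (pr_cont.measurable hm)]
  congr 1
  ext p
  constructor
  · rintro ⟨⟨q, hq, hqp⟩, hp⟩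
    obtain ⟨n, hn⟩ := pr_eq_iff.1 hqp
    have hq' := (hsub hq).1
    have hp' := hp.1
    have h1 : p.1 = q.1 + n := by rw [hn]; simp
    have h2 : (n:ℝ) < 1 := by linarith [hp'.2, hq'.1]
    have h3 : (-1:ℝ) < n := by linarith [hp'.1, hq'.2]
    have h4 : n = 0 := by
      have : n < 1 := by exact_mod_cast h2
      have : -1 < n := by exact_mod_cast h3
      omega
    subst h4
    have : p = q := by rw [hn]; ext <;> simp
    rwa [this]
  · intro hp
    exact ⟨⟨p, hp, rfl⟩, ⟨(hsub hp).1.1, (hsub hp).1.2.le⟩, trivial⟩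

lemma small_ball_vertical (p : Pl) (r : ℝ) (hr : r ≤ 1/2) :
    Metric.ball p r ⊆ Ioo (p.1 - 1/2) (p.1 - 1/2 + 1) ×ˢ univ := by
  intro q hq
  have h1 : dist q.1 p.1 < r := lt_of_le_of_lt (le_max_left _ _) (Metric.mem_ball.1 hq)
  rw [Real.dist_eq, abs_lt] at h1
  exact ⟨⟨by linarith [h1.1], by linarith [h1.2]⟩, trivial⟩

namespace IsotopySetup
variable (S : IsotopySetup)

lemma F_open : IsOpenMap S.F :=
  IsOpenMap.of_inverse (f' := S.G) S.G_smooth.continuous S.FG S.GF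

lemma jac_F_one (hpres : MeasurePreserving S.f volume volume) (p : Pl) :
    jac (fderiv ℝ S.F p) = 1 := by
  have hDcont : Continuous (fun q => jac (fderiv ℝ S.F q)) :=
    jac_continuous.comp (S.F_smooth.continuous_fderiv (by simp))
  -- measure of small balls
  obtain ⟨r, hr0, hr⟩ : ∃ r > 0, ∀ q ∈ Metric.ball p r, S.F q ∈ Metric.ball (S.F p) (1/2) := by
    have := Metric.continuous_iff.1 S.F_smooth.continuous p (1/2) (by norm_num)
    exact this
  have key : ∀ s ≤ min r (1/2), 
      ∫⁻ q in Metric.ball p s, ENNReal.ofReal (jac (fderiv ℝ S.F q)) = volume (Metric.ball p s) := by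
    intro s hs
    have h1 := lintegral_abs_det_fderiv_eq_addHaar_image (μ := (volume : Measure Pl))
      (s := Metric.ball p s) (f := S.F) (f' := fderiv ℝ S.F) measurableSet_ball
      (fun x _ => (S.F_hasF x).hasFDerivWithinAt) (LeftInverse.injective S.GF).injOn
    have h2 : ∀ q, |(fderiv ℝ S.F q).det| = jac (fderiv ℝ S.F q) := by
      intro q; rw [det_eq_jac, abs_of_pos (S.jac_F_pos q)]
    simp only [h2] at h1
    rw [h1]
    have hsub1 : Metric.ball p s ⊆ Ioo (p.1 - 1/2) (p.1 - 1/2 + 1) ×ˢ univ :=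
      small_ball_vertical p s (hs.trans (min_le_right _ _))
    have hsub2 : S.F '' Metric.ball p s ⊆ Ioo ((S.F p).1 - 1/2) ((S.F p).1 - 1/2 + 1) ×ˢ univ := by
      rintro _ ⟨q, hq, rfl⟩
      exact small_ball_vertical (S.F p) (1/2) le_rfl
        (hr q (Metric.ball_subset_ball (hs.trans (min_le_left _ _)) hq))
    rw [← vol_pr_image _ _ Metric.isOpen_ball hsub1,
      ← vol_pr_image _ _ (S.F_open _ Metric.isOpen_ball) hsub2]
    have e : pr '' (S.F '' Metric.ball p s) = S.f '' (pr '' Metric.ball p s) := by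
      rw [image_image, image_image]
      apply image_congr
      intro q _
      exact S.lift_f q
    rw [e]
    have hm : MeasurableSet (S.f '' (pr '' Metric.ball p s)) := by
      rw [← e]; exact (pr_open _ (S.F_open _ Metric.isOpen_ball)).measurableSet
    rw [← hpres.measure_preimage hm.nullMeasurableSet, preimage_image_eq _ S.f_inj]
  by_contra hne
  have hvol : ∀ s, 0 < s → volume (Metric.ball p s) ≠ 0 := fun s hs =>
    (Metric.measure_ball_pos _ _ hs).ne'
  have hvol' : ∀ s, volume (Metric.ball p s) ≠ ⊤ := fun s => measure_ball_lt_top.ne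
  rcases lt_or_gt_of_ne hne with h | h
  · obtain ⟨c, hc1, hc2⟩ := exists_between h
    obtain ⟨s, hs0, hs⟩ := Metric.eventually_nhds_iff.1
      (hDcont.continuousAt.eventually_lt (continuousAt_const (y := c)) hc1)
    have hm : 0 < min s (min r (1/2)) := by positivity
    have hk := key (min s (min r (1/2))) (min_le_right _ _)
    set t := min s (min r (1/2))
    have hle : ∫⁻ q in Metric.ball p t, ENNReal.ofReal (jac (fderiv ℝ S.F q))
        ≤ ∫⁻ q in Metric.ball p t, ENNReal.ofReal c := by
      apply setLIntegral_mono measurable_const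
      intro q hq
      exact ENNReal.ofReal_le_ofReal (hs (lt_of_lt_of_le hq (min_le_left _ _))).le
    rw [hk, setLIntegral_const] at hle
    have : ENNReal.ofReal c * volume (Metric.ball p t) < 1 * volume (Metric.ball p t) :=
      (ENNReal.mul_lt_mul_iff_left (hvol t hm) (hvol' t)).2 (by
        rw [← ENNReal.ofReal_one]; exact (ENNReal.ofReal_lt_ofReal_iff one_pos).2 hc2)
    rw [one_mul] at this
    exact absurd hle (not_le.2 this)
  · obtain ⟨c, hc1, hc2⟩ := exists_between h
    obtain ⟨s, hs0, hs⟩ := Metric.eventually_nhds_iff.1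
      ((continuousAt_const (y := c)).eventually_lt hDcont.continuousAt hc2)
    have hm : 0 < min s (min r (1/2)) := by positivity
    have hk := key (min s (min r (1/2))) (min_le_right _ _)
    set t := min s (min r (1/2))
    have hle : ∫⁻ q in Metric.ball p t, ENNReal.ofReal c
        ≤ ∫⁻ q in Metric.ball p t, ENNReal.ofReal (jac (fderiv ℝ S.F q)) := by
      apply setLIntegral_mono (ENNReal.measurable_ofReal.comp hDcont.measurable)
      intro q hq
      exact ENNReal.ofReal_le_ofReal (hs (lt_of_lt_of_le hq (min_le_left _ _))).le
    rw [hk, setLIntegral_const] at hle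
    have : 1 * volume (Metric.ball p t) < ENNReal.ofReal c * volume (Metric.ball p t) :=
      (ENNReal.mul_lt_mul_iff_left (hvol t hm) (hvol' t)).2 (by
        rw [← ENNReal.ofReal_one]
        exact (ENNReal.ofReal_lt_ofReal_iff (by linarith)).2 hc1)
    rw [one_mul] at this
    exact absurd hle (not_le.2 this)

lemma hasDerivAt_vert (p : Pl) :
    HasDerivAt (fun y => S.F (p.1, y)) (fderiv ℝ S.F p (0,1)) p.2 := by
  have h1 : HasDerivAt (fun y : ℝ => ((p.1, y) : Pl)) (0,1) p.2 :=
    (hasDerivAt_const _ _).prodMk (hasDerivAt_id _)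
  exact (S.F_hasF p).comp_hasDerivAt p.2 h1

lemma hasDerivAt_vertG (p : Pl) :
    HasDerivAt (fun y => S.G (p.1, y)) (fderiv ℝ S.G p (0,1)) p.2 := by
  have h1 : HasDerivAt (fun y : ℝ => ((p.1, y) : Pl)) (0,1) p.2 :=
    (hasDerivAt_const _ _).prodMk (hasDerivAt_id _)
  exact (S.G_hasF p).comp_hasDerivAt p.2 h1

lemma beta_pos (ht : S.PosTwist) (p : Pl) : 0 < (fderiv ℝ S.F p (0,1)).1 := by
  have h := (ht p.1).2.2 p.2
  have h2 : HasDerivAt (fun y => (S.F (p.1, y)).1) (fderiv ℝ S.F p (0,1)).1 p.2 := (S.hasDerivAt_vert p).fst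
  rwa [h2.deriv] at h

lemma DG_comp (p : Pl) : (fderiv ℝ S.G (S.F p)).comp (fderiv ℝ S.F p) = ContinuousLinearMap.id ℝ Pl := by
  have h3 := (S.G_hasF (S.F p)).comp p (S.F_hasF p)
  have e : S.G ∘ S.F = id := funext S.GF
  rw [e] at h3
  exact h3.unique (hasFDerivAt_id p)

lemma DF_comp (p : Pl) : (fderiv ℝ S.F (S.G p)).comp (fderiv ℝ S.G p) = ContinuousLinearMap.id ℝ Pl := by
  have h3 := (S.F_hasF (S.G p)).comp p (S.G_hasF p)
  have e : S.F ∘ S.G = id := funext S.FG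
  rw [e] at h3
  exact h3.unique (hasFDerivAt_id p)

lemma betaG_neg (ht : S.PosTwist) (p : Pl) : (fderiv ℝ S.G p (0,1)).1 < 0 := by
  have h := S.DF_comp p
  have hj := S.jac_F_pos (S.G p)
  have hb := S.beta_pos ht (S.G p)
  set L := fderiv ℝ S.F (S.G p)
  have h1 : L (fderiv ℝ S.G p (0,1)) = (0,1) := by
    have := congrArg (fun M : Pl →L[ℝ] Pl => M (0,1)) h
    simpa using this
  rw [lin_expand] at h1
  set u := fderiv ℝ S.G p (0,1)
  have e1 : u.1 * (L (1,0)).1 + u.2 * (L (0,1)).1 = 0 := by simpa using congrArg Prod.fst h1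
  have e2 : u.1 * (L (1,0)).2 + u.2 * (L (0,1)).2 = 1 := by simpa using congrArg Prod.snd h1
  have e3 : u.1 * jac L = - (L (0,1)).1 := by
    unfold jac
    linear_combination (L (0,1)).2 * e1 - (L (0,1)).1 * e2
  by_contra hu
  push Not at hu
  have := mul_nonneg hu hj.le
  linarith

lemma itw (ht : S.PosTwist) (x : ℝ) : StrictAnti (fun y => (S.G (x, y)).1) := by
  apply strictAnti_of_deriv_neg
  intro y
  have h2 : HasDerivAt (fun y => (S.G (x, y)).1) (fderiv ℝ S.G (x,y) (0,1)).1 y :=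
    (S.hasDerivAt_vertG (x,y)).fst
  rw [h2.deriv]
  exact S.betaG_neg ht _

lemma bdd_of_per {H : Pl → Pl} (hc : Continuous H) (hper : ∀ p : Pl, H (p + (1, 0)) = H p + (1, 0))
    (M : ℝ) : ∃ B, ∀ p : Pl, |p.2| ≤ M → |(H p).2| ≤ B ∧ |(H p).1 - p.1| ≤ B := by
  have hK : IsCompact (Icc (0:ℝ) 1 ×ˢ Icc (-M) M) := isCompact_Icc.prod isCompact_Icc
  obtain ⟨B, hB⟩ := (hK.image (f := fun p => ((H p).2, (H p).1 - p.1))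
    (by fun_prop)).isBounded.exists_norm_le
  refine ⟨B, fun p hp => ?_⟩
  obtain ⟨n, hn⟩ := exists_shift p
  have h1 := hB _ (mem_image_of_mem _ (show p + ((n:ℝ),0) ∈ Icc (0:ℝ) 1 ×ˢ Icc (-M) M from
    ⟨hn, by simpa using abs_le.1 hp⟩))
  rw [per_int hper, Prod.norm_def] at h1
  simp at h1
  exact h1

lemma ends_of_lift {H K : Pl → Pl} (hH : Continuous H) (hK : Continuous K) (hKH : ∀ p, K (H p) = p)
    (hper : ∀ p : Pl, K (p + (1, 0)) = K p + (1, 0)) 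
    (htop : ∃ c, ∀ m, ∃ p : Pl, m ≤ p.2 ∧ c ≤ (H p).2) (hbot : ∃ c, ∀ m, ∃ p : Pl, p.2 ≤ m ∧ (H p).2 ≤ c)
    (M : ℝ) : ∃ M', ∀ p : Pl, (M' ≤ p.2 → M ≤ (H p).2) ∧ (p.2 ≤ -M' → (H p).2 ≤ -M) := by
  obtain ⟨c1, h1⟩ := htop
  obtain ⟨c2, h2⟩ := hbot
  set M1 := |M| + |c1| + |c2| + 1 with hM1
  obtain ⟨B, hB⟩ := bdd_of_per hK hper M1
  have hfar : ∀ p : Pl, B < |p.2| → M1 < |(H p).2| := by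
    intro p hp
    by_contra hcon
    push Not at hcon
    have := (hB _ hcon).1
    rw [hKH] at this
    linarith
  have a0 := abs_nonneg M; have a1 := abs_nonneg c1; have a2 := abs_nonneg c2
  have b0 := le_abs_self M; have b1 := neg_abs_le c1; have b2 := le_abs_self c2
  have hBB := le_abs_self B
  have hcs : Continuous (fun p : Pl => (H p).2) := by fun_prop
  refine ⟨|B| + 1, fun p => ⟨fun hp => ?_, fun hp => ?_⟩⟩
  · have hconn : IsPreconnected {q : Pl | |B| + 1 ≤ q.2} := by
      have : {q : Pl | |B| + 1 ≤ q.2} = univ ×ˢ Ici (|B|+1) := by ext; simp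
      rw [this]; exact isPreconnected_univ.prod isPreconnected_Ici
    obtain ⟨q, hq1, hq2⟩ := h1 (|B|+1)
    by_contra hcon
    push Not at hcon
    have hp' := hfar p (by have := le_abs_self p.2; linarith)
    have hpneg : (H p).2 ≤ 0 := by
      rcases abs_cases (H p).2 with h | h <;> linarith
    have hq' := hfar q (by have := le_abs_self q.2; linarith)
    have hqpos : 0 ≤ (H q).2 := by
      rcases abs_cases (H q).2 with h | h <;> linarith
    obtain ⟨r, hr, hr0⟩ := hconn.intermediate_value hp hq1 hcs.continuousOn ⟨hpneg, hqpos⟩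
    have := hfar r (by have := le_abs_self r.2; have hr' : |B| + 1 ≤ r.2 := hr; linarith)
    simp only at hr0
    rw [hr0] at this
    simp at this; linarith
  · have hconn : IsPreconnected {q : Pl | q.2 ≤ -(|B| + 1)} := by
      have : {q : Pl | q.2 ≤ -(|B| + 1)} = univ ×ˢ Iic (-(|B|+1)) := by ext; simp
      rw [this]; exact isPreconnected_univ.prod isPreconnected_Iic
    obtain ⟨q, hq1, hq2⟩ := h2 (-(|B|+1))
    by_contra hcon
    push Not at hcon
    have hp' := hfar p (by have := neg_le_abs p.2; linarith)
    have hpneg : 0 ≤ (H p).2 := by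
      rcases abs_cases (H p).2 with h | h <;> linarith
    have hq' := hfar q (by have := neg_le_abs q.2; linarith)
    have hqpos : (H q).2 ≤ 0 := by
      rcases abs_cases (H q).2 with h | h <;> linarith
    obtain ⟨r, hr, hr0⟩ := hconn.intermediate_value hq1 hp hcs.continuousOn ⟨hqpos, hpneg⟩
    have := hfar r (by have := neg_le_abs r.2; have hr' : r.2 ≤ -(|B| + 1) := hr; linarith)
    simp only at hr0
    rw [hr0] at this
    simp at this; linarith

lemma eta_step (ht : S.PosTwist) (y y' : ℝ) (h : (S.F (0,y')).1 = (S.F (0,y)).1 + 1) :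
    (S.F (0,y)).2 < (S.F (0,y')).2 := by
  have e1 := S.GF (0,y')
  have e2 : S.G ((S.F (0,y')).1, (S.F (0,y)).2) = (1, y) := by
    have := S.G_per (S.F (0,y))
    rw [S.GF] at this
    have e3 : (((S.F (0,y)).1 + 1, (S.F (0,y)).2) : Pl) = S.F (0,y) + (1,0) := by ext <;> simp
    rw [h, e3, this]
    ext <;> simp
  by_contra hcon
  push Not at hcon
  have h1 := (S.itw ht (S.F (0,y')).1).antitone hcon
  simp only [Prod.mk.eta] at h1
  rw [e2, e1] at h1
  simp at h1; linarith

lemma endF (ht : S.PosTwist) (M : ℝ) : ∃ M', ∀ p : Pl,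
    (M' ≤ p.2 → M ≤ (S.F p).2) ∧ (p.2 ≤ -M' → (S.F p).2 ≤ -M) := by
  choose Y hY using fun n : ℤ => (ht 0).2.1 (n : ℝ)
  simp only at hY
  have hstep : ∀ n : ℤ, (S.F (0, Y n)).2 < (S.F (0, Y (n+1))).2 := by
    intro n
    apply S.eta_step ht
    rw [hY, hY]; push_cast; ring
  have hmono : StrictMono (fun n : ℤ => (S.F (0, Y n)).2) := strictMono_int_of_lt_succ hstep
  have hlarge : ∀ m : ℝ, ∃ n : ℤ, 0 ≤ n ∧ m ≤ Y n := by
    intro m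
    obtain ⟨n, hn⟩ := exists_int_gt (S.F (0, m)).1
    refine ⟨max n 0, le_max_right _ _, ?_⟩
    by_contra hcon
    push Not at hcon
    have := (ht 0).1 hcon
    simp only at this
    rw [hY] at this
    have h2 : (n:ℝ) ≤ ((max n 0 : ℤ) : ℝ) := by exact_mod_cast le_max_left _ _
    linarith
  have hsmall : ∀ m : ℝ, ∃ n : ℤ, n ≤ 0 ∧ Y n ≤ m := by
    intro m
    obtain ⟨n, hn⟩ := exists_int_lt (S.F (0, m)).1
    refine ⟨min n 0, min_le_right _ _, ?_⟩
    by_contra hcon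
    push Not at hcon
    have := (ht 0).1 hcon
    simp only at this
    rw [hY] at this
    have h2 : ((min n 0 : ℤ) : ℝ) ≤ (n:ℝ) := by exact_mod_cast min_le_left _ _
    linarith
  apply ends_of_lift S.F_smooth.continuous S.G_smooth.continuous S.GF S.G_per
  · refine ⟨(S.F (0, Y 0)).2, fun m => ?_⟩
    obtain ⟨n, hn, hm⟩ := hlarge m
    exact ⟨(0, Y n), hm, hmono.monotone hn⟩
  · refine ⟨(S.F (0, Y 0)).2, fun m => ?_⟩
    obtain ⟨n, hn, hm⟩ := hsmall m
    exact ⟨(0, Y n), hm, hmono.monotone hn⟩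

lemma endG (ht : S.PosTwist) (M : ℝ) : ∃ M', ∀ p : Pl,
    (M' ≤ p.2 → M ≤ (S.G p).2) ∧ (p.2 ≤ -M' → (S.G p).2 ≤ -M) := by
  obtain ⟨M0, h0⟩ := S.endF ht 0
  apply ends_of_lift S.G_smooth.continuous S.F_smooth.continuous S.FG S.F_per
  · refine ⟨0, fun m => ?_⟩
    obtain ⟨M1, h1⟩ := S.endF ht m
    refine ⟨S.F (0, max M1 0), (h1 _).1 (le_max_left _ _), ?_⟩
    rw [S.GF]; exact le_max_right _ _
  · refine ⟨0, fun m => ?_⟩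
    obtain ⟨M1, h1⟩ := S.endF ht (-m)
    refine ⟨S.F (0, min (-M1) 0), ?_, ?_⟩
    · have := (h1 (0, min (-M1) 0)).2 (min_le_left _ _)
      linarith
    rw [S.GF]; exact min_le_right _ _

/-- The abstract twist data of a twist map. -/
def twistLift (ht : S.PosTwist) (hpres : MeasurePreserving S.f volume volume) : TwistLift where
  F := S.F
  G := S.G
  contF := S.F_smooth.continuous
  contG := S.G_smooth.continuous
  GF := S.GF
  FG := S.FG
  perF := S.F_per
  perG := S.G_per
  tw x := (ht x).1
  itw := S.itw ht
  endF := S.endF ht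
  endG := S.endG ht
  meas s hs := by
    rw [S.desc_F]; exact hpres.measure_preimage hs.nullMeasurableSet

lemma twistLift_f (ht : S.PosTwist) (hpres : MeasurePreserving S.f volume volume) :
    (S.twistLift ht hpres).f = S.f := S.desc_F

end IsotopySetup
end

set_option linter.all false
noncomputable section
open MeasureTheory Set Filter Topology Function

/-! ### Angles -/

/-- unit vector of angle `a` (in turns, counted counterclockwise from the vertical) -/
def dirv (a : ℝ) : Pl := (-Real.sin (2 * Real.pi * a), Real.cos (2 * Real.pi * a))

/-- `a` is an angle of the vector `u` -/
def IsAng (a : ℝ) (u : Pl) : Prop := ∃ r : ℝ, 0 < r ∧ u = r • dirv a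

/-- complex number attached to a vector -/
def toC (u : Pl) : ℂ := ⟨u.2, -u.1⟩

lemma toC_cont : Continuous toC := by
  have : toC = fun u : Pl => (u.2 : ℂ) + (-u.1 : ℝ) * Complex.I := by
    funext u; apply Complex.ext <;> simp [toC]
  rw [this]; fun_prop

lemma toC_ne {u : Pl} (h : u ≠ 0) : toC u ≠ 0 := by
  intro h2
  apply h
  have h3 := congrArg Complex.re h2
  have h4 := congrArg Complex.im h2
  simp [toC] at h3 h4
  ext <;> simp [h3, h4]

lemma isAng_iff_exp {a : ℝ} {u : Pl} : IsAng a u ↔ ∃ c : ℝ, Complex.exp ⟨c, 2 * Real.pi * a⟩ = toC u := by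
  constructor
  · rintro ⟨r, hr, rfl⟩
    refine ⟨Real.log r, ?_⟩
    apply Complex.ext
    · simp [toC, dirv, Complex.exp_re, Real.exp_log hr]
    · simp [toC, dirv, Complex.exp_im, Real.exp_log hr]
  · rintro ⟨c, hc⟩
    refine ⟨Real.exp c, Real.exp_pos c, ?_⟩
    have h1 := congrArg Complex.re hc
    have h2 := congrArg Complex.im hc
    simp [toC, Complex.exp_re, Complex.exp_im] at h1 h2
    ext
    · simp [dirv]; linarith
    · simp [dirv]; linarith

lemma IsAng.ne {a : ℝ} {u : Pl} (h : IsAng a u) : u ≠ 0 := by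
  rintro rfl
  obtain ⟨c, hc⟩ := isAng_iff_exp.1 h
  have : toC 0 = 0 := by simp [toC]; rfl
  rw [this] at hc
  exact Complex.exp_ne_zero _ hc

lemma IsAng.unique {a b : ℝ} {u : Pl} (ha : IsAng a u) (hb : IsAng b u) : ∃ n : ℤ, b = a + n := by
  obtain ⟨c, hc⟩ := isAng_iff_exp.1 ha
  obtain ⟨d, hd⟩ := isAng_iff_exp.1 hb
  rw [← hc, Complex.exp_eq_exp_iff_exists_int] at hd
  obtain ⟨n, hn⟩ := hd
  refine ⟨n, ?_⟩
  have := congrArg Complex.im hn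
  simp at this
  have hp := Real.pi_pos
  have e : 2 * Real.pi * (b - (a + n)) = 0 := by linarith
  have : b - (a + n) = 0 := by
    rcases mul_eq_zero.1 e with h | h
    · linarith
    · exact h
  linarith

lemma dirv_add_int (a : ℝ) (n : ℤ) : dirv (a + n) = dirv a := by
  unfold dirv
  have : 2 * Real.pi * (a + n) = 2 * Real.pi * a + n * (2 * Real.pi) := by ring
  rw [this, Real.sin_add_int_mul_two_pi, Real.cos_add_int_mul_two_pi]

lemma IsAng.add_int {a : ℝ} {u : Pl} (h : IsAng a u) (n : ℤ) : IsAng (a + n) u := by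
  obtain ⟨r, hr, rfl⟩ := h
  exact ⟨r, hr, by rw [dirv_add_int]⟩

lemma IsAng.smul {a : ℝ} {u : Pl} (h : IsAng a u) {c : ℝ} (hc : 0 < c) : IsAng a (c • u) := by
  obtain ⟨r, hr, rfl⟩ := h
  exact ⟨c * r, by positivity, by rw [smul_smul]⟩

lemma isAng_dirv (a : ℝ) : IsAng a (dirv a) := ⟨1, one_pos, by simp⟩

lemma exists_isAng {u : Pl} (h : u ≠ 0) : ∃ a, IsAng a u := by
  refine ⟨(Complex.log (toC u)).im / (2 * Real.pi), isAng_iff_exp.2 ⟨(Complex.log (toC u)).re, ?_⟩⟩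
  have : (2 * Real.pi * ((Complex.log (toC u)).im / (2 * Real.pi))) = (Complex.log (toC u)).im := by
    field_simp
  rw [this, Complex.eta, Complex.exp_log (toC_ne h)]

lemma dirv_cont : Continuous dirv := by unfold dirv; fun_prop
lemma dirv_ne (a : ℝ) : dirv a ≠ 0 := (isAng_dirv a).ne

lemma isAng_left {a : ℝ} {u : Pl} (h : IsAng a u) (k : ℤ) (h1 : (2*k:ℝ) < 2*a) (h2 : 2*a < 2*k+1) : u.1 < 0 := by
  obtain ⟨r, hr, rfl⟩ := h
  have e : dirv a = dirv (a - k) := by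
    have := dirv_add_int (a - k) k
    rw [sub_add_cancel] at this; exact this
  rw [e]
  have : 0 < Real.sin (2 * Real.pi * (a - k)) := by
    have hp := Real.pi_pos
    apply Real.sin_pos_of_pos_of_lt_pi <;> nlinarith
  simp [dirv]
  positivity

lemma isAng_right {a : ℝ} {u : Pl} (h : IsAng a u) (k : ℤ) (h1 : (2*k-1:ℝ) < 2*a) (h2 : 2*a < 2*k) : 0 < u.1 := by
  obtain ⟨r, hr, rfl⟩ := h
  have e : dirv a = dirv (a - k) := by
    have := dirv_add_int (a - k) k
    rw [sub_add_cancel] at this; exact this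
  rw [e]
  have : Real.sin (2 * Real.pi * (a - k)) < 0 := by
    have hp := Real.pi_pos
    apply Real.sin_neg_of_neg_of_neg_pi_lt <;> nlinarith
  simp [dirv]
  nlinarith

lemma isAng_up {a : ℝ} {u : Pl} (h : IsAng a u) (k : ℤ) (h1 : 2*a = 2*k) : u.1 = 0 ∧ 0 < u.2 := by
  obtain ⟨r, hr, rfl⟩ := h
  have e : dirv a = dirv 0 := by
    have := dirv_add_int 0 k
    rw [← this]; congr 1; linarith
  rw [e]
  simp [dirv, hr]

lemma isAng_down {a : ℝ} {u : Pl} (h : IsAng a u) (k : ℤ) (h1 : 2*a = 2*k+1) : u.1 = 0 ∧ u.2 < 0 := by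
  obtain ⟨r, hr, rfl⟩ := h
  have e : dirv a = dirv (1/2) := by
    have := dirv_add_int (1/2) k
    rw [← this]; congr 1; linarith
  have e2 : 2 * Real.pi * (1/2) = Real.pi := by ring
  rw [e]
  simp only [dirv, e2]
  simp [hr]

/-- Lifting of angles along homotopies. -/
lemma lift_ang {A : Type*} [TopologicalSpace A] (u : C(unitInterval × A, Pl)) (hu : ∀ x, u x ≠ 0)
    (a0 : C(A, ℝ)) (h0 : ∀ x, IsAng (a0 x) (u (0, x))) :
    ∃ a : C(unitInterval × A, ℝ), (∀ x, IsAng (a x) (u x)) ∧ ∀ x, a (0, x) = a0 x := by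
  let H : C(unitInterval × A, {z : ℂ // z ≠ 0}) :=
    ⟨fun x => ⟨toC (u x), toC_ne (hu x)⟩, by
      exact Continuous.subtype_mk (toC_cont.comp u.continuous) _⟩
  let l0 : C(A, ℂ) := ⟨fun x => ((Real.log ‖toC (u (0,x))‖ : ℝ) : ℂ) + ((2 * Real.pi * a0 x : ℝ) : ℂ) * Complex.I, by
    have h1 : Continuous fun x => toC (u (0,x)) := toC_cont.comp (by fun_prop)
    have h2 : Continuous fun x => Real.log ‖toC (u (0,x))‖ :=
      h1.norm.log (fun x => norm_ne_zero_iff.2 (toC_ne (hu _)))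
    fun_prop⟩
  have hl : ∀ x, H (0, x) = (fun z : ℂ => (⟨Complex.exp z, Complex.exp_ne_zero z⟩ : {z : ℂ // z ≠ 0})) (l0 x) := by
    intro x
    apply Subtype.ext
    obtain ⟨c, hc⟩ := isAng_iff_exp.1 (h0 x)
    have hn : Real.log ‖toC (u (0,x))‖ = c := by
      rw [← hc, Complex.norm_exp, Real.log_exp]
    show toC (u (0,x)) = Complex.exp (((Real.log ‖toC (u (0,x))‖ : ℝ) : ℂ) + ((2 * Real.pi * a0 x : ℝ) : ℂ) * Complex.I)
    rw [hn, ← hc]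
    congr 1
    apply Complex.ext <;> simp
  let L := Complex.isCoveringMap_exp.liftHomotopy H l0 hl
  have hL1 := Complex.isCoveringMap_exp.liftHomotopy_lifts H l0 hl
  have hL0 := Complex.isCoveringMap_exp.liftHomotopy_zero H l0 hl
  refine ⟨⟨fun x => (L x).im / (2 * Real.pi), by fun_prop⟩, fun x => ?_, fun x => ?_⟩
  · refine isAng_iff_exp.2 ⟨(L x).re, ?_⟩
    have e : (2 * Real.pi * ((L x).im / (2 * Real.pi))) = (L x).im := by field_simp
    have := congrArg Subtype.val (congrFun hL1 x)
    simp only [ContinuousMap.coe_mk, e, Complex.eta]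
    exact this
  · have : L (0, x) = l0 x := hL0 x
    simp [this, l0]

/-- The relation between directions before and after a positive twist map. -/
def Allowed (u u' : Pl) : Prop :=
  (u.1 = 0 → 0 < u.2 → 0 < u'.1) ∧ (u.1 = 0 → u.2 < 0 → u'.1 < 0) ∧
  (u'.1 = 0 → 0 < u'.2 → u.1 < 0) ∧ (u'.1 = 0 → u'.2 < 0 → 0 < u.1)

/-- The relation between properly lifted angles. -/
def Good (a a' : ℝ) : Prop := ∃ k : ℤ,
  ((k:ℝ) < 2*a ∧ 2*a < k+1 ∧ (k-1:ℝ) < 2*a' ∧ 2*a' < k+1) ∨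
  ((k-1:ℝ) < 2*a ∧ 2*a < k+1 ∧ (k-1:ℝ) < 2*a' ∧ 2*a' < k)

lemma good_open : IsOpen {x : ℝ × ℝ | Good x.1 x.2} := by
  have : {x : ℝ × ℝ | Good x.1 x.2} = ⋃ k : ℤ,
    (({x : ℝ × ℝ | (k:ℝ) < 2*x.1} ∩ {x | 2*x.1 < (k:ℝ)+1} ∩ {x | (k-1:ℝ) < 2*x.2} ∩ {x | 2*x.2 < (k:ℝ)+1}) ∪
     ({x : ℝ × ℝ | (k-1:ℝ) < 2*x.1} ∩ {x | 2*x.1 < (k:ℝ)+1} ∩ {x | (k-1:ℝ) < 2*x.2} ∩ {x | 2*x.2 < (k:ℝ)})) := by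
    ext x
    simp only [Good, mem_setOf_eq, mem_iUnion, mem_union, mem_inter_iff, and_assoc]
  rw [this]
  refine isOpen_iUnion fun k => ?_
  refine IsOpen.union ?_ ?_ <;>
  · refine IsOpen.inter (IsOpen.inter (IsOpen.inter ?_ ?_) ?_) ?_ <;>
    exact isOpen_lt (by fun_prop) (by fun_prop)

lemma good_floor {a a' : ℝ} (h : Good a a') :
    (⌊2*a⌋ - 1 : ℝ) < 2*a' ∧ 2*a' < ⌊2*a⌋ + 1 ∧ (2*a = ⌊2*a⌋ → 2*a' < ⌊2*a⌋) := by
  obtain ⟨k, ⟨h1, h2, h3, h4⟩ | ⟨h1, h2, h3, h4⟩⟩ := h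
  · have : ⌊2*a⌋ = k := Int.floor_eq_iff.2 ⟨h1.le, h2⟩
    rw [this]
    exact ⟨h3, h4, fun h => absurd h (by linarith)⟩
  · by_cases hk : (k:ℝ) ≤ 2*a
    · have : ⌊2*a⌋ = k := Int.floor_eq_iff.2 ⟨hk, h2⟩
      rw [this]
      exact ⟨h3, by linarith, fun h => h4⟩
    · push Not at hk
      have : ⌊2*a⌋ = k - 1 := Int.floor_eq_iff.2 ⟨by push_cast; linarith, by push_cast; linarith⟩
      rw [this]
      push_cast
      exact ⟨by linarith, by linarith, fun h => absurd h (by linarith)⟩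

lemma good_shift {a a' : ℝ} (h : Good a a') (n : ℤ) : Good (a + n) (a' + n) := by
  obtain ⟨k, h⟩ := h
  refine ⟨k + 2*n, ?_⟩
  push_cast
  rcases h with ⟨h1, h2, h3, h4⟩ | ⟨h1, h2, h3, h4⟩
  · left; refine ⟨?_, ?_, ?_, ?_⟩ <;> linarith
  · right; refine ⟨?_, ?_, ?_, ?_⟩ <;> linarith

lemma good_le_zero {a a' : ℝ} (h : Good a a') (ha : a ≤ 0) : a' < 0 := by
  obtain ⟨h1, h2, h3⟩ := good_floor h
  have hk : ⌊2*a⌋ ≤ 0 := by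
    have : ⌊2*a⌋ ≤ ⌊(0:ℝ)⌋ := Int.floor_le_floor (by linarith)
    simpa using this
  rcases eq_or_lt_of_le hk with hk | hk
  · rw [hk] at h3
    have := Int.floor_le (2*a)
    rw [hk] at this
    push_cast at *
    have := h3 (by linarith)
    linarith
  · have : ⌊2*a⌋ + 1 ≤ 0 := hk
    have : (⌊2*a⌋ + 1 : ℝ) ≤ 0 := by exact_mod_cast this
    linarith

lemma exists_good {a a' : ℝ} {u u' : Pl} (h : Allowed u u') (ha : IsAng a u) (ha' : IsAng a' u') :
    ∃ n : ℤ, Good a (a' - n) := by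
  set k := ⌊2*a⌋ with hk
  have hk1 := Int.floor_le (2*a)
  have hk2 := Int.lt_floor_add_one (2*a)
  rw [← hk] at hk1 hk2
  obtain ⟨n, hn1, hn2⟩ : ∃ n : ℤ, (k-1:ℝ) ≤ 2*(a' - n) ∧ 2*(a' - n) < k+1 := by
    refine ⟨⌊a' - (k-1)/2⌋, ?_, ?_⟩
    · have := Int.floor_le (a' - (k-1)/2); linarith
    · have := Int.lt_floor_add_one (a' - (k-1)/2); linarith
  refine ⟨n, ?_⟩
  have hb : IsAng (a' - n) u' := by
    have := ha'.add_int (-n); push_cast at this; rwa [← sub_eq_add_neg] at this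
  set b := a' - n
  obtain ⟨m, hm⟩ := Int.even_or_odd' k
  rcases eq_or_lt_of_le hk1 with hk1 | hk1
  · -- vertical case
    refine ⟨k, Or.inr ⟨by linarith, by linarith, ?_, ?_⟩⟩ 
    · -- k-1 < 2b
      rcases eq_or_lt_of_le hn1 with hn | hn
      · exfalso
        rcases hm with hm | hm
        · have hu := isAng_up ha m (by rw [← hk1, hm]; push_cast; ring)
          have hd := isAng_down hb (m-1) (by rw [← hn, hm]; push_cast; ring)
          have := h.1 hu.1 hu.2
          linarith [hd.1]
        · have hu := isAng_down ha m (by rw [← hk1, hm]; push_cast; ring)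
          have hd := isAng_up hb m (by rw [← hn, hm]; push_cast; ring)
          have := h.2.1 hu.1 hu.2
          linarith [hd.1]
      · exact hn
    · by_contra hcon
      push Not at hcon
      rcases hm with hm | hm
      · have hu := isAng_up ha m (by rw [← hk1, hm]; push_cast; ring)
        have := h.1 hu.1 hu.2
        rw [hm] at hcon hn2
        push_cast at hcon hn2
        rcases eq_or_lt_of_le hcon with hc | hc
        · have := (isAng_up hb m hc.symm).1; linarith
        · have := isAng_left hb m hc hn2; linarith
      · have hu := isAng_down ha m (by rw [← hk1, hm]; push_cast; ring)
        have := h.2.1 hu.1 hu.2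
        rw [hm] at hcon hn2
        push_cast at hcon hn2
        rcases eq_or_lt_of_le hcon with hc | hc
        · have := (isAng_down hb m hc.symm).1; linarith
        · have := isAng_right hb (m+1) (by push_cast; linarith) (by push_cast; linarith); linarith
  · refine ⟨k, Or.inl ⟨hk1, hk2, ?_, hn2⟩⟩
    rcases eq_or_lt_of_le hn1 with hn | hn
    · exfalso
      rcases hm with hm | hm
      · rw [hm] at hk1 hk2 hn
        push_cast at hk1 hk2 hn
        have hl := isAng_left ha m hk1 hk2
        have hd := isAng_down hb (m-1) (by push_cast; linarith)
        have := h.2.2.2 hd.1 hd.2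
        linarith
      · rw [hm] at hk1 hk2 hn
        push_cast at hk1 hk2 hn
        have hl := isAng_right ha (m+1) (by push_cast; linarith) (by push_cast; linarith)
        have hd := isAng_up hb m (by linarith)
        have := h.2.2.1 hd.1 hd.2
        linarith
    · exact hn

lemma good_unique {a b : ℝ} {n m : ℤ} (h1 : Good a (b - n)) (h2 : Good a (b - m)) : n = m := by
  obtain ⟨p1, p2, -⟩ := good_floor h1
  obtain ⟨q1, q2, -⟩ := good_floor h2
  have e1 : (n:ℝ) - m < 1 := by linarith
  have e2 : (m:ℝ) - n < 1 := by linarith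
  have e1' : n - m < 1 := by exact_mod_cast e1
  have e2' : m - n < 1 := by exact_mod_cast e2
  omega

/-- Goodness propagates on connected families. -/
lemma good_conn {X : Type*} [TopologicalSpace X] [PreconnectedSpace X] {θ θ' : X → ℝ}
    {u u' : X → Pl} (hθ : Continuous θ) (hθ' : Continuous θ') (hu : ∀ x, IsAng (θ x) (u x))
    (hu' : ∀ x, IsAng (θ' x) (u' x)) (hall : ∀ x, Allowed (u x) (u' x)) (x0 : X)
    (h0 : Good (θ x0) (θ' x0)) (x : X) : Good (θ x) (θ' x) := by
  have hopen : ∀ n : ℤ, IsOpen {x | Good (θ x) (θ' x - n)} := fun n =>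
    good_open.preimage (f := fun x => (θ x, θ' x - n)) (by fun_prop)
  have hcl : IsClopen {x | Good (θ x) (θ' x - (0:ℤ))} := by
    refine ⟨⟨?_⟩, hopen 0⟩
    have : {x | Good (θ x) (θ' x - (0:ℤ))}ᶜ = ⋃ n : {n : ℤ // n ≠ 0}, {x | Good (θ x) (θ' x - (n:ℤ))} := by
      ext x
      simp only [mem_compl_iff, mem_setOf_eq, mem_iUnion]
      constructor
      · intro h
        obtain ⟨n, hn⟩ := exists_good (hall x) (hu x) (hu' x)
        refine ⟨⟨n, ?_⟩, hn⟩
        rintro rfl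
        exact h hn
      · rintro ⟨n, hn⟩ h
        exact n.2 (good_unique hn h)
    rw [this]
    exact isOpen_iUnion fun n => hopen n
  have huniv := hcl.eq_univ ⟨x0, by simpa using h0⟩
  have : x ∈ {x | Good (θ x) (θ' x - (0:ℤ))} := by rw [huniv]; trivial
  simpa using this

/-- two continuous angle functions which agree at a point agree -/
lemma ang_unique {X : Type*} [TopologicalSpace X] [PreconnectedSpace X] {θ θ' : X → ℝ}
    (hθ : Continuous θ) (hθ' : Continuous θ') (h : ∀ x, ∃ n : ℤ, θ' x = θ x + n) (x0 x : X) :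
    θ' x - θ x = θ' x0 - θ x0 := by
  choose n hn using h
  have hc : Continuous (fun x => ((n x : ℤ) : ℝ)) := by
    have : (fun x => ((n x : ℤ) : ℝ)) = fun x => θ' x - θ x := by funext x; rw [hn]; ring
    rw [this]; fun_prop
  have hc' : Continuous n := Int.isClosedEmbedding_coe_real.isEmbedding.continuous_iff.2 hc
  have := PreconnectedSpace.constant (f := n) inferInstance hc' (x := x) (y := x0)
  rw [hn x, hn x0, this]; ring

lemma TwistLift.allowed (T : TwistLift) {p q : Pl} (h : q ≠ p) : Allowed (q - p) (T.F q - T.F p) := by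
  have hx : ∀ a b : Pl, a.1 - b.1 = 0 → a = (b.1, a.2) := by
    intro a b h; ext
    · simp; linarith
    · rfl
  refine ⟨fun h1 h2 => ?_, fun h1 h2 => ?_, fun h1 h2 => ?_, fun h1 h2 => ?_⟩
  · simp only [Prod.fst_sub, Prod.snd_sub] at *
    have := T.tw p.1 (show p.2 < q.2 by linarith)
    rw [hx q p h1]
    simp only at this ⊢; simpa using this
  · simp only [Prod.fst_sub, Prod.snd_sub] at *
    have := T.tw p.1 (show q.2 < p.2 by linarith)
    rw [hx q p h1]
    simp only at this ⊢; simpa using this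
  · simp only [Prod.fst_sub, Prod.snd_sub] at *
    have h3 := T.itw (T.F p).1 (show (T.F p).2 < (T.F q).2 by linarith)
    simp only [Prod.mk.eta] at h3
    rw [← hx (T.F q) (T.F p) h1, T.GF, T.GF] at h3
    linarith
  · simp only [Prod.fst_sub, Prod.snd_sub] at *
    have h3 := T.itw (T.F p).1 (show (T.F q).2 < (T.F p).2 by linarith)
    simp only [Prod.mk.eta] at h3
    rw [← hx (T.F q) (T.F p) h1, T.GF, T.GF] at h3
    linarith

end

set_option linter.all false
noncomputable section
open MeasureTheory Set Filter Topology Function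

namespace IsotopySetup
variable (S : IsotopySetup)

lemma iter_smooth (n : ℕ) : ContDiff ℝ 1 (S.F^[n]) := by
  induction n with
  | zero => exact contDiff_id
  | succ k ih => rw [iterate_succ']; exact S.F_smooth.comp ih

/-- derivative of the iterates -/
def DN (n : ℕ) (p : Pl) : Pl →L[ℝ] Pl := fderiv ℝ (S.F^[n]) p

lemma DN_has (n : ℕ) (p : Pl) : HasFDerivAt (S.F^[n]) (S.DN n p) p :=
  ((S.iter_smooth n).differentiable (by simp) p).hasFDerivAt

lemma DN_zero (p : Pl) : S.DN 0 p = ContinuousLinearMap.id ℝ Pl := fderiv_id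

lemma DN_succ (n : ℕ) (p : Pl) : S.DN (n+1) p = (fderiv ℝ S.F (S.F^[n] p)).comp (S.DN n p) := by
  have h := (S.F_hasF (S.F^[n] p)).comp p (S.DN_has n p)
  rw [← iterate_succ'] at h
  exact (S.DN_has (n+1) p).unique h

lemma DN_add (n m : ℕ) (p : Pl) : S.DN (m + n) p = (S.DN m (S.F^[n] p)).comp (S.DN n p) := by
  have h := (S.DN_has m (S.F^[n] p)).comp p (S.DN_has n p)
  rw [← iterate_add] at h
  exact (S.DN_has (m+n) p).unique h

lemma DN_succ_apply (n : ℕ) (p w : Pl) : S.DN (n+1) p w = fderiv ℝ S.F (S.F^[n] p) (S.DN n p w) := by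
  rw [DN_succ]; rfl

lemma lin_ne_of_jac {L : Pl →L[ℝ] Pl} (h : jac L ≠ 0) {w : Pl} (hw : w ≠ 0) : L w ≠ 0 := by
  intro h0
  rw [lin_expand] at h0
  have e1 : w.1 * (L (1,0)).1 + w.2 * (L (0,1)).1 = 0 := by simpa using congrArg Prod.fst h0
  have e2 : w.1 * (L (1,0)).2 + w.2 * (L (0,1)).2 = 0 := by simpa using congrArg Prod.snd h0
  have e3 : w.1 * jac L = 0 := by
    unfold jac
    linear_combination (L (0,1)).2 * e1 - (L (0,1)).1 * e2
  have e4 : w.2 * jac L = 0 := by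
    unfold jac
    linear_combination -(L (1,0)).2 * e1 + (L (1,0)).1 * e2
  apply hw
  ext
  · simpa [h] using e3
  · simpa [h] using e4

lemma jac_DN_pos (n : ℕ) (p : Pl) : 0 < jac (S.DN n p) := by
  induction n with
  | zero => rw [DN_zero, jac_id]; exact one_pos
  | succ k ih => rw [DN_succ, jac_comp]; exact mul_pos (S.jac_F_pos _) ih

lemma DN_ne (n : ℕ) (p : Pl) {w : Pl} (hw : w ≠ 0) : S.DN n p w ≠ 0 :=
  lin_ne_of_jac (S.jac_DN_pos n p).ne' hw

lemma allowed_lin (ht : S.PosTwist) (p w : Pl) : Allowed w (fderiv ℝ S.F p w) := by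
  have hb := S.beta_pos ht p
  have hj := S.jac_F_pos p
  set L := fderiv ℝ S.F p
  have e1 : (L w).1 = w.1 * (L (1,0)).1 + w.2 * (L (0,1)).1 := by
    have := congrArg Prod.fst (lin_expand L w); simpa using this
  have e2 : (L w).2 = w.1 * (L (1,0)).2 + w.2 * (L (0,1)).2 := by
    have := congrArg Prod.snd (lin_expand L w); simpa using this
  have e3 : w.1 * jac L = (L (0,1)).2 * (L w).1 - (L (0,1)).1 * (L w).2 := by
    unfold jac; rw [e1, e2]; ring
  refine ⟨fun h1 h2 => ?_, fun h1 h2 => ?_, fun h1 h2 => ?_, fun h1 h2 => ?_⟩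
  · rw [e1, h1]; nlinarith
  · rw [e1, h1]; nlinarith
  · rw [h1] at e3; by_contra hc; push Not at hc; nlinarith [mul_nonneg hc hj.le, mul_pos hb h2]
  · rw [h1] at e3; by_contra hc; push Not at hc
    have := mul_nonneg (neg_nonneg.2 hc) hj.le
    nlinarith [mul_neg_of_pos_of_neg hb h2]

lemma Ft_has (t : ℝ) (ht : t ∈ Icc (0:ℝ) 1) (p : Pl) :
    HasFDerivAt (S.Ft t) (fderiv ℝ (S.Ft t) p) p :=
  ((S.Ft_smooth t ht).differentiable (by simp) p).hasFDerivAt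

/-- averaged difference quotients of the isotopy -/
def dq (p : Pl) (x : unitInterval × (ℝ × unitInterval)) : Pl :=
  ∫ s in (0:ℝ)..1, fderiv ℝ (S.Ft x.1) (p + (s * (x.2.2 : ℝ)) • dirv x.2.1) (dirv x.2.1)

lemma dq_cont (p : Pl) : Continuous (S.dq p) := by
  unfold dq
  apply intervalIntegral.continuous_parametric_intervalIntegral_of_continuous'
  have h1 : Continuous (fun q : (unitInterval × (ℝ × unitInterval)) × ℝ =>
      (((q.1.1 : ℝ), p + (q.2 * (q.1.2.2 : ℝ)) • dirv q.1.2.1) : ℝ × Pl)) := by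
    have := dirv_cont
    fun_prop
  have h2 := S.DFt_cont.comp_continuous h1 (fun q => ⟨q.1.1.2, mem_univ _⟩)
  have h3 : Continuous (fun q : (unitInterval × (ℝ × unitInterval)) × ℝ => dirv q.1.2.1) :=
    dirv_cont.comp (by fun_prop)
  exact h2.clm_apply h3

lemma dq_eps_zero (p : Pl) (t : unitInterval) (α : ℝ) :
    S.dq p (t, (α, 0)) = fderiv ℝ (S.Ft t) p (dirv α) := by
  simp [dq]

lemma dq_eps (p : Pl) (t : unitInterval) (α : ℝ) (ε : unitInterval) :
    (ε:ℝ) • S.dq p (t, (α, ε)) = S.Ft t (p + (ε:ℝ) • dirv α) - S.Ft t p := by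
  unfold dq
  rw [← intervalIntegral.integral_smul]
  have h : ∀ s ∈ uIcc (0:ℝ) 1, HasDerivAt (fun s : ℝ => S.Ft t (p + (s * (ε:ℝ)) • dirv α))
      ((ε:ℝ) • fderiv ℝ (S.Ft t) (p + (s * (ε : ℝ)) • dirv α) (dirv α)) s := by
    intro s _
    have h1 : HasDerivAt (fun s : ℝ => p + (s * (ε:ℝ)) • dirv α) ((ε:ℝ) • dirv α) s := by
      have := (((hasDerivAt_id s).mul_const (ε:ℝ)).smul_const (dirv α)).const_add p
      simpa using this
    have := (S.Ft_has t t.2 (p + (s * (ε:ℝ)) • dirv α)).comp_hasDerivAt s h1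
    rwa [map_smul] at this
  have hc : Continuous (fun s : ℝ => (ε:ℝ) • fderiv ℝ (S.Ft t) (p + (s * (ε : ℝ)) • dirv α) (dirv α)) := by
    have h1 := (S.Ft_smooth t t.2).continuous_fderiv (by simp)
    have h2 : Continuous (fun s : ℝ => fderiv ℝ (S.Ft t) (p + (s * (ε : ℝ)) • dirv α)) :=
      h1.comp (by fun_prop)
    exact (h2.clm_apply continuous_const).const_smul (ε:ℝ)
  rw [intervalIntegral.integral_eq_sub_of_hasDerivAt h (hc.intervalIntegrable _ _)]
  simp

lemma Ft_inj (t : ℝ) (ht : t ∈ Icc (0:ℝ) 1) : Injective (S.Ft t) := by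
  obtain ⟨G, hG, hl, hr⟩ := S.Ft_diffeo t ht
  exact hl.injective

lemma dq_ne (p : Pl) (x : unitInterval × (ℝ × unitInterval)) : S.dq p x ≠ 0 := by
  obtain ⟨t, α, ε⟩ := x
  by_cases hε : ε = 0
  · subst hε
    rw [dq_eps_zero]
    exact lin_ne_of_jac (S.jac_Ft_ne t t.2 p) (dirv_ne α)
  · intro h
    have h2 := S.dq_eps p t α ε
    rw [h, smul_zero] at h2
    have h3 := S.Ft_inj t t.2 (sub_eq_zero.1 h2.symm)
    have h4 : (ε:ℝ) • dirv α = 0 := by simpa using h3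
    rcases smul_eq_zero.1 h4 with h5 | h5
    · exact hε (Subtype.ext h5)
    · exact dirv_ne α h5

lemma dirv_quarter : dirv (-1/4) = (1, 0) := by
  unfold dirv
  have : 2 * Real.pi * (-1/4) = -(Real.pi/2) := by ring
  rw [this]; simp

lemma iso_good_aux (T : TwistLift) (hT : T.F = S.F) (ht : S.PosTwist) (p : Pl) :
    ∃ a : C(unitInterval × (ℝ × unitInterval), ℝ), (∀ x, IsAng (a x) (S.dq p x)) ∧
      (∀ x, a (0, x) = x.1) ∧ ∀ x, Good (a (0,x)) (a (1,x)) := by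
  have h00 : ∀ α (ε : unitInterval), S.dq p (0, (α, ε)) = dirv α := by
    intro α ε
    unfold dq
    simp [S.Ft_zero, fderiv_id]
  obtain ⟨a, ha, ha0⟩ := lift_ang ⟨S.dq p, S.dq_cont p⟩ (S.dq_ne p) ⟨fun x : ℝ × unitInterval => x.1, by fun_prop⟩
    (by rintro ⟨α, ε⟩; simp only [ContinuousMap.coe_mk, h00]; exact isAng_dirv α)
  refine ⟨a, ha, ha0, ?_⟩
  refine good_conn (X := ℝ × unitInterval) (u := fun x => S.dq p (0,x)) (u' := fun x => S.dq p (1,x))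
    (by fun_prop) (by fun_prop) (fun x => ha _) (fun x => ha _) ?_ (-1/4, 1) ?_
  · rintro ⟨α, ε⟩
    simp only [h00]
    by_cases hε : ε = 0
    · subst hε
      rw [dq_eps_zero]
      exact S.allowed_lin ht p _
    · have hε' : 0 < (ε:ℝ) := lt_of_le_of_ne ε.2.1 (fun h => hε (Subtype.ext h.symm))
      have h1 := S.dq_eps p 1 α ε
      have h2 := T.allowed (p := p) (q := p + (ε:ℝ) • dirv α) (by
        intro h
        have h4 : (ε:ℝ) • dirv α = 0 := by simpa using h
        rcases smul_eq_zero.1 h4 with h5 | h5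
        · exact hε'.ne' h5
        · exact dirv_ne α h5)
      rw [hT] at h2
      have h3 : S.F (p + (ε:ℝ) • dirv α) - S.F p = (ε:ℝ) • S.dq p (1, (α, ε)) := h1.symm
      rw [h3, add_sub_cancel_left] at h2
      set w := S.dq p (1, (α, ε))
      obtain ⟨b1, b2, b3, b4⟩ := h2
      simp only [Prod.smul_fst, Prod.smul_snd, smul_eq_mul, mul_eq_zero, hε'.ne', false_or,
        mul_pos_iff_of_pos_left hε', mul_neg_iff, hε', not_lt.2 hε'.le, true_and, false_and, or_false] at b1 b2 b3 b4
      exact ⟨b1, b2, b3, b4⟩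
  · -- base point
    have hconst : ∀ t : unitInterval, S.dq p (t, (-1/4, 1)) = (1, 0) := by
      intro t
      have := S.dq_eps p t (-1/4) 1
      rw [dirv_quarter] at this
      simp only [Icc.coe_one, one_smul, S.Ft_periodic] at this
      simpa using this
    have hang : ∀ t : unitInterval, IsAng (-1/4) (S.dq p (t, (-1/4, 1))) := by
      intro t; rw [hconst, ← dirv_quarter]; exact isAng_dirv _
    have := ang_unique (X := unitInterval) (θ := fun t => a (t, (-1/4,1))) (θ' := fun _ => (-1/4:ℝ))
      (by fun_prop) (by fun_prop) (fun t => (ha _).unique (hang t)) 0 1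
    have h0 : a (0, (-1/4, 1)) = -1/4 := ha0 _
    simp only [h0] at this
    rw [h0]
    have h1 : a (1, (-1/4, 1)) = -1/4 := by linarith
    rw [h1]
    refine ⟨-1, Or.inl ?_⟩
    norm_num

lemma iso_good (T : TwistLift) (hT : T.F = S.F) (ht : S.PosTwist) (p w : Pl) (Θ : ℝ → ℝ)
    (hΘ : ContinuousOn Θ (Icc 0 1))
    (hang : ∀ t ∈ Icc (0:ℝ) 1, IsAng (Θ t) (fderiv ℝ (S.Ft t) p w)) : Good (Θ 0) (Θ 1) := by
  obtain ⟨a, ha, ha0, hg⟩ := S.iso_good_aux T hT ht p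
  have hw : IsAng (Θ 0) w := by
    have := hang 0 (by simp)
    rw [S.Ft_zero, fderiv_id] at this
    exact this
  obtain ⟨r, hr, hwr⟩ := hw
  have h1 : ∀ t : unitInterval, IsAng (a (t, (Θ 0, 0))) (fderiv ℝ (S.Ft t) p w) := by
    intro t
    have := (ha (t, (Θ 0, 0))).smul hr
    rw [dq_eps_zero, ← map_smul, ← hwr] at this
    exact this
  have h2 := ang_unique (X := unitInterval) (θ := fun t => a (t, (Θ 0,0))) (θ' := fun t => Θ t)
      (by fun_prop) (hΘ.restrict) (fun t => (h1 t).unique (hang t t.2)) 0 1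
  have h3 := hg (Θ 0, 0)
  have h0 : a (0, (Θ 0, 0)) = Θ 0 := ha0 _
  simp only [h0, Icc.coe_zero, Icc.coe_one] at h2
  have h4 : a (1, (Θ 0, 0)) = Θ 1 := by linarith
  rwa [h0, h4] at h3

/-! ### Torsion and side changes -/

lemma D_seg (n : ℕ) (s : ℝ) (hs : s ∈ Icc (0:ℝ) 1) (p w : Pl) :
    S.D (n + s) p w = fderiv ℝ (S.Ft s) (S.F^[n] p) (S.DN n p w) := by
  rcases eq_or_lt_of_le hs.2 with h | h
  · subst h
    have e : ((n:ℝ) + 1) = ((n+1 : ℕ) : ℝ) := by push_cast; ring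
    unfold D
    rw [e, Nat.floor_natCast, Int.fract_natCast, S.Ft_zero]
    simp only [fderiv_id, ContinuousLinearMap.comp_apply, ContinuousLinearMap.id_apply]
    exact S.DN_succ_apply n p w
  · unfold D
    have h1 : ⌊(n:ℝ) + s⌋₊ = n := by
      rw [Nat.floor_eq_iff (by have := hs.1; positivity)]
      constructor <;> linarith [hs.1]
    have h2 : Int.fract ((n:ℝ) + s) = s := by
      rw [Int.fract_natCast_add, Int.fract_eq_self.2 ⟨hs.1, h⟩]
    rw [h1, h2]; rfl

lemma D_nat (n : ℕ) (p w : Pl) : S.D n p w = S.DN n p w := by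
  have := S.D_seg n 0 (by simp) p w
  rw [add_zero, S.Ft_zero, fderiv_id] at this
  exact this

/-- left side (or up) -/
def sd (w : Pl) : Prop := w.1 < 0 ∨ (w.1 = 0 ∧ 0 < w.2)

lemma sd_iff {a : ℝ} {w : Pl} (h : IsAng a w) : sd w ↔ Even ⌊2*a⌋ := by
  have hk1 := Int.floor_le (2*a)
  have hk2 := Int.lt_floor_add_one (2*a)
  obtain ⟨m, hm | hm⟩ := Int.even_or_odd' ⌊2*a⌋
  · rw [hm] at hk1 hk2 ⊢
    push_cast at hk1 hk2
    simp only [even_two, Even.mul_right, iff_true]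
    rcases eq_or_lt_of_le hk1 with h1 | h1
    · exact Or.inr (isAng_up h m h1.symm)
    · exact Or.inl (isAng_left h m h1 hk2)
  · rw [hm] at hk1 hk2 ⊢
    push_cast at hk1 hk2
    have : ¬ Even (2*m+1) := by simp
    simp only [this, iff_false]
    rintro (h2 | ⟨h2, h3⟩)
    all_goals
      rcases eq_or_lt_of_le hk1 with h1 | h1
      · have := isAng_down h m h1.symm
        linarith
      · have := isAng_right h (m+1) (by push_cast; linarith) (by push_cast; linarith)
        linarith

open Classical in
/-- number of side changes up to time `n` -/
def sc (p w : Pl) (n : ℕ) : ℕ :=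
  ∑ j ∈ Finset.range n, if (sd (S.DN j p w) ↔ sd (S.DN (j+1) p w)) then 0 else 1

open Classical in
lemma sc_succ (p w : Pl) (n : ℕ) : S.sc p w (n+1) = S.sc p w n +
    if (sd (S.DN n p w) ↔ sd (S.DN (n+1) p w)) then 0 else 1 := Finset.sum_range_succ _ _

lemma good_floor_step {a a' : ℝ} (h : Good a a') : ⌊2*a'⌋ = ⌊2*a⌋ ∨ ⌊2*a'⌋ = ⌊2*a⌋ - 1 := by
  obtain ⟨h1, h2, -⟩ := good_floor h
  have h3 : ⌊2*a'⌋ < ⌊2*a⌋ + 1 := by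
    rw [Int.floor_lt]; push_cast; exact h2
  have h4 : ⌊2*a⌋ - 1 ≤ ⌊2*a'⌋ := by
    rw [Int.le_floor]; push_cast; exact h1.le
  omega

lemma angleVar_sc (T : TwistLift) (hT : T.F = S.F) (ht : S.PosTwist) (p w : Pl) (n : ℕ) (a : ℝ)
    (h : S.AngleVar p w n a) : |2 * a + S.sc p w n| ≤ 1 := by
  obtain ⟨Θ, hc, hang, rfl⟩ := h
  have hang' : ∀ t ∈ Icc (0:ℝ) n, IsAng (Θ t) (S.D t p w) := hang
  have key : ∀ m : ℕ, m ≤ n → ⌊2 * Θ m⌋ = ⌊2 * Θ 0⌋ - S.sc p w m := by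
    intro m
    induction m with
    | zero => intro _; simp [sc]
    | succ k ih =>
      intro hk
      have hk' : (k:ℝ) + 1 ≤ n := by exact_mod_cast hk
      have ih' := ih (by omega)
      have hsub : ∀ s ∈ Icc (0:ℝ) 1, (k:ℝ) + s ∈ Icc (0:ℝ) n := by
        intro s hs
        exact ⟨by have := hs.1; positivity, by linarith [hs.2]⟩
      have hg := S.iso_good T hT ht (S.F^[k] p) (S.DN k p w) (fun s => Θ (k + s))
        (hc.comp (by fun_prop) hsub) (fun s hs => by
          rw [← S.D_seg k s hs]; exact hang' _ (hsub s hs))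
      simp only [add_zero] at hg
      have a1 : IsAng (Θ k) (S.DN k p w) := by
        rw [← D_nat]; exact hang' _ (by simpa using hsub 0 (by simp))
      have a2 : IsAng (Θ (k+1)) (S.DN (k+1) p w) := by
        have := hang' _ (hsub 1 (by simp))
        have e : ((k:ℝ) + 1) = ((k+1 : ℕ) : ℝ) := by push_cast; ring
        rw [e] at this ⊢
        rwa [D_nat] at this
      have hs1 := sd_iff a1
      have hs2 := sd_iff a2
      rw [sc_succ]
      push_cast
      rcases good_floor_step hg with h | h
      · rw [if_pos (by rw [hs1, hs2, h]), h, ih']; ring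
      · rw [if_neg (by
          rw [hs1, hs2, h]
          intro hh
          rw [Int.even_sub_one] at hh
          tauto), h, ih']; push_cast; ring
  have hn := key n le_rfl
  have b1 := Int.floor_le (2 * Θ n)
  have b2 := Int.lt_floor_add_one (2 * Θ n)
  have c1 := Int.floor_le (2 * Θ 0)
  have c2 := Int.lt_floor_add_one (2 * Θ 0)
  have hn' : ((⌊2 * Θ n⌋ : ℤ) : ℝ) = ⌊2 * Θ 0⌋ - S.sc p w n := by rw [hn]; push_cast; ring
  rw [abs_le]
  constructor <;> linarith

lemma D_cont (p w : Pl) (n : ℕ) : ContinuousOn (fun t => S.D t p w) (Icc 0 (n:ℝ)) := by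
  induction n with
  | zero => simp
  | succ k ih =>
    have h1 : ContinuousOn (fun t => S.D t p w) (Icc (k:ℝ) (k+1)) := by
      have h2 : ContinuousOn (fun t : ℝ => fderiv ℝ (S.Ft (t - k)) (S.F^[k] p) (S.DN k p w)) (Icc (k:ℝ) (k+1)) := by
        have h3 : ContinuousOn (fun t : ℝ => ((t - k, S.F^[k] p) : ℝ × Pl)) (Icc (k:ℝ) (k+1)) := by fun_prop
        have h4 := S.DFt_cont.comp h3 (fun t ht => ⟨⟨by linarith [ht.1], by linarith [ht.2]⟩, mem_univ _⟩)
        exact h4.clm_apply continuousOn_const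
      refine h2.congr fun t ht => ?_
      have := S.D_seg k (t - k) ⟨by linarith [ht.1], by linarith [ht.2]⟩ p w
      rwa [add_sub_cancel] at this
    have e : Icc (0:ℝ) ((k+1:ℕ):ℝ) = Icc 0 (k:ℝ) ∪ Icc (k:ℝ) (k+1) := by
      rw [Icc_union_Icc_eq_Icc (by positivity) (by linarith)]; push_cast; rfl
    rw [e]
    exact ih.union_of_isClosed h1 isClosed_Icc isClosed_Icc

lemma D_ne (t : ℝ) (ht : 0 ≤ t) (p : Pl) {w : Pl} (hw : w ≠ 0) : S.D t p w ≠ 0 := by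
  have h1 := Nat.floor_le ht
  have h2 := Nat.lt_floor_add_one t
  have := S.D_seg ⌊t⌋₊ (t - ⌊t⌋₊) ⟨by linarith, by linarith⟩ p w
  rw [add_sub_cancel] at this
  rw [this]
  exact lin_ne_of_jac (S.jac_Ft_ne _ ⟨by linarith, by linarith⟩ _) (S.DN_ne _ _ hw)

lemma exists_angleVar (p : Pl) {w : Pl} (hw : w ≠ 0) (n : ℕ) : ∃ a, S.AngleVar p w n a := by
  by_cases hn : n = 0
  · subst hn
    obtain ⟨b, hb⟩ := exists_isAng (S.D_ne 0 le_rfl p hw)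
    refine ⟨0, fun _ => b, continuousOn_const, fun t ht => ?_, by simp⟩
    have : t = 0 := by simpa using ht
    subst this
    exact hb
  have hn' : (0:ℝ) < n := by positivity
  have hc : Continuous (fun x : unitInterval × Unit => S.D (n * (x.1:ℝ)) p w) :=
    (S.D_cont p w n).comp_continuous (by fun_prop) (fun x =>
      ⟨mul_nonneg hn'.le x.1.2.1, by nlinarith [x.1.2.2]⟩)
  obtain ⟨b, hb⟩ := exists_isAng (S.D_ne 0 le_rfl p hw)
  obtain ⟨θ, hθ, -⟩ := lift_ang ⟨_, hc⟩ (fun x => S.D_ne _ (mul_nonneg hn'.le x.1.2.1) p hw)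
    (ContinuousMap.const _ b) (fun x => by simpa using hb)
  refine ⟨_, fun t => θ (projIcc 0 1 zero_le_one (t / n), ()), ?_, ?_, rfl⟩
  · have : Continuous (fun t : ℝ => θ (projIcc (0:ℝ) 1 zero_le_one (t / n), ())) :=
      θ.continuous.comp ((continuous_projIcc.comp (by fun_prop)).prodMk continuous_const)
    exact this.continuousOn
  · intro t ht
    have h1 : t / n ∈ Icc (0:ℝ) 1 := ⟨div_nonneg ht.1 hn'.le, by rw [div_le_one hn']; exact ht.2⟩
    have h2 := hθ (projIcc 0 1 zero_le_one (t / n), ())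
    simp only [ContinuousMap.coe_mk, projIcc_of_mem _ h1] at h2
    rw [mul_div_cancel₀ _ hn'.ne'] at h2
    simp only [projIcc_of_mem _ h1]
    exact h2

/-- Zero torsion in terms of side changes. -/
lemma torsionLift_iff (T : TwistLift) (hT : T.F = S.F) (ht : S.PosTwist) (p : Pl) :
    S.TorsionLift p 0 ↔ ∀ w, w ≠ 0 → Tendsto (fun n : ℕ => (S.sc p w n : ℝ) / n) atTop (𝓝 0) := by
  have hsmall : Tendsto (fun n : ℕ => (1:ℝ) / n) atTop (𝓝 0) := tendsto_const_div_atTop_nhds_zero_nat 1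
  constructor
  · intro h w hw
    obtain ⟨a, ha, hlim⟩ := h w hw
    have h2 : Tendsto (fun n : ℕ => -2 * (a n / (n:ℝ)) + 1 / n) atTop (𝓝 0) := by
      have := (hlim.const_mul (-2)).add hsmall
      simpa using this
    refine tendsto_of_tendsto_of_tendsto_of_le_of_le' tendsto_const_nhds h2 ?_ ?_
    · exact Eventually.of_forall fun n => by positivity
    · filter_upwards [eventually_ge_atTop 1] with n hn
      have h3 := (abs_le.1 (S.angleVar_sc T hT ht p w n (a n) (ha n hn))).2
      have : -2 * (a n / (n:ℝ)) + 1 / n = (-2 * a n + 1) / n := by ring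
      rw [this]
      gcongr
      linarith
  · intro h w hw
    choose a ha using fun n => S.exists_angleVar p hw n
    refine ⟨a, fun n _ => ha n, ?_⟩
    have hl := h w hw
    have h2 : Tendsto (fun n : ℕ => -(1/2) * ((S.sc p w n : ℝ) / n) + 1 / n) atTop (𝓝 0) := by
      simpa using (hl.const_mul (-(1/2:ℝ))).add hsmall
    have h3 : Tendsto (fun n : ℕ => -(1/2) * ((S.sc p w n : ℝ) / n) - 1 / n) atTop (𝓝 0) := by
      simpa using (hl.const_mul (-(1/2:ℝ))).sub hsmall
    refine tendsto_of_tendsto_of_tendsto_of_le_of_le h3 h2 ?_ ?_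
    · intro n
      have h3 := (abs_le.1 (S.angleVar_sc T hT ht p w n (a n) (ha n))).1
      have : -(1/2) * ((S.sc p w n : ℝ) / n) - 1 / n = (-(1/2) * S.sc p w n - 1) / n := by ring
      simp only [this]
      gcongr
      linarith
    · intro n
      have h3 := (abs_le.1 (S.angleVar_sc T hT ht p w n (a n) (ha n))).2
      have : -(1/2) * ((S.sc p w n : ℝ) / n) + 1 / n = (-(1/2) * S.sc p w n + 1) / n := by ring
      simp only [this]
      gcongr
      linarith

end IsotopySetup
end

set_option linter.all false
noncomputable section
open MeasureTheory Set Filter Topology Function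

namespace IsotopySetup
variable (S : IsotopySetup)

lemma sd_neg {w : Pl} (hw : w ≠ 0) : sd (-w) ↔ ¬ sd w := by
  unfold sd
  simp only [Prod.fst_neg, Prod.snd_neg]
  rcases lt_trichotomy w.1 0 with h | h | h
  · constructor
    · rintro (h1 | h1) <;> linarith [h1]
    · intro h1; exact absurd (Or.inl h) h1
  · have h2 : w.2 ≠ 0 := fun h2 => hw (by ext <;> simp [h, h2])
    constructor
    · rintro (h1 | ⟨h1, h3⟩) (h4 | ⟨h4, h5⟩) <;> linarith
    · intro h1
      right
      refine ⟨by linarith, ?_⟩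
      push Not at h1
      have := h1.2 h
      rcases lt_or_gt_of_ne h2 with h3 | h3 <;> linarith
  · constructor
    · rintro - (h4 | ⟨h4, h5⟩) <;> linarith
    · intro _; left; linarith

/-- a vector never on the left forces the vertical to stay right -/
lemma right_of_not_sd (ht : S.PosTwist) (p w : Pl) (hw : w ≠ 0) (N : ℕ) (hN : 1 ≤ N)
    (h : ∀ j ≤ N, ¬ sd (S.DN j p w)) : 0 ≤ (S.DN N p (0,1)).1 := by
  have hnn : ∀ j ≤ N, 0 ≤ (S.DN j p w).1 := by
    intro j hj
    by_contra hc; push Not at hc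
    exact h j hj (Or.inl hc)
  have hpos : ∀ j < N, 0 < (S.DN j p w).1 := by
    intro j hj
    rcases eq_or_lt_of_le (hnn j hj.le) with h1 | h1
    · exfalso
      have hne := S.DN_ne j p hw
      have h2 : (S.DN j p w).2 < 0 := by
        have := h j hj.le
        unfold sd at this
        push Not at this
        rcases eq_or_lt_of_le (this.2 h1.symm) with h3 | h3
        · exact absurd (by ext <;> simp [← h1, h3]) hne
        · exact h3
      have h3 := (S.allowed_lin ht (S.F^[j] p) (S.DN j p w)).2.1 h1.symm h2
      rw [← DN_succ_apply] at h3
      linarith [hnn (j+1) hj]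
    · exact h1
  have key : ∀ j < N, ∃ c d : ℝ, 0 ≤ c ∧ 0 ≤ d ∧ S.DN j p (0,1) = c • S.DN j p w + d • ((0,1) : Pl) := by
    intro j
    induction j with
    | zero =>
      intro _
      exact ⟨0, 1, le_rfl, zero_le_one, by simp [DN_zero]⟩
    | succ k ih =>
      intro hk
      obtain ⟨c, d, hc, hd, e⟩ := ih (by omega)
      have hb := S.beta_pos ht (S.F^[k] p)
      have hj := S.jac_F_pos (S.F^[k] p)
      have hp1 := hpos k (by omega)
      have hp2 := hpos (k+1) hk
      rw [DN_succ_apply] at hp2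
      rw [DN_succ_apply, DN_succ_apply, e, map_add, map_smul, map_smul]
      set L := fderiv ℝ S.F (S.F^[k] p)
      set w' := S.DN k p w
      have e1 : (L w').1 = w'.1 * (L (1,0)).1 + w'.2 * (L (0,1)).1 := by
        have := congrArg Prod.fst (lin_expand L w'); simpa using this
      have e2 : (L w').2 = w'.1 * (L (1,0)).2 + w'.2 * (L (0,1)).2 := by
        have := congrArg Prod.snd (lin_expand L w'); simpa using this
      have e3 : (L (0,1)).2 * (L w').1 - (L (0,1)).1 * (L w').2 = w'.1 * jac L := by
        rw [e1, e2]; unfold jac; ring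
      refine ⟨c + d * ((L (0,1)).1 / (L w').1), d * (w'.1 * jac L / (L w').1), by positivity, by positivity, ?_⟩
      rw [← e3]
      ext
      · simp; field_simp
      · simp; field_simp; ring
  obtain ⟨M, rfl⟩ : ∃ M, N = M + 1 := ⟨N - 1, by omega⟩
  obtain ⟨c, d, hc, hd, e⟩ := key M (by omega)
  have h1 := hnn (M+1) le_rfl
  have hb := S.beta_pos ht (S.F^[M] p)
  rw [DN_succ_apply] at h1 ⊢
  rw [e, map_add, map_smul, map_smul]
  simp only [Prod.fst_add, Prod.smul_fst, smul_eq_mul]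
  positivity

lemma sc_const (p w : Pl) (N : ℕ) (h : S.sc p w N = 0) : ∀ j ≤ N, (sd (S.DN j p w) ↔ sd w) := by
  classical
  intro j
  induction j with
  | zero => intro _; rw [DN_zero]; rfl
  | succ k ih =>
    intro hk
    rw [← ih (by omega)]
    unfold sc at h
    rw [Finset.sum_eq_zero_iff] at h
    have := h k (Finset.mem_range.2 hk)
    by_contra hne
    rw [if_neg (fun h => hne h.symm)] at this
    omega

lemma sc_pos (ht : S.PosTwist) (p w : Pl) (hw : w ≠ 0) (N : ℕ) (hb : (S.DN N p (0,1)).1 < 0) :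
    1 ≤ S.sc p w N := by
  have hN : 1 ≤ N := by
    by_contra h
    have : N = 0 := by omega
    subst this
    simp [DN_zero] at hb
  by_contra h
  have h0 : S.sc p w N = 0 := by omega
  have hc := S.sc_const p w N h0
  by_cases hs : sd w
  · have := S.right_of_not_sd ht p (-w) (by simpa using hw) N hN (fun j hj => by
      rw [map_neg, sd_neg (S.DN_ne j p hw), not_not, hc j hj]; exact hs)
    linarith
  · have := S.right_of_not_sd ht p w hw N hN (fun j hj => by rw [hc j hj]; exact hs)
    linarith

open Classical in
lemma sc_shift (p w : Pl) (j N : ℕ) : S.sc (S.F^[j] p) (S.DN j p w) N =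
    ∑ i ∈ Finset.range N, if (sd (S.DN (i+j) p w) ↔ sd (S.DN (i+j+1) p w)) then 0 else 1 := by
  unfold sc
  refine Finset.sum_congr rfl fun i _ => ?_
  have e1 : S.DN i (S.F^[j] p) (S.DN j p w) = S.DN (i+j) p w := by rw [DN_add]; rfl
  have e2 : S.DN (i+1) (S.F^[j] p) (S.DN j p w) = S.DN (i+j+1) p w := by
    have : i + j + 1 = (i+1) + j := by ring
    rw [this, S.DN_add j (i+1) p]; rfl
  rw [e1, e2]

open Classical in
lemma visits_le (ht : S.PosTwist) (p w : Pl) (hw : w ≠ 0) (N n : ℕ) :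
    (∑ j ∈ Finset.range n, if (S.DN N (S.F^[j] p) (0,1)).1 < 0 then 1 else 0) ≤ N * S.sc p w (n + N) := by
  have h1 : (∑ j ∈ Finset.range n, if (S.DN N (S.F^[j] p) (0,1)).1 < 0 then 1 else 0)
      ≤ ∑ j ∈ Finset.range n, S.sc (S.F^[j] p) (S.DN j p w) N := by
    refine Finset.sum_le_sum fun j _ => ?_
    split_ifs with h
    · exact S.sc_pos ht _ _ (S.DN_ne j p hw) N h
    · exact Nat.zero_le _
  refine h1.trans ?_
  simp only [sc_shift]
  rw [Finset.sum_comm]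
  have h2 : ∀ i ∈ Finset.range N, (∑ j ∈ Finset.range n,
      if (sd (S.DN (i+j) p w) ↔ sd (S.DN (i+j+1) p w)) then 0 else 1) ≤ S.sc p w (n + N) := by
    intro i hi
    have hi' := Finset.mem_range.1 hi
    have : (∑ j ∈ Finset.range n, if (sd (S.DN (i+j) p w) ↔ sd (S.DN (i+j+1) p w)) then 0 else 1)
      = ∑ m ∈ Finset.Ico i (i+n), if (sd (S.DN m p w) ↔ sd (S.DN (m+1) p w)) then 0 else 1 := by
      rw [Finset.sum_Ico_eq_sum_range]; simp
    rw [this]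
    unfold sc
    apply Finset.sum_le_sum_of_subset
    intro m hm
    simp only [Finset.mem_Ico, Finset.mem_range] at *
    omega
  calc _ ≤ ∑ i ∈ Finset.range N, S.sc p w (n+N) := Finset.sum_le_sum h2
    _ = _ := by simp

open Classical in
lemma visits_tendsto (ht : S.PosTwist) (p w : Pl) (hw : w ≠ 0) (N : ℕ)
    (hsc : Tendsto (fun n : ℕ => (S.sc p w n : ℝ) / n) atTop (𝓝 0)) :
    Tendsto (fun n : ℕ => (∑ j ∈ Finset.range n, if (S.DN N (S.F^[j] p) (0,1)).1 < 0 then (1:ℝ) else 0) / n)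
      atTop (𝓝 0) := by
  have h1 := (hsc.comp (tendsto_add_atTop_nat N)).const_mul ((N:ℝ) * (N+1))
  rw [mul_zero] at h1
  refine tendsto_of_tendsto_of_tendsto_of_le_of_le' tendsto_const_nhds h1 ?_ ?_
  · refine Eventually.of_forall fun n => div_nonneg (Finset.sum_nonneg fun j _ => ?_) (by positivity)
    split_ifs <;> norm_num
  · filter_upwards [eventually_ge_atTop 1] with n hn
    have h2 : ((∑ j ∈ Finset.range n, if (S.DN N (S.F^[j] p) (0,1)).1 < 0 then (1:ℝ) else 0))
        ≤ N * S.sc p w (n + N) := by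
      exact_mod_cast S.visits_le ht p w hw N n
    simp only [comp_apply]
    have hn' : (1:ℝ) ≤ n := by exact_mod_cast hn
    have h3 : ((n + N : ℕ) : ℝ) ≤ (N + 1) * n := by
      push_cast
      nlinarith [(Nat.cast_nonneg N : (0:ℝ) ≤ N)]
    have h5 : (0:ℝ) < ((n+N : ℕ):ℝ) := by push_cast; positivity
    have h4 : (1:ℝ)/n ≤ (N+1) / ((n+N : ℕ) : ℝ) := by
      rw [div_le_div_iff₀ (by positivity) h5]; linarith
    calc _ ≤ (N * S.sc p w (n + N)) * ((1:ℝ)/n) := by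
            rw [div_eq_mul_one_div]; gcongr
      _ ≤ (N * S.sc p w (n + N)) * ((N+1) / ((n+N : ℕ) : ℝ)) := by gcongr
      _ = _ := by ring

lemma iter_per (n : ℕ) (p : Pl) (k : ℤ) : S.F^[n] (p + ((k:ℝ),0)) = S.F^[n] p + ((k:ℝ),0) := by
  induction n with
  | zero => rfl
  | succ m ih => rw [iterate_succ_apply', iterate_succ_apply', ih, per_int S.F_per]

lemma DN_per (n : ℕ) (p : Pl) (k : ℤ) : S.DN n (p + ((k:ℝ),0)) = S.DN n p := by
  have h := S.DN_has n (p + ((k:ℝ),0))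
  have h1 : HasFDerivAt (fun q => S.F^[n] (q + ((k:ℝ),0))) (S.DN n (p + ((k:ℝ),0))) p := by
    have := h.comp p ((hasFDerivAt_id p).add_const ((k:ℝ),0))
    rw [ContinuousLinearMap.comp_id] at this
    exact this
  have h2 : HasFDerivAt (fun q => S.F^[n] (q + ((k:ℝ),0))) (S.DN n p) p := by
    simp only [iter_per]
    exact (S.DN_has n p).add_const _
  exact h1.unique h2

lemma DN_cont (n : ℕ) : Continuous (S.DN n) := (S.iter_smooth n).continuous_fderiv (by simp)

lemma lift_iter (n : ℕ) (p : Pl) : S.f^[n] (pr p) = pr (S.F^[n] p) := by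
  induction n with
  | zero => rfl
  | succ m ih => rw [iterate_succ_apply', iterate_succ_apply', ih]; exact (S.lift_f _).symm

lemma noconj (ht : S.PosTwist) (hpres : MeasurePreserving S.f volume volume) (U : Set Ann)
    (hUopen : IsOpen U) (hUbdd : Bornology.IsBounded U) (hUinv : S.f '' U = U)
    (hae : ∀ᵐ z ∂volume, z ∈ U → S.Torsion z 0) (p : Pl) (hp : pr p ∈ U) (n : ℕ) (hn : 1 ≤ n) :
    0 < (S.DN n p (0,1)).1 := by
  classical
  by_contra hcon
  push Not at hcon
  -- a time with negative component
  obtain ⟨N, hN⟩ : ∃ N, (S.DN N p (0,1)).1 < 0 := by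
    rcases eq_or_lt_of_le hcon with h | h
    · have hne : S.DN n p (0,1) ≠ 0 := S.DN_ne n p (by simp)
      have h2 : (S.DN n p (0,1)).2 ≠ 0 := fun h2 => hne (by ext <;> simp [h, h2])
      rcases lt_or_gt_of_ne h2 with h2 | h2
      · refine ⟨n+1, ?_⟩
        rw [DN_succ_apply]
        exact (S.allowed_lin ht _ _).2.1 h h2
      · obtain ⟨m, rfl⟩ : ∃ m, n = m + 1 := ⟨n-1, by omega⟩
        refine ⟨m, ?_⟩
        rw [DN_succ_apply] at h h2
        exact (S.allowed_lin ht _ _).2.2.1 h h2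
    · exact ⟨n, h⟩
  set O : Set Ann := pr '' {q | (S.DN N q (0,1)).1 < 0} ∩ U with hO
  have hcb : Continuous fun q => (S.DN N q (0,1)).1 := by
    have := (S.DN_cont N).clm_apply (continuous_const (y := ((0,1):Pl)))
    fun_prop
  have hOopen : IsOpen O := (pr_open _ (isOpen_lt hcb continuous_const)).inter hUopen
  have hOne : O.Nonempty := ⟨pr p, ⟨p, hN, rfl⟩, hp⟩
  have hmem : ∀ q, pr q ∈ U → (pr q ∈ O ↔ (S.DN N q (0,1)).1 < 0) := by
    intro q hq
    constructor
    · rintro ⟨⟨q', hq', e⟩, -⟩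
      obtain ⟨k, rfl⟩ := pr_eq_iff.1 e
      rw [DN_per]; exact hq'
    · intro h; exact ⟨⟨q, h, rfl⟩, hq⟩
  have hUpre : ∀ z, S.f z ∈ U ↔ z ∈ U := by
    intro z
    constructor
    · intro h
      rw [← hUinv] at h
      obtain ⟨z', hz', e⟩ := h
      rwa [← S.f_inj e]
    · intro h; rw [← hUinv]; exact ⟨z, h, rfl⟩
  have hUit : ∀ j z, S.f^[j] z ∈ U ↔ z ∈ U := by
    intro j
    induction j with
    | zero => intro z; rfl
    | succ m ih => intro z; rw [iterate_succ_apply', hUpre, ih]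
  have hvolU : volume U < ⊤ := hUbdd.measure_lt_top
  have hvolO : volume O < ⊤ := lt_of_le_of_lt (measure_mono inter_subset_right) hvolU
  set φ : ℕ → Ann → ℝ := fun n z => (∑ j ∈ Finset.range n, O.indicator (fun _ => (1:ℝ)) (S.f^[j] z)) / n with hφ
  have hfm : ∀ j, MeasurePreserving (S.f^[j]) volume volume := fun j => hpres.iterate j
  have hmeas1 : ∀ j, Measurable (fun z => O.indicator (fun _ => (1:ℝ)) (S.f^[j] z)) := fun j =>
    (measurable_const.indicator hOopen.measurableSet).comp (hfm j).measurable
  have hint1 : ∀ j, ∫ z in U, O.indicator (fun _ => (1:ℝ)) (S.f^[j] z) = volume.real O := by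
    intro j
    have e : (fun z => O.indicator (fun _ => (1:ℝ)) (S.f^[j] z)) = (S.f^[j] ⁻¹' O).indicator (fun _ => (1:ℝ)) := by
      funext z; simp only [indicator, mem_preimage]
    rw [e, integral_indicator ((hfm j).measurable hOopen.measurableSet), setIntegral_const, smul_eq_mul, mul_one,
      measureReal_restrict_apply ((hfm j).measurable hOopen.measurableSet)]
    have e2 : S.f^[j] ⁻¹' O ∩ U = S.f^[j] ⁻¹' O := by
      apply inter_eq_left.2
      intro z hz
      exact (hUit j z).1 hz.2
    rw [e2, measureReal_def, (hfm j).measure_preimage hOopen.measurableSet.nullMeasurableSet, measureReal_def]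
  have hbd1 : ∀ z, O.indicator (fun _ => (1:ℝ)) z ≤ 1 ∧ 0 ≤ O.indicator (fun _ => (1:ℝ)) z := by
    intro z
    simp only [indicator]; split_ifs <;> norm_num
  have hfin : IsFiniteMeasure (volume.restrict U) := ⟨by simpa using hvolU⟩
  have hii : ∀ j, Integrable (fun z => O.indicator (fun _ => (1:ℝ)) (S.f^[j] z)) (volume.restrict U) := by
    intro j
    refine Integrable.of_bound (hmeas1 j).aestronglyMeasurable 1 (Eventually.of_forall fun z => ?_)
    rw [Real.norm_eq_abs, abs_of_nonneg (hbd1 _).2]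
    exact (hbd1 _).1
  have hint2 : ∀ n, 1 ≤ n → ∫ z in U, φ n z = volume.real O := by
    intro n hn
    simp only [hφ]
    rw [integral_div, integral_finset_sum _ (fun j _ => hii j)]
    simp only [hint1]
    simp
    field_simp
  have hlim : Tendsto (fun n => ∫ z in U, φ n z) atTop (𝓝 (∫ z in U, (0:ℝ))) := by
    refine tendsto_integral_of_dominated_convergence (fun _ => (1:ℝ)) ?_ (integrable_const _) ?_ ?_
    · intro n
      exact ((Finset.measurable_sum _ fun j _ => hmeas1 j).div_const _).aestronglyMeasurable
    · intro n
      refine Eventually.of_forall fun z => ?_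
      have h0 : 0 ≤ φ n z := div_nonneg (Finset.sum_nonneg fun j _ => (hbd1 _).2) (by positivity)
      rw [Real.norm_eq_abs, abs_of_nonneg h0]
      apply div_le_one_of_le₀ _ (by positivity)
      calc _ ≤ ∑ j ∈ Finset.range n, (1:ℝ) := Finset.sum_le_sum fun j _ => (hbd1 _).1
        _ = n := by simp
    · rw [ae_restrict_iff' hUopen.measurableSet]
      filter_upwards [hae] with z hz hzU
      obtain ⟨q, rfl, hq⟩ := hz hzU
      have hq2 := (S.torsionLift_iff (S.twistLift ht hpres) rfl ht q).1 hq (0,1) (by simp)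
      have h3 := S.visits_tendsto ht q (0,1) (by simp) N hq2
      refine h3.congr fun n => ?_
      simp only [hφ]
      congr 1
      refine Finset.sum_congr rfl fun j _ => ?_
      rw [lift_iter]
      have hU' : pr (S.F^[j] q) ∈ U := by rw [← lift_iter]; exact (hUit j _).2 hzU
      simp only [indicator, hmem _ hU']
  rw [integral_zero] at hlim
  have h0 : volume.real O = 0 := by
    have : Tendsto (fun n : ℕ => volume.real O) atTop (𝓝 0) := by
      refine hlim.congr' ?_
      filter_upwards [eventually_ge_atTop 1] with n hn using hint2 n hn
    exact tendsto_nhds_unique tendsto_const_nhds this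
  have hpos := hOopen.measure_pos volume hOne
  rw [measureReal_def, ENNReal.toReal_eq_zero_iff] at h0
  rcases h0 with h | h
  · exact hpos.ne' h
  · exact hvolO.ne h

end IsotopySetup
end

set_option linter.all false
noncomputable section
open MeasureTheory Set Filter Topology Function

lemma bdd_scal {g : Pl → ℝ} (hc : Continuous g) (hper : ∀ (p : Pl) (k : ℤ), g (p + ((k:ℝ), 0)) = g p)
    (M : ℝ) : ∃ B, ∀ p : Pl, |p.2| ≤ M → |g p| ≤ B := by
  have hK : IsCompact (Icc (0:ℝ) 1 ×ˢ Icc (-M) M) := isCompact_Icc.prod isCompact_Icc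
  obtain ⟨B, hB⟩ := (hK.image hc).isBounded.exists_norm_le
  refine ⟨B, fun p hp => ?_⟩
  obtain ⟨n, hn⟩ := exists_shift p
  rw [← hper p n]
  exact hB _ ⟨_, ⟨hn, by simpa [abs_le] using hp⟩, rfl⟩

namespace IsotopySetup
variable (S : IsotopySetup)

lemma jac_DN_one (hpres : MeasurePreserving S.f volume volume) (n : ℕ) (p : Pl) : jac (S.DN n p) = 1 := by
  induction n with
  | zero => rw [DN_zero, jac_id]
  | succ k ih => rw [DN_succ, jac_comp, ih, S.jac_F_one hpres, one_mul]

/-- abstract invariant bounded region without conjugate points -/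
structure Reg (W : Set Pl) : Prop where
  inv : ∀ p, S.F p ∈ W ↔ p ∈ W
  bdd : ∃ M, ∀ p ∈ W, |p.2| ≤ M
  nc : ∀ p ∈ W, ∀ n, 1 ≤ n → 0 < (S.DN n p (0,1)).1

lemma Reg.iter {W : Set Pl} (hW : S.Reg W) (n : ℕ) (p : Pl) : S.F^[n] p ∈ W ↔ p ∈ W := by
  induction n with
  | zero => rfl
  | succ m ih => rw [iterate_succ_apply', hW.inv, ih]

lemma fderiv_per (p : Pl) (k : ℤ) : fderiv ℝ S.F (p + ((k:ℝ),0)) = fderiv ℝ S.F p := S.DN_per 1 p k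

lemma sum_bound (ht : S.PosTwist) (hpres : MeasurePreserving S.f volume volume) {W : Set Pl} (hW : S.Reg W) :
    ∃ K, ∀ p ∈ W, ∀ N : ℕ, ∑ n ∈ Finset.range N,
      1 / ((S.DN (n+1) p (0,1)).1 * (S.DN (n+2) p (0,1)).1) ≤ K := by
  obtain ⟨M, hM⟩ := hW.bdd
  have hFc : Continuous (fderiv ℝ S.F) := S.F_smooth.continuous_fderiv (by simp)
  have hb := S.beta_pos ht
  have c1 : Continuous fun p => (fderiv ℝ S.F p (0,1)).1 := by fun_prop
  have c2 : Continuous fun p => (fderiv ℝ S.F p (0,1)).2 := by fun_prop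
  have c3 : Continuous fun p => (fderiv ℝ S.F p (1,0)).1 := by fun_prop
  obtain ⟨B1, hB1⟩ := bdd_scal (g := fun p => 1 / (fderiv ℝ S.F p (0,1)).1)
    (continuous_const.div c1 fun p => (hb p).ne') (fun p k => by simp only [fderiv_per]) M
  obtain ⟨B2, hB2⟩ := bdd_scal (g := fun p => (fderiv ℝ S.F p (0,1)).2 / (fderiv ℝ S.F p (0,1)).1)
    (c2.div c1 fun p => (hb p).ne') (fun p k => by simp only [fderiv_per]) M
  obtain ⟨B3, hB3⟩ := bdd_scal (g := fun p => (fderiv ℝ S.F p (1,0)).1 / (fderiv ℝ S.F p (0,1)).1)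
    (c3.div c1 fun p => (hb p).ne') (fun p k => by simp only [fderiv_per]) M
  refine ⟨B1 * (B3 + B2), fun p hp N => ?_⟩
  have step : ∀ n, 1 / ((S.DN (n+1) p (0,1)).1 * (S.DN (n+2) p (0,1)).1) ≤
      B1 * ((S.DN (n+1) p (1,0)).1 / (S.DN (n+1) p (0,1)).1 - (S.DN (n+2) p (1,0)).1 / (S.DN (n+2) p (0,1)).1) := by
    intro n
    have h1 := hW.nc p hp (n+1) (by omega)
    have h2 := hW.nc p hp (n+2) (by omega)
    have hj := S.jac_DN_one hpres (n+1) p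
    have hbn := hb (S.F^[n+1] p)
    have hB := hB1 (S.F^[n+1] p) (hM _ ((hW.iter S _ _).2 hp))
    have e : (S.DN (n+1) p (1,0)).1 / (S.DN (n+1) p (0,1)).1 - (S.DN (n+2) p (1,0)).1 / (S.DN (n+2) p (0,1)).1
       = (fderiv ℝ S.F (S.F^[n+1] p) (0,1)).1 / ((S.DN (n+1) p (0,1)).1 * (S.DN (n+2) p (0,1)).1) := by
      rw [div_sub_div _ _ h1.ne' h2.ne']
      congr 1
      rw [S.DN_succ_apply (n+1), S.DN_succ_apply (n+1)]
      rw [lin_expand _ (S.DN (n+1) p (0,1)), lin_expand _ (S.DN (n+1) p (1,0))]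
      unfold jac at hj
      simp only [Prod.fst_add, Prod.smul_fst, smul_eq_mul]
      linear_combination (fderiv ℝ S.F (S.F^[n+1] p) (0,1)).1 * hj
    rw [e]
    have : 1 ≤ B1 * (fderiv ℝ S.F (S.F^[n+1] p) (0,1)).1 := by
      have := (le_abs_self _).trans hB
      rwa [div_le_iff₀ hbn] at this
    rw [← mul_div_assoc]
    gcongr
  have low : ∀ n, - B2 ≤ (S.DN (n+1) p (1,0)).1 / (S.DN (n+1) p (0,1)).1 := by
    intro n
    have h1 := hW.nc p hp (n+1) (by omega)
    set q := S.G p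
    have hFq : S.F q = p := S.FG p
    have hq : q ∈ W := by rw [← hW.inv, hFq]; exact hp
    have h2 := hW.nc q hq (n+1+1) (by omega)
    rw [S.DN_add 1 (n+1) q] at h2
    have e1 : S.F^[1] q = p := hFq
    rw [e1] at h2
    have e2 : S.DN 1 q = fderiv ℝ S.F q := rfl
    rw [e2, ContinuousLinearMap.comp_apply, lin_expand (S.DN (n+1) p)] at h2
    simp at h2
    have hB := (abs_le.1 (hB2 q (hM _ hq))).2
    have hbq := hb q
    rw [div_le_iff₀ hbq] at hB
    rw [le_div_iff₀ h1]
    by_contra hc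
    push Not at hc
    have := mul_lt_mul_of_pos_left hc hbq
    nlinarith [mul_le_mul_of_nonneg_right hB h1.le]
  calc _ ≤ ∑ n ∈ Finset.range N, B1 * ((S.DN (n+1) p (1,0)).1 / (S.DN (n+1) p (0,1)).1 - (S.DN (n+2) p (1,0)).1 / (S.DN (n+2) p (0,1)).1) :=
        Finset.sum_le_sum fun n _ => step n
    _ = B1 * ((S.DN (0+1) p (1,0)).1 / (S.DN (0+1) p (0,1)).1 - (S.DN (N+1) p (1,0)).1 / (S.DN (N+1) p (0,1)).1) := by
        rw [← Finset.mul_sum]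
        rw [Finset.sum_range_sub' (fun n => (S.DN (n+1) p (1,0)).1 / (S.DN (n+1) p (0,1)).1)]
    _ ≤ _ := by
        have hB10 : 0 ≤ B1 := (abs_nonneg _).trans (hB1 p (hM _ hp))
        have := low N
        have h3 := (abs_le.1 (hB3 p (hM _ hp))).2
        have h4 : (S.DN (0+1) p (1,0)).1 / (S.DN (0+1) p (0,1)).1 ≤ B3 := h3
        gcongr
        linarith

lemma hasDeriv_X (n : ℕ) (x y : ℝ) : HasDerivAt (fun y => (S.F^[n] (x,y)).1) (S.DN n (x,y) (0,1)).1 y := by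
  have h1 : HasDerivAt (fun y : ℝ => ((x,y):Pl)) (0,1) y := (hasDerivAt_const y x).prodMk (hasDerivAt_id y)
  exact ((S.DN_has n (x,y)).comp_hasDerivAt y h1).fst

lemma X_mono {W : Set Pl} (hW : S.Reg W) (x y0 y1 : ℝ) (hseg : ∀ y ∈ Ioo y0 y1, (x,y) ∈ W) (n : ℕ) (hn : 1 ≤ n) :
    StrictMonoOn (fun y => (S.F^[n] (x,y)).1) (Icc y0 y1) := by
  apply strictMonoOn_of_deriv_pos (convex_Icc _ _)
  · exact fun y _ => (S.hasDeriv_X n x y).continuousAt.continuousWithinAt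
  · intro y hy
    rw [interior_Icc] at hy
    rw [(S.hasDeriv_X n x y).deriv]
    exact hW.nc _ (hseg y hy) n hn

lemma diverge (ht : S.PosTwist) (hpres : MeasurePreserving S.f volume volume) {W : Set Pl} (hW : S.Reg W)
    (x y0 y1 : ℝ) (hy : y0 < y1) (hseg : ∀ y ∈ Ioo y0 y1, (x,y) ∈ W) (B : ℝ) :
    ∃ n, B < (S.F^[n] (x,y1)).1 - (S.F^[n] (x,y0)).1 := by
  by_contra hcon
  push Not at hcon
  obtain ⟨K, hK⟩ := S.sum_bound ht hpres hW
  set C := max B 1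
  have hC : 0 < C := lt_of_lt_of_le one_pos (le_max_right _ _)
  have hCB : ∀ n, (S.F^[n] (x,y1)).1 - (S.F^[n] (x,y0)).1 ≤ C := fun n => (hcon n).trans (le_max_left _ _)
  set l := y1 - y0 with hl
  have hl0 : 0 < l := by rw [hl]; linarith
  set t := 4 * C / l with htd
  have ht0 : 0 < t := by positivity
  have key : ∀ N : ℕ, (N:ℝ) * (2 * l / t^2) ≤ K / 4 * l := by
    intro N
    set Q : ℝ → ℝ := fun y => ∑ n ∈ Finset.range N,
      (3 / t^2 * y - 2 / t^3 * ((S.F^[n+1] (x,y)).1 + (S.F^[n+2] (x,y)).1)) with hQ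
    have hQd : ∀ y, HasDerivAt Q (∑ n ∈ Finset.range N,
      (3 / t^2 * 1 - 2 / t^3 * ((S.DN (n+1) (x,y) (0,1)).1 + (S.DN (n+2) (x,y) (0,1)).1))) y := by
      intro y
      apply HasDerivAt.fun_sum
      intro n _
      exact ((hasDerivAt_id y).const_mul _).sub
        (((S.hasDeriv_X (n+1) x y).add (S.hasDeriv_X (n+2) x y)).const_mul _)
    obtain ⟨y, hyI, e⟩ := exists_hasDerivAt_eq_slope Q _ hy
      (fun y _ => (hQd y).continuousAt.continuousWithinAt) (fun y _ => hQd y)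
    rw [eq_div_iff (by linarith)] at e
    have hle : (∑ n ∈ Finset.range N,
      (3 / t^2 * 1 - 2 / t^3 * ((S.DN (n+1) (x,y) (0,1)).1 + (S.DN (n+2) (x,y) (0,1)).1))) ≤ K / 4 := by
      have h1 := hK (x,y) (hseg y hyI) N
      calc _ ≤ ∑ n ∈ Finset.range N, (1 / ((S.DN (n+1) (x,y) (0,1)).1 * (S.DN (n+2) (x,y) (0,1)).1)) / 4 := by
            refine Finset.sum_le_sum fun n _ => ?_
            have p1 := hW.nc _ (hseg y hyI) (n+1) (by omega)
            have p2 := hW.nc _ (hseg y hyI) (n+2) (by omega)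
            generalize (S.DN (n+1) (x,y) (0,1)).1 = a at *
            generalize (S.DN (n+2) (x,y) (0,1)).1 = b at *
            have h2 : 1 / (a+b)^2 ≤ (1 / (a*b)) / 4 := by
              rw [div_div]
              apply one_div_le_one_div_of_le (by positivity)
              nlinarith [sq_nonneg (a-b)]
            refine le_trans ?_ h2
            set s := a + b with hs
            have hs0 : 0 < s := by positivity
            have : 1 / s^2 - (3 / t^2 * 1 - 2 / t^3 * s) = (t - s)^2 * (t + 2 * s) / (t^3 * s^2) := by
              field_simp; ring
            have h5 : 0 ≤ (t - s)^2 * (t + 2 * s) / (t^3 * s^2) := by positivity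
            linarith
        _ = (∑ n ∈ Finset.range N, 1 / ((S.DN (n+1) (x,y) (0,1)).1 * (S.DN (n+2) (x,y) (0,1)).1)) / 4 := by rw [Finset.sum_div]
        _ ≤ K / 4 := by linarith
    have hge : (N:ℝ) * (2 * l / t^2) ≤ Q y1 - Q y0 := by
      simp only [hQ]
      rw [← Finset.sum_sub_distrib]
      calc _ = ∑ n ∈ Finset.range N, (2 * l / t^2) := by simp
        _ ≤ _ := by
          refine Finset.sum_le_sum fun n _ => ?_
          have i1 := hCB (n+1)
          have i2 := hCB (n+2)
          have e3 : 2 * l / t^2 = 3 / t^2 * l - 2 / t^3 * (2 * C) := by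
            rw [show C = t * l / 4 by rw [htd]; field_simp]
            field_simp; ring
          rw [e3]
          have : 2 / t^3 * (((S.F^[n+1] (x,y1)).1 - (S.F^[n+1] (x,y0)).1) + ((S.F^[n+2] (x,y1)).1 - (S.F^[n+2] (x,y0)).1)) ≤ 2 / t^3 * (2*C) := by
            gcongr; linarith
          rw [hl]
          linarith
    rw [← hl] at e
    rw [← e] at hge
    exact hge.trans (by gcongr)
  obtain ⟨N, hN⟩ := exists_nat_gt (K / 4 * l / (2 * l / t^2))
  rw [div_lt_iff₀ (by positivity)] at hN
  exact absurd (key N) (not_le.2 hN)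

end IsotopySetup
end

set_option linter.all false
noncomputable section
open MeasureTheory Set Filter Topology Function

lemma continuousAt_of_closed {g : ℝ → ℝ} {x0 M : ℝ} {K : Set Pl} (hK : IsClosed K)
    (h1 : ∀ᶠ x in 𝓝 x0, (x, g x) ∈ K ∧ |g x| ≤ M) (h2 : ∀ y, (x0, y) ∈ K → y = g x0) : ContinuousAt g x0 := by
  have hc : IsCompact (Icc (-M) M) := isCompact_Icc
  refine hc.tendsto_nhds_of_unique_mapClusterPt (h1.mono fun x hx => abs_le.1 hx.2) ?_
  intro y hy hcl
  apply h2
  have h3 : MapClusterPt ((x0, y) : Pl) (𝓝 x0) (fun x => (x, g x)) := by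
    rw [mapClusterPt_iff_frequently] at hcl ⊢
    intro s hs
    rw [nhds_prod_eq, mem_prod_iff] at hs
    obtain ⟨a, ha, b, hb, hab⟩ := hs
    have := (hcl b hb).and_eventually ha
    exact this.mono fun x hx => hab ⟨hx.2, hx.1⟩
  exact isClosed_iff_clusterPt.1 hK _ (h3.clusterPt.mono (by
    rw [le_principal_iff]; exact h1.mono fun x hx => hx.1))

namespace IsotopySetup
variable (S : IsotopySetup)

lemma G_iter_F_iter (n : ℕ) (p : Pl) : S.G^[n] (S.F^[n] p) = p :=
  (Function.LeftInverse.iterate S.GF n) p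

lemma F_iter_G_iter (n : ℕ) (p : Pl) : S.F^[n] (S.G^[n] p) = p :=
  (Function.LeftInverse.iterate S.FG n) p

lemma G_iter_deriv (hpres : MeasurePreserving S.f volume volume) (n : ℕ) (p : Pl) :
    HasFDerivAt (S.G^[n]) (fderiv ℝ (S.G^[n]) p) p ∧
    (fderiv ℝ (S.G^[n]) p (0,1)).1 = -(S.DN n (S.G^[n] p) (0,1)).1 := by
  have hs : ContDiff ℝ 1 (S.G^[n]) := by
    induction n with
    | zero => exact contDiff_id
    | succ m ih => rw [iterate_succ']; exact ContDiff.comp S.G_smooth ih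
  have hG : ∀ p, HasFDerivAt (S.G^[n]) (fderiv ℝ (S.G^[n]) p) p := fun p =>
    (hs.differentiable (by simp) p).hasFDerivAt
  refine ⟨hG p, ?_⟩
  set q := S.G^[n] p
  have hq : S.F^[n] q = p := S.F_iter_G_iter n p
  have h1 := (hG (S.F^[n] q)).comp q (S.DN_has n q)
  have h2 : S.G^[n] ∘ S.F^[n] = id := funext (S.G_iter_F_iter n)
  rw [h2] at h1
  have h3 := h1.unique (hasFDerivAt_id q)
  rw [hq] at h3
  have hj := S.jac_DN_one hpres n q
  set L := S.DN n q
  have h4 : L (-(L (0,1)).1, (L (1,0)).1) = (0,1) := by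
    rw [lin_expand L]
    unfold jac at hj
    ext
    · simp; ring
    · simp; linear_combination hj
  have h5 := congrArg (fun (A : Pl →L[ℝ] Pl) => A (-(L (0,1)).1, (L (1,0)).1)) h3
  simp only [ContinuousLinearMap.comp_apply, h4] at h5
  rw [h5]; rfl

structure Strip (φm φp : ℝ → ℝ) : Prop where
  cm : Continuous φm
  cp : Continuous φp
  pm : ∀ x, φm (x+1) = φm x
  pp : ∀ x, φp (x+1) = φp x
  lt : ∀ x, φm x < φp x
  reg : S.Reg {p | φm p.1 < p.2 ∧ p.2 < φp p.1}
  im : ∀ x, (S.F (x, φm x)).2 = φm (S.F (x, φm x)).1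
  ip : ∀ x, (S.F (x, φp x)).2 = φp (S.F (x, φp x)).1

lemma per_int_fun {φ : ℝ → ℝ} (h : ∀ x, φ (x+1) = φ x) (x : ℝ) (k : ℤ) : φ (x + k) = φ x := by
  have : Function.Periodic φ 1 := h
  simpa using this.int_mul k x

lemma graph_mono {φ : ℝ → ℝ} (hc : Continuous φ) (hp : ∀ x, φ (x+1) = φ x)
    (hi : ∀ x, (S.F (x, φ x)).2 = φ (S.F (x, φ x)).1) (n : ℕ) {x x' : ℝ} (h : x ≤ x') :
    (S.F^[n] (x, φ x)).1 ≤ (S.F^[n] (x', φ x')).1 ∧ (S.F^[n] (x, φ x)).2 = φ (S.F^[n] (x, φ x)).1 := by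
  set g : ℝ → ℝ := fun x => (S.F (x, φ x)).1 with hg
  have hgc : Continuous g := by
    have := S.F_smooth.continuous
    fun_prop
  have hF : ∀ x, S.F (x, φ x) = (g x, φ (g x)) := fun x => Prod.ext rfl (hi x)
  have hinj : Injective g := by
    intro a b hab
    have : S.F (a, φ a) = S.F (b, φ b) := by rw [hF, hF, hab]
    have := congrArg S.G this
    rw [S.GF, S.GF] at this
    exact congrArg Prod.fst this
  have hgp : ∀ x, g (x+1) = g x + 1 := by
    intro x
    have := S.F_per (x, φ x)
    simp only [hg, hp]
    have e : ((x, φ x) : Pl) + (1, 0) = (x+1, φ x) := by simp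
    rw [e] at this
    rw [this]; rfl
  have hmono : StrictMono g := by
    rcases hgc.strictMono_of_inj hinj with h | h
    · exact h
    · have := h (show (0:ℝ) < 0 + 1 by norm_num)
      rw [hgp] at this
      linarith
  have hit : ∀ x, S.F^[n] (x, φ x) = (g^[n] x, φ (g^[n] x)) := by
    induction n with
    | zero => intro x; rfl
    | succ m ih => intro x; rw [iterate_succ_apply, hF, ih]; rfl
  rw [hit, hit]
  exact ⟨(hmono.monotone.iterate n) h, rfl⟩

variable {S} {φm φp : ℝ → ℝ}

def Wc (φm φp : ℝ → ℝ) : Set Pl := {p | φm p.1 ≤ p.2 ∧ p.2 ≤ φp p.1}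

lemma Strip.wc_inv (h : S.Strip φm φp) {p : Pl} (hp : p ∈ Wc φm φp) (n : ℕ) : S.F^[n] p ∈ Wc φm φp := by
  induction n with
  | zero => exact hp
  | succ m ih =>
    rw [iterate_succ_apply']
    set q := S.F^[m] p
    rcases eq_or_lt_of_le ih.1 with h1 | h1
    · have := h.im q.1
      rw [h1] at this
      exact ⟨this.ge, this.le.trans (h.lt _).le⟩
    · rcases eq_or_lt_of_le ih.2 with h2 | h2
      · have := h.ip q.1
        rw [← h2] at this
        exact ⟨(h.lt _).le.trans this.ge, this.le⟩
      · have := (h.reg.inv q).2 ⟨h1, h2⟩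
        exact ⟨this.1.le, this.2.le⟩

lemma Strip.seg (h : S.Strip φm φp) {x y0 y1 : ℝ} (h0 : φm x ≤ y0) (h1 : y1 ≤ φp x) :
    ∀ y ∈ Ioo y0 y1, ((x,y):Pl) ∈ {p : Pl | φm p.1 < p.2 ∧ p.2 < φp p.1} :=
  fun y hy => ⟨lt_of_le_of_lt h0 hy.1, lt_of_lt_of_le hy.2 h1⟩

/-- vertical order is horizontal order later (weak) -/
lemma Strip.vmono (h : S.Strip φm φp) {x y0 y1 : ℝ} (h0 : φm x ≤ y0) (h1 : y1 ≤ φp x) (hy : y0 ≤ y1) (n : ℕ) :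
    (S.F^[n] (x,y0)).1 ≤ (S.F^[n] (x,y1)).1 := by
  rcases Nat.eq_zero_or_pos n with rfl | hn
  · exact le_rfl
  · exact (S.X_mono h.reg x y0 y1 (h.seg h0 h1) n hn).monotoneOn (left_mem_Icc.2 hy) (right_mem_Icc.2 hy) hy

lemma Strip.vanti (h : S.Strip φm φp) (hpres : MeasurePreserving S.f volume volume)
    {x y0 y1 : ℝ} (h0 : φm x ≤ y0) (h1 : y1 ≤ φp x) (hy : y0 < y1) (n : ℕ) (hn : 1 ≤ n) :
    (S.G^[n] (x,y1)).1 < (S.G^[n] (x,y0)).1 := by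
  have hd : ∀ y, HasDerivAt (fun y => (S.G^[n] (x,y)).1) (fderiv ℝ (S.G^[n]) (x,y) (0,1)).1 y := by
    intro y
    have h1 : HasDerivAt (fun y : ℝ => ((x,y):Pl)) (0,1) y := (hasDerivAt_const y x).prodMk (hasDerivAt_id y)
    exact ((S.G_iter_deriv hpres n (x,y)).1.comp_hasDerivAt y h1).fst
  refine strictAntiOn_of_deriv_neg (convex_Icc y0 y1) (fun y _ => (hd y).continuousAt.continuousWithinAt) ?_
    (left_mem_Icc.2 hy.le) (right_mem_Icc.2 hy.le) hy
  intro y hyI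
  rw [interior_Icc] at hyI
  rw [(hd y).deriv, (S.G_iter_deriv hpres n (x,y)).2, neg_lt_zero]
  apply h.reg.nc _ _ n hn
  rw [← h.reg.iter S n, S.F_iter_G_iter]
  exact h.seg h0 h1 y hyI

lemma Strip.cross (h : S.Strip φm φp) (ht : S.PosTwist) (hpres : MeasurePreserving S.f volume volume)
    {p z : Pl} (hp : p ∈ Wc φm φp) (hz : z ∈ Wc φm φp) (hx : p.1 ≤ z.1) {n : ℕ}
    (hn : (S.F^[n] z).1 < (S.F^[n] p).1) :
    (∀ k, n ≤ k → (S.F^[k] z).1 ≤ (S.F^[k] p).1) ∧ ∀ B, ∃ k, B < (S.F^[k] p).1 - (S.F^[k] z).1 := by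
  have hn1 : 1 ≤ n := by
    by_contra hc
    have : n = 0 := by omega
    subst this
    exact absurd hn (not_lt.2 hx)
  -- intermediate point
  have hlow : (S.F^[n] (p.1, φm p.1)).1 ≤ (S.F^[n] z).1 := by
    refine (S.graph_mono h.cm h.pm h.im n hx).1.trans ?_
    exact h.vmono le_rfl hz.2 hz.1 n
  have hcont : ContinuousOn (fun y => (S.F^[n] (p.1,y)).1) (Icc (φm p.1) p.2) := fun y _ =>
    (S.hasDeriv_X n p.1 y).continuousAt.continuousWithinAt
  obtain ⟨y3, hy3, e3⟩ := intermediate_value_Icc hp.1 hcont ⟨hlow, hn.le⟩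
  simp only at e3
  have hy3p : y3 < p.2 := by
    rcases eq_or_lt_of_le hy3.2 with h1 | h1
    · exfalso; rw [h1] at e3; linarith
    · exact h1
  set q : Pl := (p.1, y3) with hq
  have hqW : q ∈ Wc φm φp := ⟨hy3.1, hy3.2.trans hp.2⟩
  have hqn := h.wc_inv hqW n
  have hzn := h.wc_inv hz n
  have hord : (S.F^[n] z).2 ≤ (S.F^[n] q).2 := by
    by_contra hc
    push Not at hc
    have h5 := h.vanti hpres (x := (S.F^[n] z).1) (y0 := (S.F^[n] q).2) (y1 := (S.F^[n] z).2)
      (by rw [← e3]; exact hqn.1) hzn.2 hc n hn1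
    have e5 : (((S.F^[n] z).1, (S.F^[n] q).2) : Pl) = S.F^[n] q := Prod.ext e3.symm rfl
    rw [e5, Prod.mk.eta, S.G_iter_F_iter, S.G_iter_F_iter] at h5
    exact absurd h5 (not_lt.2 hx)
  have hk1 : ∀ k, n ≤ k → (S.F^[k] z).1 ≤ (S.F^[k] q).1 := by
    intro k hk
    obtain ⟨j, rfl⟩ := Nat.exists_eq_add_of_le' hk
    rw [iterate_add_apply, iterate_add_apply]
    have e5 : (((S.F^[n] z).1, (S.F^[n] q).2) : Pl) = S.F^[n] q := Prod.ext e3.symm rfl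
    have := h.vmono (x := (S.F^[n] z).1) (y0 := (S.F^[n] z).2) (y1 := (S.F^[n] q).2) hzn.1
      (by rw [← e3]; exact hqn.2) hord j
    rwa [e5, Prod.mk.eta] at this
  have hk2 : ∀ k, (S.F^[k] q).1 ≤ (S.F^[k] p).1 := fun k =>
    h.vmono (x := p.1) (y0 := y3) (y1 := p.2) hy3.1 hp.2 hy3.2 k
  refine ⟨fun k hk => (hk1 k hk).trans (hk2 k), fun B => ?_⟩
  -- bounded differences for small k
  obtain ⟨C, hC⟩ : ∃ C, ∀ k < n, (S.F^[k] p).1 - (S.F^[k] q).1 ≤ C := by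
    obtain ⟨C, hC⟩ := ((Set.finite_lt_nat n).image (fun k => (S.F^[k] p).1 - (S.F^[k] q).1)).bddAbove
    exact ⟨C, fun k hk => hC ⟨k, hk, rfl⟩⟩
  obtain ⟨k, hk⟩ := S.diverge ht hpres h.reg p.1 y3 p.2 hy3p (h.seg hy3.1 hp.2) (max B C)
  refine ⟨k, ?_⟩
  have hkn : n ≤ k := by
    by_contra hc
    push Not at hc
    have := hC k hc
    exact absurd (lt_of_le_of_lt (le_max_right _ _) hk) (not_lt.2 this)
  have h1 := hk1 k hkn
  have h2 : B < (S.F^[k] p).1 - (S.F^[k] q).1 := lt_of_le_of_lt (le_max_left _ _) hk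
  linarith

/-- bounded equivalence -/
def BEq (S : IsotopySetup) (p z : Pl) : Prop := ∃ B, ∀ n, |(S.F^[n] p).1 - (S.F^[n] z).1| ≤ B

lemma BEq.symm {p z : Pl} (h : BEq S p z) : BEq S z p := by
  obtain ⟨B, hB⟩ := h
  exact ⟨B, fun n => by rw [abs_sub_comm]; exact hB n⟩

lemma BEq.trans {p q z : Pl} (h : BEq S p q) (h' : BEq S q z) : BEq S p z := by
  obtain ⟨B, hB⟩ := h
  obtain ⟨B', hB'⟩ := h'
  exact ⟨B + B', fun n => (abs_sub_le _ _ _).trans (add_le_add (hB n) (hB' n))⟩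

lemma BEq.int (p : Pl) (k : ℤ) : BEq S (p + ((k:ℝ),0)) p := ⟨|(k:ℝ)|, fun n => by
  rw [S.iter_per]; simp⟩

lemma wc_int (h : S.Strip φm φp) (p : Pl) (k : ℤ) : p + ((k:ℝ),0) ∈ Wc φm φp ↔ p ∈ Wc φm φp := by
  unfold Wc
  simp [per_int_fun h.pm, per_int_fun h.pp]

/-- boundedness is quantitative -/
lemma Strip.quant (h : S.Strip φm φp) (ht : S.PosTwist) (hpres : MeasurePreserving S.f volume volume)
    {p z : Pl} (hp : p ∈ Wc φm φp) (hz : z ∈ Wc φm φp) (m : ℤ) (hx : p.1 ≤ z.1 + m)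
    (hb : ∃ B, ∀ n, (S.F^[n] p).1 - (S.F^[n] z).1 ≤ B) (n : ℕ) : (S.F^[n] p).1 ≤ (S.F^[n] z).1 + m := by
  by_contra hc
  push Not at hc
  obtain ⟨B, hB⟩ := hb
  have e : ∀ n, (S.F^[n] (z + ((m:ℝ),0))).1 = (S.F^[n] z).1 + m := fun n => by rw [S.iter_per]; simp
  obtain ⟨k, hk⟩ := (h.cross ht hpres hp ((wc_int h z m).2 hz) (by simpa using hx) (n := n) (by rw [e]; exact hc)).2 (B + |(m:ℝ)|)
  rw [e] at hk
  have := hB k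
  have := neg_abs_le (m:ℝ)
  linarith

lemma Strip.dich (h : S.Strip φm φp) (ht : S.PosTwist) (hpres : MeasurePreserving S.f volume volume)
    {p z : Pl} (hp : p ∈ Wc φm φp) (hz : z ∈ Wc φm φp) :
    (∃ B, ∀ n, (S.F^[n] p).1 - (S.F^[n] z).1 ≤ B) ∨ (∃ B, ∀ n, (S.F^[n] z).1 - (S.F^[n] p).1 ≤ B) := by
  obtain ⟨m, hm⟩ := exists_int_gt (p.1 - z.1)
  by_cases hall : ∀ n, (S.F^[n] p).1 ≤ (S.F^[n] z).1 + m
  · left; exact ⟨m, fun n => by linarith [hall n]⟩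
  · right
    push Not at hall
    obtain ⟨n, hn⟩ := hall
    have e : ∀ n, (S.F^[n] (z + ((m:ℝ),0))).1 = (S.F^[n] z).1 + m := fun n => by rw [S.iter_per]; simp
    have hk := (h.cross ht hpres hp ((wc_int h z m).2 hz) (by simp; linarith) (n := n) (by rw [e]; exact hn)).1
    obtain ⟨C, hC⟩ := ((Set.finite_lt_nat n).image (fun k => (S.F^[k] z).1 - (S.F^[k] p).1)).bddAbove
    refine ⟨max C (-m), fun k => ?_⟩
    rcases lt_or_ge k n with hkn | hkn
    · exact (hC ⟨k, hkn, rfl⟩).trans (le_max_left _ _)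
    · have := hk k hkn
      rw [e] at this
      exact le_trans (by linarith) (le_max_right _ _)

lemma Strip.uniq (h : S.Strip φm φp) (ht : S.PosTwist) (hpres : MeasurePreserving S.f volume volume)
    {x y y' : ℝ} (hp : (x,y) ∈ Wc φm φp) (hz : (x,y') ∈ Wc φm φp) (hb : BEq S (x,y) (x,y')) : y = y' := by
  obtain ⟨B, hB⟩ := hb
  rcases lt_trichotomy y y' with h1 | h1 | h1
  · obtain ⟨n, hn⟩ := S.diverge ht hpres h.reg x y y' h1 (h.seg hp.1 hz.2) B
    have := (abs_le.1 (hB n)).1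
    linarith
  · exact h1
  · obtain ⟨n, hn⟩ := S.diverge ht hpres h.reg x y' y h1 (h.seg hz.1 hp.2) B
    have := (abs_le.1 (hB n)).2
    linarith

lemma Strip.exist (h : S.Strip φm φp) (ht : S.PosTwist) (hpres : MeasurePreserving S.f volume volume)
    {z : Pl} (hz : φm z.1 < z.2 ∧ z.2 < φp z.1) (x : ℝ) :
    ∃ y, φm x < y ∧ y < φp x ∧ BEq S (x,y) z := by
  have hzW : z ∈ Wc φm φp := ⟨hz.1.le, hz.2.le⟩
  obtain ⟨m, hm⟩ : ∃ m : ℤ, |x - z.1| < m := exists_int_gt _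
  rw [abs_lt] at hm
  have cF : ∀ n, Continuous fun y => (S.F^[n] (x,y)).1 := fun n =>
    continuous_iff_continuousAt.2 fun y => (S.hasDeriv_X n x y).continuousAt
  have ez : ∀ (w : Pl) n, (S.F^[n] (w + ((m:ℝ),0))).1 = (S.F^[n] w).1 + m := fun w n => by rw [S.iter_per]; simp
  have mlow : ∀ n, (S.F^[n] (x, φm x)).1 ≤ (S.F^[n] (z.1, φm z.1)).1 + m := by
    intro n
    have h2 := (S.graph_mono h.cm h.pm h.im n (show x ≤ z.1 + m by linarith)).1
    have := ez (z.1, φm z.1) n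
    simp at this
    rwa [per_int_fun h.pm, this] at h2
  have mhigh : ∀ n, (S.F^[n] (z.1, φp z.1)).1 ≤ (S.F^[n] (x, φp x)).1 + m := by
    intro n
    have h2 := (S.graph_mono h.cp h.pp h.ip n (show z.1 ≤ x + m by linarith)).1
    have := ez (x, φp x) n
    simp at this
    rwa [per_int_fun h.pp, this] at h2
  have zlow : ∀ n, (S.F^[n] (z.1, φm z.1)).1 ≤ (S.F^[n] z).1 := fun n =>
    h.vmono (x := z.1) (y1 := z.2) le_rfl hz.2.le hz.1.le n
  have zhigh : ∀ n, (S.F^[n] z).1 ≤ (S.F^[n] (z.1, φp z.1)).1 := fun n =>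
    h.vmono (x := z.1) (y0 := z.2) hz.1.le le_rfl hz.2.le n
  set I : Set ℝ := ⋂ n, {y | (S.F^[n] (x,y)).1 ≤ (S.F^[n] z).1 + m} with hI
  set J : Set ℝ := ⋂ n, {y | (S.F^[n] z).1 ≤ (S.F^[n] (x,y)).1 + m} with hJ
  have hIc : IsClosed I := isClosed_iInter fun n => isClosed_le (cF n) continuous_const
  have hJc : IsClosed J := isClosed_iInter fun n => isClosed_le continuous_const ((cF n).add continuous_const)
  have hpc : IsPreconnected (Icc (φm x) (φp x)) := isPreconnected_Icc
  rw [isPreconnected_closed_iff] at hpc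
  obtain ⟨y, hyY, hyI, hyJ⟩ := hpc I J hIc hJc (by
      intro y hy
      rcases h.dich ht hpres (p := (x,y)) hy hzW with hb | hb
      · left
        exact mem_iInter.2 fun n => h.quant ht hpres (p := (x,y)) hy hzW m (by simp; linarith) hb n
      · right
        exact mem_iInter.2 fun n => h.quant ht hpres (z := (x,y)) hzW hy m (by simp; linarith) hb n)
    ⟨φm x, left_mem_Icc.2 (h.lt x).le, mem_iInter.2 fun n => by
      have := mlow n; have := zlow n; simp only [mem_setOf_eq]; linarith⟩
    ⟨φp x, right_mem_Icc.2 (h.lt x).le, mem_iInter.2 fun n => by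
      have := mhigh n; have := zhigh n; simp only [mem_setOf_eq]; linarith⟩
  have hyI' := fun n => mem_iInter.1 hyI n
  have hyJ' := fun n => mem_iInter.1 hyJ n
  simp only [mem_setOf_eq] at hyI' hyJ'
  refine ⟨y, lt_of_le_of_ne hyY.1 ?_, lt_of_le_of_ne hyY.2 ?_, m, fun n => ?_⟩
  · intro e
    obtain ⟨n, hn⟩ := S.diverge ht hpres h.reg z.1 (φm z.1) z.2 hz.1 (h.seg le_rfl hz.2.le) (m + m)
    have h1 := hyJ' n
    rw [← e] at h1
    have := mlow n
    simp at hn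
    linarith
  · intro e
    obtain ⟨n, hn⟩ := S.diverge ht hpres h.reg z.1 z.2 (φp z.1) hz.2 (h.seg hz.1.le le_rfl) (m + m)
    have h1 := hyI' n
    rw [e] at h1
    have := mhigh n
    simp at hn
    linarith
  · rw [abs_le]
    constructor
    · have := hyJ' n; linarith
    · have := hyI' n; linarith

end IsotopySetup
end

set_option linter.all false
noncomputable section
open MeasureTheory Set Filter Topology Function

/-! ### degree theory -/

lemma exp_lift {A : Type*} [TopologicalSpace A] [SimplyConnectedSpace A] [LocallyPathConnectedSpace A]
    (g : A → ℂ) (hg : Continuous g) (h0 : ∀ a, g a ≠ 0) : ∃ L : A → ℂ, Continuous L ∧ ∀ a, Complex.exp (L a) = g a := by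
  let a0 : A := Classical.arbitrary A
  let G : C(A, {z : ℂ // z ≠ 0}) := ⟨fun a => ⟨g a, h0 a⟩, hg.subtype_mk _⟩
  obtain ⟨L, hL, -⟩ := Complex.isCoveringMap_exp.existsUnique_continuousMap_lifts G a0 (Complex.log (g a0))
    (Subtype.ext (Complex.exp_log (h0 a0)))
  exact ⟨L, L.continuous, fun a => congrArg Subtype.val (congrFun hL.2 a)⟩

abbrev tpi : ℂ := 2 * Real.pi * Complex.I

lemma tpi_ne : tpi ≠ 0 := Complex.two_pi_I_ne_zero

lemma exp_diff_const {A : Type*} [TopologicalSpace A] [PreconnectedSpace A] {L L' : A → ℂ} (h : Continuous L)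
    (h' : Continuous L') (he : ∀ a, Complex.exp (L a) = Complex.exp (L' a)) (a b : A) : L a - L' a = L b - L' b := by
  have h1 : ∀ a, ∃ n : ℤ, L a = L' a + n * tpi := fun a => Complex.exp_eq_exp_iff_exists_int.1 (he a)
  choose n hn using h1
  have hc : Continuous (fun x => ((n x : ℤ) : ℝ)) := by
    have : (fun x => ((n x : ℤ) : ℝ)) = fun x => ((L x - L' x) / tpi).re := by
      funext x; rw [hn]
      have : (L' x + (n x : ℂ) * tpi - L' x) / tpi = ((n x : ℝ) : ℂ) := by
        rw [add_sub_cancel_left, mul_div_assoc, div_self tpi_ne]; simp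
      rw [this, Complex.ofReal_re]
    rw [this]; fun_prop
  have hc' : Continuous n := Int.isClosedEmbedding_coe_real.isEmbedding.continuous_iff.2 hc
  have := PreconnectedSpace.constant (f := n) inferInstance hc' (x := a) (y := b)
  rw [hn a, hn b, this]; ring

def Deg (g : ℝ → ℂ) (n : ℤ) : Prop :=
  ∃ L : ℝ → ℂ, Continuous L ∧ (∀ s, Complex.exp (L s) = g s) ∧ ∀ s, L (s+1) = L s + n * tpi

lemma Deg.exist {g : ℝ → ℂ} (hg : Continuous g) (h0 : ∀ s, g s ≠ 0) (hp : ∀ s, g (s+1) = g s) : ∃ n, Deg g n := by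
  obtain ⟨L, hL, he⟩ := exp_lift g hg h0
  obtain ⟨n, hn⟩ := Complex.exp_eq_exp_iff_exists_int.1 (show Complex.exp (L (0+1)) = Complex.exp (L 0) by
    rw [he, he, hp])
  refine ⟨n, L, hL, he, fun s => ?_⟩
  have := exp_diff_const (L := fun s => L (s+1)) (L' := L) (by fun_prop) hL (fun s => by simp only [he, hp]) s 0
  linear_combination this + hn

lemma Deg.unique {g : ℝ → ℂ} {n m : ℤ} (h : Deg g n) (h' : Deg g m) : n = m := by
  obtain ⟨L, hL, he, hp⟩ := h
  obtain ⟨L', hL', he', hp'⟩ := h'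
  have := exp_diff_const hL hL' (fun s => by rw [he, he']) (0+1) 0
  rw [hp, hp'] at this
  have h2 : ((n:ℂ) - m) * tpi = 0 := by linear_combination this
  rcases mul_eq_zero.1 h2 with h3 | h3
  · exact_mod_cast sub_eq_zero.1 h3
  · exact absurd h3 tpi_ne

lemma Deg.mul {g h : ℝ → ℂ} {n m : ℤ} (hg : Deg g n) (hh : Deg h m) : Deg (fun s => g s * h s) (n + m) := by
  obtain ⟨L, hL, he, hp⟩ := hg
  obtain ⟨L', hL', he', hp'⟩ := hh
  refine ⟨fun s => L s + L' s, by fun_prop, fun s => by rw [Complex.exp_add, he, he'], fun s => ?_⟩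
  simp only [hp, hp']; push_cast; ring

lemma Deg.zpow {g : ℝ → ℂ} {n : ℤ} (hg : Deg g n) (k : ℤ) : Deg (fun s => g s ^ k) (k * n) := by
  obtain ⟨L, hL, he, hp⟩ := hg
  refine ⟨fun s => k * L s, by fun_prop, fun s => by rw [Complex.exp_int_mul, he], fun s => ?_⟩
  simp only [hp]; push_cast; ring

lemma Deg.const {c : ℂ} (hc : c ≠ 0) : Deg (fun _ => c) 0 :=
  ⟨fun _ => Complex.log c, continuous_const, fun _ => Complex.exp_log hc, fun s => by simp⟩

lemma Deg.congr {g h : ℝ → ℂ} {n : ℤ} (hg : Deg g n) (e : ∀ s, g s = h s) : Deg h n := by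
  rwa [← funext e]

lemma Deg.near {g h : ℝ → ℂ} {n : ℤ} (hg : Continuous g) (hpg : ∀ s, g (s+1) = g s) (hh : Deg h n)
    (hn : ∀ s, ‖g s - h s‖ < ‖h s‖) : Deg g n := by
  obtain ⟨L, hL, he, hp⟩ := hh
  have hh0 : ∀ s, h s ≠ 0 := fun s => by rw [← he]; exact Complex.exp_ne_zero _
  have hhc : Continuous h := by
    have : h = fun s => Complex.exp (L s) := by funext s; rw [he]
    rw [this]; fun_prop
  have hhp : ∀ s, h (s+1) = h s := by
    intro s
    rw [← he, ← he, hp, Complex.exp_add, Complex.exp_int_mul_two_pi_mul_I, mul_one]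
  have hs : ∀ s, g s / h s ∈ Complex.slitPlane := by
    intro s
    have : ‖g s / h s - 1‖ < 1 := by
      rw [div_sub_one (hh0 s), norm_div, div_lt_one (norm_pos_iff.2 (hh0 s))]
      exact hn s
    apply Complex.mem_slitPlane_of_norm_lt_one (z := g s / h s - 1) at this
    simpa using this
  refine ⟨fun s => L s + Complex.log (g s / h s), ?_, ?_, ?_⟩
  · exact hL.add (Continuous.clog (hg.div hhc hh0) hs)
  · intro s
    rw [Complex.exp_add, he, Complex.exp_log (Complex.slitPlane_ne_zero (hs s))]
    field_simp [hh0 s]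
  · intro s
    simp only [hp, hpg, hhp]; ring

lemma Deg.isOpen {X : Type*} [TopologicalSpace X] (g : X → ℝ → ℂ) (hc : Continuous (uncurry g))
    (hp : ∀ x s, g x (s+1) = g x s) (h0 : ∀ x s, g x s ≠ 0) (n : ℤ) : IsOpen {x | Deg (g x) n} := by
  rw [isOpen_iff_mem_nhds]
  intro x0 hx0
  have hcs : ∀ x, Continuous (g x) := fun x => hc.comp (by fun_prop : Continuous fun s => (x, s))
  have hO : IsOpen {q : X × ℝ | ‖g q.1 q.2 - g x0 q.2‖ < ‖g x0 q.2‖} := by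
    have c1 : Continuous fun q : X × ℝ => g q.1 q.2 := hc
    have c2 : Continuous fun q : X × ℝ => g x0 q.2 := (hcs x0).comp continuous_snd
    exact isOpen_lt (c1.sub c2).norm c2.norm
  obtain ⟨u, v, hu, hv, hxu, hv2, huv⟩ := generalized_tube_lemma (isCompact_singleton (x := x0))
    (isCompact_Icc (a := (0:ℝ)) (b := 1)) hO (by
      rintro ⟨x, s⟩ ⟨hx, -⟩
      rw [mem_singleton_iff] at hx
      simp only at hx
      simp [hx, h0])
  refine mem_of_superset (hu.mem_nhds (hxu rfl)) fun x hx => ?_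
  refine Deg.near (hcs x) (hp x) hx0 fun s => ?_
  have pz : ∀ x, g x s = g x (Int.fract s) := by
    intro x
    have : Function.Periodic (g x) 1 := hp x
    rw [Int.fract]
    have := this.sub_int_mul_eq (x := s) ⌊s⌋
    simpa using this.symm
  rw [pz x, pz x0]
  exact huv (show (x, Int.fract s) ∈ u ×ˢ v from ⟨hx, hv2 ⟨Int.fract_nonneg s, (Int.fract_lt_one s).le⟩⟩)

lemma Deg.isClopen {X : Type*} [TopologicalSpace X] (g : X → ℝ → ℂ) (hc : Continuous (uncurry g))
    (hp : ∀ x s, g x (s+1) = g x s) (h0 : ∀ x s, g x s ≠ 0) (n : ℤ) : IsClopen {x | Deg (g x) n} := by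
  refine ⟨⟨?_⟩, Deg.isOpen g hc hp h0 n⟩
  have : {x | Deg (g x) n}ᶜ = ⋃ m ∈ {m : ℤ | m ≠ n}, {x | Deg (g x) m} := by
    ext x
    simp only [mem_compl_iff, mem_setOf_eq, mem_iUnion, exists_prop]
    constructor
    · intro h
      obtain ⟨m, hm⟩ := Deg.exist (hc.comp (by fun_prop : Continuous fun s => (x, s))) (h0 x) (hp x)
      exact ⟨m, fun e => h (e ▸ hm), hm⟩
    · rintro ⟨m, hm, h⟩ h'
      exact hm (h.unique h')
  rw [this]
  exact isOpen_biUnion fun m _ => Deg.isOpen g hc hp h0 m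

/-! ### the coordinate -/

def zeta (z : Ann) : ℂ := (AddCircle.toCircle z.1 : ℂ) * (Real.exp (-(2 * Real.pi * z.2)) : ℝ)

lemma zeta_cont : Continuous zeta := by
  unfold zeta
  have : Continuous (fun z : Ann => (AddCircle.toCircle z.1)) := AddCircle.continuous_toCircle.comp continuous_fst
  fun_prop

lemma zeta_norm (z : Ann) : ‖zeta z‖ = Real.exp (-(2 * Real.pi * z.2)) := by
  unfold zeta
  rw [norm_mul, Circle.norm_coe, one_mul, Complex.norm_real, Real.norm_eq_abs, abs_of_pos (Real.exp_pos _)]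

lemma zeta_ne (z : Ann) : zeta z ≠ 0 := by
  rw [← norm_pos_iff, zeta_norm]; exact Real.exp_pos _

lemma zeta_inj : Injective zeta := by
  intro z w h
  have h1 := congrArg norm h
  rw [zeta_norm, zeta_norm, Real.exp_eq_exp] at h1
  have h2 : z.2 = w.2 := by
    have := Real.pi_pos
    have h3 : 2 * Real.pi * z.2 = 2 * Real.pi * w.2 := by linarith
    exact mul_left_cancel₀ (by positivity) h3
  unfold zeta at h
  rw [h2] at h
  have h3 := mul_right_cancel₀ (by exact_mod_cast (Real.exp_pos _).ne') h
  exact Prod.ext (AddCircle.injective_toCircle one_ne_zero (Subtype.ext h3)) h2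

lemma zeta_lt {z w : Ann} : ‖zeta z‖ < ‖zeta w‖ ↔ w.2 < z.2 := by
  rw [zeta_norm, zeta_norm, Real.exp_lt_exp, neg_lt_neg_iff]
  exact mul_lt_mul_iff_right₀ (by have := Real.pi_pos; positivity)

lemma zeta_pr (p : Pl) : zeta (pr p) = Complex.exp ((p.1 + p.2 * Complex.I) * tpi) := by
  unfold zeta pr
  simp only [AddCircle.toCircle_apply_mk, Circle.coe_exp]
  rw [Complex.ofReal_exp, ← Complex.exp_add]
  congr 1
  push_cast
  linear_combination (-(p.2 * 2 * Real.pi) : ℂ) * Complex.I_sq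

lemma zeta_deg {s y : ℝ → ℝ} {d : ℤ} (hs : Continuous s) (hy : Continuous y) (hs1 : ∀ x, s (x+1) = s x + d)
    (hy1 : ∀ x, y (x+1) = y x) : Deg (fun x => zeta (pr (s x, y x))) d :=
  ⟨fun x => (s x + y x * Complex.I) * tpi, by fun_prop, fun x => by simp only [zeta_pr], fun x => by
    simp only [hs1, hy1]; push_cast; ring⟩

/-- degree of `ζ∘γ - ζ o` for `o` high -/
lemma deg_high {c : ℝ → Ann} {d : ℤ} (hc : Continuous c) (hp : ∀ s, c (s+1) = c s) (hd : Deg (fun s => zeta (c s)) d)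
    (o : Ann) (ho : ∀ s, (c s).2 < o.2) : Deg (fun s => zeta (c s) - zeta o) d := by
  refine Deg.near (by have := zeta_cont; fun_prop) (fun s => by simp [hp]) hd fun s => ?_
  have := zeta_lt.2 (ho s)
  simpa using this

lemma deg_low {c : ℝ → Ann} (hc : Continuous c) (hp : ∀ s, c (s+1) = c s)
    (o : Ann) (ho : ∀ s, o.2 < (c s).2) : Deg (fun s => zeta (c s) - zeta o) 0 := by
  refine Deg.near (by have := zeta_cont; fun_prop) (fun s => by simp [hp]) (Deg.const (neg_ne_zero.2 (zeta_ne o))) fun s => ?_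
  have := zeta_lt.2 (ho s)
  simpa using this

lemma lift_curve (γ : C(AddCircle (1:ℝ), Ann)) : ∃ (s : ℝ → ℝ) (d : ℤ), Continuous s ∧
    (∀ x : ℝ, pr (s x, (γ x).2) = γ x) ∧ ∀ x, s (x+1) = s x + d := by
  obtain ⟨a, ha⟩ := QuotientAddGroup.mk_surjective (γ ((0:ℝ) : AddCircle (1:ℝ))).1
  let g : C(ℝ, AddCircle (1:ℝ)) := ⟨fun x => (γ (x : AddCircle (1:ℝ))).1, by
    have : Continuous fun x : ℝ => (x : AddCircle (1:ℝ)) := AddCircle.continuous_mk' 1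
    fun_prop⟩
  obtain ⟨L, ⟨hL0, hL⟩, -⟩ := (AddCircle.isCoveringMap_coe (1:ℝ)).existsUnique_continuousMap_lifts g 0 a ha
  have hL' : ∀ x, ((L x : ℝ) : AddCircle (1:ℝ)) = (γ (x : AddCircle (1:ℝ))).1 := fun x => congrFun hL x
  have h1 : ∀ x, ∃ n : ℤ, L (x+1) = L x + n := by
    intro x
    have : pr (L x, 0) = pr (L (x+1), 0) := by
      unfold pr
      simp only [hL', AddCircle.coe_add_period]
    obtain ⟨n, hn⟩ := pr_eq_iff.1 this
    exact ⟨n, by simpa using congrArg Prod.fst hn⟩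
  obtain ⟨d, hd⟩ := h1 0
  refine ⟨L, d, L.continuous, fun x => Prod.ext (hL' x) rfl, fun x => ?_⟩
  have := ang_unique L.continuous (L.continuous.comp (by fun_prop : Continuous fun x : ℝ => x + 1)) h1 0 x
  simp only [comp_apply] at this
  linarith


lemma circ_quot : IsQuotientMap (fun x : ℝ => (x : AddCircle (1:ℝ))) := isQuotientMap_quotient_mk'

lemma circ_desc {X : Type*} [TopologicalSpace X] {g : ℝ → X} (hg : Continuous g) (hp : ∀ x, g (x+1) = g x) :
    ∃ q : C(AddCircle (1:ℝ), X), ∀ x : ℝ, q x = g x := by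
  have hp' : Function.Periodic g 1 := hp
  refine ⟨⟨hp'.lift, ?_⟩, fun x => hp'.lift_coe x⟩
  rw [circ_quot.continuous_iff]
  exact hg

lemma essential_deg {γ : C(AddCircle (1:ℝ), Ann)} (hγ : EssentialCurve γ) {s : ℝ → ℝ} {d : ℤ} (hs : Continuous s)
    (h1 : ∀ x : ℝ, pr (s x, (γ x).2) = γ x) (h2 : ∀ x, s (x+1) = s x + d) : d ≠ 0 := by
  rintro rfl
  obtain ⟨Q, hQ⟩ := circ_desc hs (fun x => by rw [h2]; simp)
  have hγQ : ∀ a, pr (Q a, (γ a).2) = γ a := by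
    intro a
    obtain ⟨x, rfl⟩ := QuotientAddGroup.mk_surjective a
    have := h1 x
    rw [← hQ] at this
    exact this
  apply hγ.2 (pr 0)
  have c := pr_cont
  refine ContinuousMap.Homotopic.symm ⟨⟨⟨fun q => pr ((q.1 : ℝ) • ((Q q.2, (γ q.2).2) : Pl)), by fun_prop⟩, fun a => ?_, fun a => ?_⟩⟩
  · simp
  · simp only [Set.Icc.coe_one, one_smul]; exact hγQ a

lemma graph_essential {ψ : ℝ → ℝ} (hc : Continuous ψ) (hp : ∀ x, ψ (x+1) = ψ x) :
    ∃ γ : C(AddCircle (1:ℝ), Ann), EssentialCurve γ ∧ ∀ x : ℝ, γ x = pr (x, ψ x) := by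
  obtain ⟨q, hq⟩ := circ_desc hc hp
  refine ⟨⟨fun a => (a, q a), by fun_prop⟩, ⟨?_, ?_⟩, fun x => ?_⟩
  · exact Topology.IsEmbedding.of_comp (f := fun a => (a, q a)) (g := Prod.fst) (by fun_prop) continuous_fst .id
  · intro z hz
    obtain ⟨H⟩ := hz.symm
    obtain ⟨a, ha⟩ := QuotientAddGroup.mk_surjective z.1
    let H' : C(unitInterval × AddCircle (1:ℝ), AddCircle (1:ℝ)) := ⟨fun p => (H p).1, by fun_prop⟩
    let L := (AddCircle.isCoveringMap_coe (1:ℝ)).liftHomotopy H' (ContinuousMap.const _ a) (fun b => by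
      show (H (0, b)).1 = _
      rw [H.apply_zero]; exact ha.symm)
    have hL := (AddCircle.isCoveringMap_coe (1:ℝ)).liftHomotopy_lifts H' (ContinuousMap.const _ a) (fun b => by
      show (H (0, b)).1 = _
      rw [H.apply_zero]; exact ha.symm)
    have hL1 : ∀ b : AddCircle (1:ℝ), ((L (1, b) : ℝ) : AddCircle (1:ℝ)) = b := by
      intro b
      have := congrFun hL (1, b)
      have e : H' (1, b) = b := by
        show (H (1, b)).1 = b
        rw [H.apply_one]; rfl
      rw [e] at this
      exact this
    have ccoe : Continuous fun x : ℝ => (x : AddCircle (1:ℝ)) := AddCircle.continuous_mk' 1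
    have h3 := ang_unique (θ := fun x : ℝ => x) (θ' := fun x : ℝ => L (1, (x : AddCircle (1:ℝ)))) continuous_id
      (by fun_prop) (fun x => by
        have : pr (x, 0) = pr (L (1, (x : AddCircle (1:ℝ))), 0) := by
          unfold pr; simp only [hL1]
        obtain ⟨n, hn⟩ := pr_eq_iff.1 this
        exact ⟨n, by simpa using congrArg Prod.fst hn⟩) 0 (0+1)
    simp only [AddCircle.coe_add_period] at h3
    linarith
  · exact Prod.ext rfl (hq x)

lemma log_ann {g : Ann → ℂ} (hg : Continuous g) (h0 : ∀ z, g z ≠ 0) (hd : Deg (fun s : ℝ => g (pr (s, 0))) 0) :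
    ∃ l : Ann → ℂ, Continuous l ∧ ∀ z, Complex.exp (l z) = g z := by
  have c := pr_cont
  obtain ⟨L, hL, he⟩ := exp_lift (fun p : Pl => g (pr p)) (by fun_prop) (fun p => h0 _)
  obtain ⟨L', hL', he', hp'⟩ := hd
  have h1 := exp_diff_const (L := fun p : Pl => L (p + (1,0))) (L' := L) (by fun_prop) hL (fun p => by
    simp only [he]
    have := pr_add_int p 1
    simp only [Int.cast_one] at this
    rw [this])
  have h2 := exp_diff_const (L := fun s : ℝ => L (s, 0)) (L' := L') (by fun_prop) hL' (fun s => by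
    simp only [he, he'])
  have hper : ∀ p : Pl, L (p + (1,0)) = L p := by
    intro p
    have a := h1 p (0,0)
    have b := h2 1 0
    have c := hp' 0
    simp only [zero_add, Prod.mk_add_mk, Int.cast_zero, zero_mul, add_zero] at a b c
    linear_combination a + b + c
  have hperZ : ∀ (p : Pl) (n : ℤ), L (p + ((n:ℝ),0)) = L p := by
    intro p n
    have : Function.Periodic (fun x => L (x, p.2)) 1 := fun x => by
      have := hper (x, p.2)
      simpa using this
    have := this.int_mul n p.1
    simp only [mul_one] at this
    have e : p + ((n:ℝ),0) = (p.1 + n, p.2) := by ext <;> simp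
    rw [e, this]
  refine ⟨fun z => L (Classical.choose (pr_surj z)), ?_, fun z => ?_⟩
  · rw [pr_quot.isQuotientMap.continuous_iff]
    have : (fun z => L (Classical.choose (pr_surj z))) ∘ pr = L := by
      funext p
      simp only [comp_apply]
      have := Classical.choose_spec (pr_surj (pr p))
      obtain ⟨n, hn⟩ := pr_eq_iff.1 this
      conv_rhs => rw [hn, hperZ]
    rw [this]; exact hL
  · rw [he, Classical.choose_spec (pr_surj z)]

end

set_option linter.all false
noncomputable section
open MeasureTheory Set Filter Topology Function

namespace IsotopySetup
variable {S : IsotopySetup} {φm φp : ℝ → ℝ}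

lemma Strip.foliate (h : S.Strip φm φp) (ht : S.PosTwist) (hpres : MeasurePreserving S.f volume volume)
    (U : Set Ann) (hU : ∀ p, pr p ∈ U ↔ (φm p.1 < p.2 ∧ p.2 < φp p.1)) : C0IntegrableOn S.f U := by
  obtain ⟨M, hM⟩ := h.reg.bdd
  set W : Set Pl := {p | φm p.1 < p.2 ∧ p.2 < φp p.1} with hW
  have hWc : ∀ p ∈ W, p ∈ Wc φm φp := fun p hp => ⟨hp.1.le, hp.2.le⟩
  have hex : ∀ z : Pl, ∃ ψ : ℝ → ℝ, z ∈ W → ∀ x, φm x < ψ x ∧ ψ x < φp x ∧ BEq S (x, ψ x) z := by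
    intro z
    by_cases hz : z ∈ W
    · choose ψ hψ using fun x => h.exist ht hpres hz x
      exact ⟨ψ, fun _ => hψ⟩
    · exact ⟨0, fun hz' => absurd hz' hz⟩
  choose ψ hψ using hex
  have huniq : ∀ z ∈ W, ∀ p ∈ W, BEq S p z → p.2 = ψ z p.1 := by
    intro z hz p hp hb
    have h1 := hψ z hz p.1
    exact h.uniq ht hpres (x := p.1) (y := p.2) (y' := ψ z p.1) (hWc p hp) ⟨h1.1.le, h1.2.1.le⟩ (hb.trans h1.2.2.symm)
  have hψW : ∀ z ∈ W, ∀ x, (x, ψ z x) ∈ W := fun z hz x => ⟨(hψ z hz x).1, (hψ z hz x).2.1⟩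
  have hper : ∀ z ∈ W, ∀ x, ψ z (x+1) = ψ z x := by
    intro z hz x
    symm
    have h1 := hψ z hz x
    have e : ((x, ψ z x) : Pl) + (((1:ℤ):ℝ),0) = (x+1, ψ z x) := by ext <;> simp
    have h2 := BEq.int (S := S) (x, ψ z x) 1
    rw [e] at h2
    exact huniq z hz (x+1, ψ z x) ⟨by simp [h.pm, h1.1], by simp [h.pp, h1.2.1]⟩ (h2.trans h1.2.2)
  have hcont : ∀ z ∈ W, Continuous (ψ z) := by
    intro z hz
    rw [continuous_iff_continuousAt]
    intro x0
    set z0 : Pl := (x0, ψ z x0) with hz0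
    have hz0W : z0 ∈ W := hψW z hz x0
    have cF : ∀ n, Continuous (S.F^[n]) := fun n => (S.iter_smooth n).continuous
    set K : Set Pl := Wc φm φp ∩ ⋂ n, {p | |(S.F^[n] p).1 - (S.F^[n] z0).1| ≤ 1} with hK
    have hKc : IsClosed K := by
      refine IsClosed.inter ?_ (isClosed_iInter fun n => ?_)
      · have w1 : IsClosed {p : Pl | φm p.1 ≤ p.2} := isClosed_le (h.cm.comp continuous_fst) continuous_snd
        have w2 : IsClosed {p : Pl | p.2 ≤ φp p.1} := isClosed_le continuous_snd (h.cp.comp continuous_fst)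
        exact w1.inter w2
      · have := cF n
        exact isClosed_le (by fun_prop) (by fun_prop)
    refine continuousAt_of_closed (M := M) hKc ?_ ?_
    · filter_upwards [Metric.ball_mem_nhds x0 one_pos] with x hx
      rw [Metric.mem_ball, Real.dist_eq, abs_lt] at hx
      have hxW := hψW z hz x
      refine ⟨⟨hWc _ hxW, mem_iInter.2 fun n => ?_⟩, hM _ hxW⟩
      obtain ⟨B, hB⟩ := (hψ z hz x).2.2.trans (hψ z hz x0).2.2.symm
      have q1 := h.quant ht hpres (p := (x, ψ z x)) (z := z0) (hWc _ hxW) (hWc _ hz0W) 1 (by simp [hz0]; linarith)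
        ⟨B, fun n => (abs_le.1 (hB n)).2⟩ n
      have q2 := h.quant ht hpres (p := z0) (z := (x, ψ z x)) (hWc _ hz0W) (hWc _ hxW) 1 (by simp [hz0]; linarith)
        ⟨B, fun n => by have := (abs_le.1 (hB n)).1; linarith⟩ n
      simp only [mem_setOf_eq, abs_le]
      push_cast at q1 q2
      constructor <;> linarith
    · intro y hy
      have h1 : BEq S (x0, y) z0 := ⟨1, fun n => mem_iInter.1 hy.2 n⟩
      exact h.uniq ht hpres hy.1 (hWc _ hz0W) h1
  have hgr : ∀ z ∈ W, ∃ γ : C(AddCircle (1:ℝ), Ann), EssentialCurve γ ∧ ∀ x : ℝ, γ x = pr (x, ψ z x) :=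
    fun z hz => graph_essential (hcont z hz) (hper z hz)
  let γ : W → C(AddCircle (1:ℝ), Ann) := fun z => (hgr z.1 z.2).choose
  have hγ1 : ∀ z : W, EssentialCurve (γ z) := fun z => (hgr z.1 z.2).choose_spec.1
  have hγ2 : ∀ (z : W) (x : ℝ), γ z x = pr (x, ψ z x) := fun z => (hgr z.1 z.2).choose_spec.2
  -- range = projection of class
  have hmem : ∀ (z : W) (p : Pl), p ∈ W → (pr p ∈ range (γ z) ↔ BEq S p z) := by
    intro z p hp
    constructor
    · rintro ⟨a, ha⟩
      obtain ⟨x, rfl⟩ := QuotientAddGroup.mk_surjective a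
      have ha' : pr (x, ψ z x) = pr p := by rw [← hγ2 z x]; exact ha
      obtain ⟨n, rfl⟩ := pr_eq_iff.1 ha'
      exact (BEq.int _ _).trans (hψ z.1 z.2 x).2.2
    · intro hb
      refine ⟨(p.1 : AddCircle (1:ℝ)), ?_⟩
      rw [hγ2, ← huniq z.1 z.2 p hp hb]
  have hsub : ∀ (z : W), range (γ z) ⊆ U := by
    rintro z _ ⟨a, rfl⟩
    obtain ⟨x, rfl⟩ := QuotientAddGroup.mk_surjective a
    show γ z (x : AddCircle (1:ℝ)) ∈ U
    rw [hγ2, hU]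
    exact hψW z.1 z.2 x
  obtain ⟨B, hB⟩ := bdd_of_per S.F_smooth.continuous S.F_per M
  have hFeq : ∀ p ∈ W, BEq S (S.F p) p := by
    intro p hp
    refine ⟨B, fun n => ?_⟩
    rw [← iterate_succ_apply, iterate_succ_apply']
    exact (hB _ (hM _ ((h.reg.iter S n p).2 hp))).2
  have hinv : ∀ z : W, S.f '' range (γ z) = range (γ z) := by
    intro z
    apply Subset.antisymm
    · rintro _ ⟨w, hw, rfl⟩
      have hwU := hsub z hw
      obtain ⟨p, rfl⟩ := pr_surj w
      have hp := (hU p).1 hwU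
      rw [← S.lift_f]
      rw [hmem z p hp] at hw
      exact (hmem z (S.F p) ((h.reg.inv p).2 hp)).2 ((hFeq p hp).trans hw)
    · intro w hw
      have hwU := hsub z hw
      obtain ⟨p, rfl⟩ := pr_surj w
      have hp := (hU p).1 hwU
      rw [hmem z p hp] at hw
      have hG : S.G p ∈ W := by rw [← h.reg.inv, S.FG]; exact hp
      refine ⟨pr (S.G p), (hmem z _ hG).2 ?_, ?_⟩
      · have := hFeq _ hG
        rw [S.FG] at this
        exact this.symm.trans hw
      · rw [← S.lift_f]
        exact congrArg pr (S.FG p)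
  refine ⟨{Γ : Set Ann // ∃ z : W, range (γ z) = Γ}, fun i => γ i.2.choose, fun i => ⟨hγ1 _, hinv _⟩, ?_, ?_⟩
  · apply Subset.antisymm
    · exact iUnion_subset fun i => hsub _
    · intro w hw
      obtain ⟨p, rfl⟩ := pr_surj w
      have hp := (hU p).1 hw
      have hch : ∀ i : {Γ : Set Ann // ∃ z : W, range (γ z) = Γ}, range (γ i.2.choose) = i.1 := fun i => i.2.choose_spec
      refine mem_iUnion.2 ⟨⟨range (γ ⟨p, hp⟩), ⟨p, hp⟩, rfl⟩, ?_⟩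
      rw [hch]
      exact (hmem ⟨p, hp⟩ p hp).2 ⟨0, fun n => by simp⟩
  · intro i j hij
    rw [Function.onFun, Set.disjoint_left]
    intro w hi hj
    apply hij
    apply Subtype.ext
    rw [← i.2.choose_spec, ← j.2.choose_spec]
    have hwU := hsub _ hi
    obtain ⟨p, rfl⟩ := pr_surj w
    have hp := (hU p).1 hwU
    rw [hmem _ p hp] at hi hj
    ext w'
    have key : ∀ a b : W, BEq S p a → BEq S p b → w' ∈ range (γ a) → w' ∈ range (γ b) := by
      intro a b ha hb hw'
      have hwU' := hsub _ hw'
      obtain ⟨q, rfl⟩ := pr_surj w'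
      have hq := (hU q).1 hwU'
      rw [hmem _ q hq] at hw' ⊢
      exact hw'.trans (ha.symm.trans hb)
    exact ⟨key _ _ hi hj, key _ _ hj hi⟩

end IsotopySetup

/-! ### the complement of an annulus has no compact clopen pieces -/

def NoCpt (C : Set Ann) : Prop := ∀ K ⊆ C, IsCompact K → IsClosed (C \ K) → K = ∅

lemma ann_noCpt {U : Set Ann} (hUo : IsOpen U) (hUb : Bornology.IsBounded U) (hH : Nonempty (U ≃ₜ Ann))
    (hess : EssentialSet U) : NoCpt Uᶜ := by
  obtain ⟨H⟩ := hH
  obtain ⟨γ, hγ, hγU⟩ := hess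
  have cz := zeta_cont
  have cpr := pr_cont
  set h : Ann → Ann := fun z => (H.symm z : Ann) with hh
  have hc : Continuous h := by fun_prop
  have hhU : ∀ z, h z ∈ U := fun z => (H.symm z).2
  have hp1 : ∀ s : ℝ, pr (s+1, 0) = pr (s, 0) := fun s => by
    have := pr_add_int (s,0) 1
    simpa using this
  obtain ⟨k, hk⟩ : ∃ k, Deg (fun s : ℝ => zeta (h (pr (s,0)))) k :=
    Deg.exist (by fun_prop) (fun s => zeta_ne _) (fun s => by simp only [hp1])
  have hk0 : k ≠ 0 := by
    rintro rfl
    obtain ⟨l, hl, hle⟩ := log_ann (g := fun z => zeta (h z)) (by fun_prop) (fun z => zeta_ne _) hk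
    obtain ⟨s, d, hs, hs1, hs2⟩ := lift_curve γ
    have hd := essential_deg hγ hs hs1 hs2
    have hper : ∀ x : ℝ, γ ((x+1 : ℝ) : AddCircle (1:ℝ)) = γ x := fun x => by rw [AddCircle.coe_add_period]
    have ccoe : Continuous fun x : ℝ => (x : AddCircle (1:ℝ)) := AddCircle.continuous_mk' 1
    have D1 : Deg (fun x : ℝ => zeta (γ x)) d := by
      refine (zeta_deg (s := s) (y := fun x => (γ x).2) hs (by fun_prop) hs2 (fun x => by simp only [hper])).congr fun x => ?_
      simp only [hs1]
    have D0 : Deg (fun x : ℝ => zeta (γ x)) 0 := by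
      have hmem : ∀ x : ℝ, γ x ∈ U := fun x => hγU ⟨_, rfl⟩
      refine ⟨fun x => l (H ⟨γ x, hmem x⟩), ?_, fun x => ?_, fun x => ?_⟩
      · refine hl.comp (H.continuous.comp (Continuous.subtype_mk (by fun_prop) _))
      · rw [hle]; simp [hh]
      · simp only [hper]; simp
    exact hd (D1.unique D0)
  intro K hKU hKc hKcl
  by_contra hKne
  obtain ⟨o, ho⟩ := nonempty_iff_ne_empty.2 hKne
  have hzo : ∀ z, z ≠ o → zeta z - zeta o ≠ 0 := fun z hz h => hz (zeta_inj (sub_eq_zero.1 h))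
  have hho : ∀ z, h z ≠ o := fun z e => hKU ho (e ▸ hhU z)
  obtain ⟨d, hd⟩ : ∃ d, Deg (fun s : ℝ => zeta (h (pr (s,0))) - zeta o) d :=
    Deg.exist (by fun_prop) (fun s => hzo _ (hho _)) (fun s => by simp only [hp1])
  have hgc : Continuous fun z => (zeta (h z) - zeta o)^k * zeta (h z)^(-d) := by
    refine Continuous.mul ?_ ?_
    · exact Continuous.zpow₀ (by fun_prop) _ (fun z => Or.inl (hzo _ (hho z)))
    · exact Continuous.zpow₀ (by fun_prop) _ (fun z => Or.inl (zeta_ne _))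
  obtain ⟨l, hl, hle⟩ := log_ann hgc (fun z => mul_ne_zero (zpow_ne_zero _ (hzo _ (hho z))) (zpow_ne_zero _ (zeta_ne _)))
    (by
      have := (hd.zpow k).mul (hk.zpow (-d))
      have e : k * d + -d * k = 0 := by ring
      rwa [e] at this)
  set K2 := Uᶜ \ K with hK2
  have hdisj : Disjoint K K2 := disjoint_sdiff_right
  -- separated neighbourhoods
  obtain ⟨O1, hO1o, hO1, hO1c⟩ := normal_exists_closure_subset (s := K) (t := K2ᶜ) hKc.isClosed hKcl.isOpen_compl
    (disjoint_left.1 hdisj)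
  obtain ⟨O2, hO2o, hO2, hO2c⟩ := normal_exists_closure_subset (s := K2) (t := (closure O1)ᶜ) hKcl isClosed_closure.isOpen_compl
    (fun z hz h => hO1c h hz)
  obtain ⟨χ, hχ0, hχ1, -⟩ := exists_continuous_zero_one_of_isClosed (isClosed_closure (s := O1)) (isClosed_closure (s := O2))
    (disjoint_left.2 fun z h1 h2 => hO2c h2 h1)
  classical
  let lU : Ann → ℂ := fun z => if hz : z ∈ U then l (H ⟨z, hz⟩) else 0
  let G : Ann → ℂ := fun z => if z ∈ U then zeta z ^ d * Complex.exp (χ z * lU z) else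
    if z ∈ K then zeta z ^ d else (zeta z - zeta o)^k
  have hlU : ∀ z ∈ U, Complex.exp (lU z) = (zeta z - zeta o)^k * zeta z ^ (-d) := by
    intro z hz
    simp only [lU, dif_pos hz, hle]
    simp [hh]
  have G1 : ∀ z ∈ O1, G z = zeta z ^ d := by
    intro z hz
    by_cases hzU : z ∈ U
    · have : χ z = 0 := hχ0 (subset_closure hz)
      simp [G, hzU, this]
    · by_cases hzK : z ∈ K
      · simp [G, hzU, hzK]
      · exact absurd (show z ∈ K2 from ⟨hzU, hzK⟩) (hO1c (subset_closure hz))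
  have G2 : ∀ z ∈ O2, G z = (zeta z - zeta o)^k := by
    intro z hz
    by_cases hzU : z ∈ U
    · have : χ z = 1 := hχ1 (subset_closure hz)
      simp only [G, if_pos hzU, this, Complex.ofReal_one, one_mul, hlU z hzU]
      rw [mul_comm, mul_assoc, ← zpow_add₀ (zeta_ne z)]; simp
    · have hzK : z ∉ K := fun hzK => hO2c (subset_closure hz) (subset_closure (hO1 hzK))
      simp [G, hzU, hzK]
  have hGne : ∀ z, G z ≠ 0 := by
    intro z
    by_cases hzU : z ∈ U
    · simp only [G, if_pos hzU]
      exact mul_ne_zero (zpow_ne_zero _ (zeta_ne z)) (Complex.exp_ne_zero _)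
    · by_cases hzK : z ∈ K
      · simp only [G, if_neg hzU, if_pos hzK]
        exact zpow_ne_zero _ (zeta_ne z)
      · simp only [G, if_neg hzU, if_neg hzK]
        exact zpow_ne_zero _ (hzo z fun e => hzK (e ▸ ho))
  have hGc : Continuous G := by
    rw [continuous_iff_continuousAt]
    intro z
    by_cases hzU : z ∈ U
    · have h1 : ContinuousOn G U := by
        rw [continuousOn_iff_continuous_restrict]
        have : U.domRestrict G = fun z : U => zeta z ^ d * Complex.exp (χ z * l (H z)) := by
          funext z
          show G z = _
          simp only [G, lU, if_pos z.2, dif_pos z.2]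
        rw [this]
        refine Continuous.mul (Continuous.zpow₀ (by fun_prop) _ fun z => Or.inl (zeta_ne _)) ?_
        have := χ.continuous
        fun_prop
      exact h1.continuousAt (hUo.mem_nhds hzU)
    · by_cases hzK : z ∈ K
      · have : G =ᶠ[𝓝 z] fun z => zeta z ^ d := by
          filter_upwards [hO1o.mem_nhds (hO1 hzK)] with w hw using G1 w hw
        refine ContinuousAt.congr ?_ this.symm
        exact (Continuous.zpow₀ cz _ fun z => Or.inl (zeta_ne z)).continuousAt
      · have : G =ᶠ[𝓝 z] fun z => (zeta z - zeta o) ^ k := by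
          filter_upwards [hO2o.mem_nhds (hO2 ⟨hzU, hzK⟩)] with w hw using G2 w hw
        refine ContinuousAt.congr ?_ this.symm
        exact ContinuousAt.zpow₀ (by fun_prop) _ (Or.inl (hzo z fun e => hzK (e ▸ ho)))
  -- degree on circles
  have hclop := fun n => Deg.isClopen (X := ℝ) (fun y s => G (pr (s, y))) (by unfold uncurry; fun_prop)
    (fun y s => by
      have := pr_add_int (s,y) 1
      simp at this
      simp only [this]) (fun y s => hGne _) n
  obtain ⟨R, hR⟩ : ∃ R : ℝ, ∀ z ∈ U ∪ K, |z.2| ≤ R := by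
    obtain ⟨R, hR⟩ := (hUb.union hKc.isBounded).exists_norm_le
    exact ⟨R, fun z hz => (norm_snd_le z).trans (hR z hz)⟩
  have hoR := hR o (Or.inr ho)
  rw [abs_le] at hoR
  have hG3 : ∀ z : Ann, R < |z.2| → G z = (zeta z - zeta o)^k := by
    intro z hz
    apply G2
    apply hO2
    refine ⟨fun h => ?_, fun h => ?_⟩
    · exact absurd (hR z (Or.inl h)) (not_le.2 hz)
    · exact absurd (hR z (Or.inr h)) (not_le.2 hz)
  have hid : ∀ y : ℝ, Deg (fun s : ℝ => zeta (pr (s, y))) 1 := fun y =>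
    zeta_deg (s := fun s => s) (y := fun _ => y) continuous_id continuous_const (fun x => by simp) (fun x => rfl)
  have hpy : ∀ y s : ℝ, pr (s+1, y) = pr (s, y) := fun y s => by
    have := pr_add_int (s,y) 1
    simpa using this
  have hR0 : 0 ≤ R := by linarith
  have dlo : Deg (fun s : ℝ => G (pr (s, -(R+1)))) 0 ∨ True := Or.inr trivial
  have d1 : Deg (fun s : ℝ => G (pr (s, -(R+1)))) (k * 1) := by
    refine ((deg_high (c := fun s => pr (s, -(R+1))) (by fun_prop) (hpy _) (hid _) o (fun s => ?_)).zpow k).congr fun s => ?_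
    · simp; linarith
    · rw [hG3]; simp; rw [abs_of_nonpos (by linarith)]; linarith
  have d2 : Deg (fun s : ℝ => G (pr (s, R+1))) (k * 0) := by
    refine ((deg_low (c := fun s => pr (s, R+1)) (by fun_prop) (hpy _) o (fun s => ?_)).zpow k).congr fun s => ?_
    · simp; linarith
    · rw [hG3]; simp; rw [abs_of_nonneg (by linarith)]; linarith
  have huniv := (hclop (k*1)).eq_univ ⟨_, d1⟩
  have d3 : Deg (fun s : ℝ => G (pr (s, R+1))) (k * 1) := by
    have : (R+1) ∈ (univ : Set ℝ) := mem_univ _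
    rw [← huniv] at this
    exact this
  have := d3.unique d2
  simp at this
  exact hk0 this

end

set_option linter.all false
noncomputable section
open MeasureTheory Set Filter Topology Function

/-- angle of a vector of the lower half plane -/
def dn (u : Pl) : ℝ := 1/2 + Real.arctan (-u.1/u.2) / (2 * Real.pi)

lemma dn_ang {u : Pl} (h : u.2 < 0) : IsAng (dn u) u := by
  have hp := Real.pi_pos
  have hc := Real.cos_arctan_pos (-u.1/u.2)
  refine ⟨-u.2 / Real.cos (Real.arctan (-u.1/u.2)), div_pos (by linarith) hc, ?_⟩
  have ht := Real.tan_arctan (-u.1/u.2)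
  rw [Real.tan_eq_sin_div_cos] at ht
  have e : 2 * Real.pi * dn u = Real.arctan (-u.1/u.2) + Real.pi := by
    unfold dn; field_simp; ring
  unfold dirv
  rw [e, Real.sin_add_pi, Real.cos_add_pi]
  set c := Real.cos (Real.arctan (-u.1/u.2))
  set s := Real.sin (Real.arctan (-u.1/u.2))
  have hu : u.2 ≠ 0 := h.ne
  have hc' : c ≠ 0 := hc.ne'
  rw [div_eq_div_iff hc' hu] at ht
  ext
  · simp
    field_simp
    linarith
  · simp
    field_simp

lemma dn_range (u : Pl) : 1/4 < dn u ∧ dn u < 3/4 := by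
  have hp := Real.pi_pos
  have h1 := Real.neg_pi_div_two_lt_arctan (-u.1/u.2)
  have h2 := Real.arctan_lt_pi_div_two (-u.1/u.2)
  unfold dn
  have e1 : -(1/4) < Real.arctan (-u.1/u.2) / (2*Real.pi) := by
    rw [lt_div_iff₀ (by positivity)]; linarith
  have e2 : Real.arctan (-u.1/u.2) / (2*Real.pi) < 1/4 := by
    rw [div_lt_iff₀ (by positivity)]; linarith
  constructor <;> linarith

lemma dn_cont {X : Type*} [TopologicalSpace X] {u : X → Pl} (hu : Continuous u) (h : ∀ x, (u x).2 < 0) :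
    Continuous fun x => dn (u x) := by
  unfold dn
  refine continuous_const.add (Continuous.div_const (Real.continuous_arctan.comp ?_) _)
  exact Continuous.div (by fun_prop) (by fun_prop) fun x => (h x).ne

lemma isAng_int {a : ℝ} {u : Pl} (h : IsAng a u) (k : ℤ) (e : a = k) : u.1 = 0 ∧ 0 < u.2 :=
  isAng_up h k (by rw [e])

structure BD (V : Set Ann) (M : ℝ) : Prop where
  op : IsOpen V
  conn : IsConnected V
  hi : ∀ z : Ann, M ≤ z.2 → z ∉ V
  lo : ∀ z : Ann, z.2 ≤ -M → z ∈ V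
  nc : NoCpt Vᶜ

abbrev Vt (V : Set Ann) := {p : Pl // pr p ∈ V}
abbrev Ct (V : Set Ann) := {p : Pl // pr p ∉ V}

lemma sub_ne_VC {V : Set Ann} {z o : Pl} (hz : pr z ∈ V) (ho : pr o ∉ V) : z - o ≠ 0 := by
  intro h
  rw [sub_eq_zero.1 h] at hz
  exact ho hz

namespace BD

lemma lowC {V : Set Ann} {M : ℝ} (hB : BD V M) {o : Pl} (ho : pr o ∉ V) : -M < o.2 := by
  by_contra h
  exact ho (hB.lo _ (by rw [pr_snd]; linarith))

lemma hiV {V : Set Ann} {M : ℝ} (hB : BD V M) {o : Pl} (ho : pr o ∈ V) : o.2 < M := by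
  by_contra h
  exact hB.hi _ (by rw [pr_snd]; linarith) ho

lemma op' {V : Set Ann} {M : ℝ} (hB : BD V M) : IsOpen (pr ⁻¹' V) := hB.op.preimage pr_cont

lemma preconn {V : Set Ann} {M : ℝ} (hB : BD V M) : IsPreconnected (pr ⁻¹' V) := by
  set b : Pl := (0, -M) with hb
  have hbV : b ∈ pr ⁻¹' V := hB.lo _ (by rw [pr_snd])
  set Q := connectedComponentIn (pr ⁻¹' V) b with hQ
  have hQo : IsOpen Q := hB.op'.connectedComponentIn
  have hlow : {p : Pl | p.2 ≤ -M} ⊆ Q := by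
    apply IsPreconnected.subset_connectedComponentIn
    · have : Convex ℝ {p : Pl | p.2 ≤ -M} := by
        have := (convex_Iic (-M)).linear_preimage (LinearMap.snd ℝ ℝ ℝ)
        exact this
      exact this.isPreconnected
    · simp [hb]
    · intro p hp
      exact hB.lo _ (by rw [pr_snd]; exact hp)
  have htr : ∀ p ∈ Q, ∀ n : ℤ, p + ((n:ℝ),0) ∈ Q := by
    intro p hp n
    have : (fun p : Pl => p + ((n:ℝ),(0:ℝ))) '' Q ⊆ Q := by
      have e : Q = connectedComponentIn (pr ⁻¹' V) (b + ((n:ℝ),0)) := 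
        connectedComponentIn_eq (hlow (show (b + ((n:ℝ),0)).2 ≤ -M by simp [hb]))
      conv_rhs => rw [e]
      apply IsPreconnected.subset_connectedComponentIn
      · exact isPreconnected_connectedComponentIn.image _ (by fun_prop)
      · exact ⟨b, mem_connectedComponentIn hbV, rfl⟩
      · rintro _ ⟨q, hq, rfl⟩
        have := connectedComponentIn_subset _ _ hq
        show pr _ ∈ V
        rw [pr_add_int]; exact this
    exact this ⟨p, hp, rfl⟩
  have hR : IsOpen (pr ⁻¹' V \ Q) := by
    rw [isOpen_iff_mem_nhds]
    rintro p ⟨hp, hpQ⟩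
    have h1 : IsOpen (connectedComponentIn (pr ⁻¹' V) p) := hB.op'.connectedComponentIn
    refine mem_of_superset (h1.mem_nhds (mem_connectedComponentIn hp)) fun q hq => ?_
    refine ⟨connectedComponentIn_subset _ _ hq, fun hqQ => hpQ ?_⟩
    have e1 := connectedComponentIn_eq hq
    have e2 := connectedComponentIn_eq hqQ
    rw [hQ, e2, ← e1]
    exact mem_connectedComponentIn hp
  have hempty : pr ⁻¹' V \ Q = ∅ := by
    by_contra hne
    obtain ⟨p, hp⟩ := nonempty_iff_ne_empty.2 hne
    have := hB.conn.isPreconnected (pr '' Q) (pr '' (pr ⁻¹' V \ Q)) (pr_open _ hQo) (pr_open _ hR) ?_ ?_ ?_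
    · obtain ⟨_, -, ⟨q, hq, rfl⟩, r, hr, e⟩ := this
      obtain ⟨n, hn⟩ := pr_eq_iff.1 e.symm
      exact hr.2 (hn ▸ htr q hq n)
    · intro z hz
      obtain ⟨q, rfl⟩ := pr_surj z
      by_cases hq : q ∈ Q
      · exact Or.inl ⟨q, hq, rfl⟩
      · exact Or.inr ⟨q, ⟨hz, hq⟩, rfl⟩
    · exact ⟨pr b, hbV, b, mem_connectedComponentIn hbV, rfl⟩
    · exact ⟨pr p, hp.1, p, hp, rfl⟩
  have : pr ⁻¹' V = Q := Subset.antisymm (diff_eq_empty.1 hempty) (connectedComponentIn_subset _ _)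
  rw [this]
  exact isPreconnected_connectedComponentIn

end BD

/-- intrinsic characterisation of the angle function based at `z`. -/
structure AF (V : Set Ann) (z : Pl) (φ : Ct V → ℝ) : Prop where
  cont : Continuous φ
  ang : ∀ o, IsAng (φ o) (z - o.1)
  far : ∃ R : ℝ, ∀ o : Ct V, (R < |o.1.1| ∨ R < o.1.2) → 0 < φ o ∧ φ o < 1

lemma AF.unique {V M} (hB : BD V M) {z φ φ'} (h : AF V z φ) (h' : AF V z φ') : φ = φ' := by
  obtain ⟨R, hR⟩ := h.far
  obtain ⟨R', hR'⟩ := h'.far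
  have hn : ∀ o, ∃ n : ℤ, φ' o = φ o + n := fun o => (h.ang o).unique (h'.ang o)
  choose n hn using hn
  have hc : Continuous (fun x => ((n x : ℤ) : ℝ)) := by
    have : (fun x => ((n x : ℤ) : ℝ)) = fun x => φ' x - φ x := by funext x; rw [hn]; ring
    have h1 := h.cont
    have h2 := h'.cont
    rw [this]; fun_prop
  have hc' : Continuous n := Int.isClosedEmbedding_coe_real.isEmbedding.continuous_iff.2 hc
  have hcl : IsClopen {o | n o ≠ 0} := (isClopen_discrete {k : ℤ | k ≠ 0}).preimage hc'
  set Kt : Set Pl := Subtype.val '' {o : Ct V | n o ≠ 0} with hKt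
  have hCc : IsClosed (pr ⁻¹' V)ᶜ := hB.op'.isClosed_compl
  have hKc : IsClosed Kt := (hCc.isClosedEmbedding_subtypeVal.isClosedMap) _ hcl.1
  have hsub : Kt ⊆ Icc (-(max R R')) (max R R') ×ˢ Icc (-M) (max R R') := by
    rintro _ ⟨o, ho, rfl⟩
    by_contra hout
    have hfar : max R R' < |o.1.1| ∨ max R R' < o.1.2 := by
      by_contra hh
      push Not at hh
      exact hout ⟨abs_le.1 hh.1, (hB.lowC o.2).le, hh.2⟩
    have a1 := hR o (hfar.imp (lt_of_le_of_lt (le_max_left _ _)) (lt_of_le_of_lt (le_max_left _ _)))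
    have a2 := hR' o (hfar.imp (lt_of_le_of_lt (le_max_right _ _)) (lt_of_le_of_lt (le_max_right _ _)))
    apply ho
    have := hn o
    have b1 : (-1:ℝ) < n o := by linarith
    have b2 : (n o : ℝ) < 1 := by linarith
    have b1 : -1 < n o := by exact_mod_cast b1
    have b2 : n o < 1 := by exact_mod_cast b2
    omega
  have hKcpt : IsCompact Kt := (isCompact_Icc.prod isCompact_Icc).of_isClosed_subset hKc hsub
  obtain ⟨O, hO, hOe⟩ := isOpen_induced_iff.1 hcl.2
  have hKO : ∀ p, p ∈ Kt ↔ pr p ∉ V ∧ p ∈ O := by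
    intro p
    constructor
    · rintro ⟨o, ho, rfl⟩
      rw [← hOe] at ho
      exact ⟨o.2, ho⟩
    · rintro ⟨h1, h2⟩
      refine ⟨⟨p, h1⟩, ?_, rfl⟩
      rw [← hOe]; exact h2
  have hempty := hB.nc (pr '' Kt) (by
    rintro _ ⟨p, hp, rfl⟩
    exact ((hKO p).1 hp).1) (hKcpt.image pr_cont) (by
    have : Vᶜ \ (pr '' Kt) = Vᶜ ∩ (pr '' O)ᶜ := by
      ext w
      constructor
      · rintro ⟨h1, h2⟩
        refine ⟨h1, ?_⟩
        rintro ⟨p, hp, rfl⟩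
        exact h2 ⟨p, (hKO p).2 ⟨h1, hp⟩, rfl⟩
      · rintro ⟨h1, h2⟩
        refine ⟨h1, ?_⟩
        rintro ⟨p, hp, rfl⟩
        exact h2 ⟨p, ((hKO p).1 hp).2, rfl⟩
    rw [this]
    exact hB.op.isClosed_compl.inter (pr_open _ hO).isClosed_compl)
  rw [image_eq_empty] at hempty
  funext o
  have : n o = 0 := by
    by_contra h
    have : o.1 ∈ Kt := ⟨o, h, rfl⟩
    rw [hempty] at this
    exact this
  rw [hn o, this]; simp

lemma stay01 {X : Type*} [TopologicalSpace X] [PreconnectedSpace X] {a : X → ℝ} (ha : Continuous a)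
    (h0 : ∀ x, a x ≠ 0) (h1 : ∀ x, a x ≠ 1) (x0 x : X) (hx : 0 < a x0 ∧ a x0 < 1) : 0 < a x ∧ a x < 1 := by
  constructor
  · by_contra hh
    push Not at hh
    obtain ⟨y, hy⟩ := mem_range_of_exists_le_of_exists_ge ha ⟨x, hh⟩ ⟨x0, hx.1.le⟩
    exact h0 y hy
  · by_contra hh
    push Not at hh
    obtain ⟨y, hy⟩ := mem_range_of_exists_le_of_exists_ge ha ⟨x0, hx.2.le⟩ ⟨x, hh⟩
    exact h1 y hy

lemma AF.extend {V z φ} (hz : pr z ∈ V) (h : AF V z φ) {r : ℝ} (hr : 0 < r) (hball : Metric.ball z r ⊆ pr ⁻¹' V) :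
    ∃ ψ : C(Metric.ball z r × Ct V, ℝ), ∀ z', AF V z'.1 (fun o => ψ (z', o)) := by
  have hseg : ∀ (t : unitInterval) (z' : Metric.ball z r), z + (t:ℝ) • (z'.1 - z) ∈ Metric.ball z r := by
    intro t z'
    have h1 := z'.2
    rw [Metric.mem_ball, dist_eq_norm] at h1 ⊢
    rw [add_sub_cancel_left, norm_smul, Real.norm_of_nonneg t.2.1]
    have := mul_le_of_le_one_left (norm_nonneg (z'.1 - z)) t.2.2
    linarith
  let u : C(unitInterval × (Metric.ball z r × Ct V), Pl) :=
    ⟨fun x => z + (x.1:ℝ) • (x.2.1.1 - z) - x.2.2.1, by fun_prop⟩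
  have hu : ∀ x, u x ≠ 0 := fun x => sub_ne_VC (hball (hseg x.1 x.2.1)) x.2.2.2
  have hcφ := h.cont
  obtain ⟨a, ha, ha0⟩ := lift_ang u hu ⟨fun x => φ x.2, by fun_prop⟩ (fun x => by
    have := h.ang x.2
    simpa [u] using this)
  have ha0' : ∀ x, a (0, x) = φ x.2 := ha0
  refine ⟨⟨fun x => a (1, x), by fun_prop⟩, fun z' => ⟨by fun_prop, fun o => ?_, ?_⟩⟩
  · have := ha (1, (z', o))
    simpa [u] using this
  · obtain ⟨R, hR⟩ := h.far
    refine ⟨max R (‖z‖ + r), fun o ho => ?_⟩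
    have hfar := hR o (ho.imp (lt_of_le_of_lt (le_max_left _ _)) (lt_of_le_of_lt (le_max_left _ _)))
    have key : ∀ (t : unitInterval) (k : ℤ), a (t, (z', o)) ≠ k := by
      intro t k e
      obtain ⟨e1, e2⟩ := isAng_int (ha (t, (z', o))) k e
      have hb := hseg t z'
      set q := z + (t:ℝ) • (z'.1 - z) with hq
      have hq1 : ‖q‖ < ‖z‖ + r := by
        rw [Metric.mem_ball, dist_eq_norm] at hb
        have := norm_sub_norm_le q z
        linarith
      have e1 : (q - o.1).1 = 0 := e1
      have e2 : 0 < (q - o.1).2 := e2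
      simp only [Prod.fst_sub, Prod.snd_sub] at e1 e2
      have n1 := norm_fst_le q
      have n2 := norm_snd_le q
      rw [Real.norm_eq_abs] at n1 n2
      rcases ho with ho | ho
      · have := lt_of_le_of_lt (le_max_right _ _) ho
        rw [show o.1.1 = q.1 by linarith] at this
        linarith
      · have := lt_of_le_of_lt (le_max_right _ _) ho
        have := le_abs_self q.2
        linarith
    have hca : Continuous fun t : unitInterval => a (t, (z', o)) := by fun_prop
    have := stay01 hca (fun t => by simpa using key t 0) (fun t => by simpa using key t 1) 0 1 (by rw [ha0']; exact hfar)
    exact this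

lemma AF.low {V M} (hB : BD V M) {z : Pl} (hz : z.2 ≤ -M) : AF V z (fun o => dn (z - o.1)) := by
  have : ∀ o : Ct V, (z - o.1).2 < 0 := fun o => by
    have := hB.lowC o.2
    simp; linarith
  refine ⟨dn_cont (by fun_prop) this, fun o => dn_ang (this o), 0, fun o _ => ?_⟩
  have := dn_range (z - o.1)
  constructor <;> linarith

/-- the global angle function -/
structure TH (V : Set Ann) (M : ℝ) (θ : Vt V × Ct V → ℝ) : Prop where
  cont : Continuous θ
  ang : ∀ z o, IsAng (θ (z, o)) (z.1 - o.1)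
  low : ∀ z o, z.1.2 ≤ -M → 1/4 < θ (z, o) ∧ θ (z, o) < 3/4

lemma BD.exists_TH {V M} (hB : BD V M) : ∃ θ, TH V M θ := by
  have hex : ∀ z : Pl, pr z ∈ V → ∃ φ, AF V z φ := by
    intro z hz
    have hpc : PreconnectedSpace (Vt V) := Subtype.preconnectedSpace hB.preconn
    have hball : ∀ z : Pl, pr z ∈ V → ∃ r > 0, Metric.ball z r ⊆ pr ⁻¹' V := fun z hz =>
      Metric.isOpen_iff.1 hB.op' z hz
    have hcl : IsClopen {z : Vt V | ∃ φ, AF V z.1 φ} := by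
      constructor
      · rw [← isOpen_compl_iff, Metric.isOpen_iff]
        intro z0 hz0
        obtain ⟨r, hr, hb⟩ := hball z0.1 z0.2
        refine ⟨r/2, by linarith, ?_⟩
        rintro z1 hz1 ⟨φ, hφ⟩
        apply hz0
        have h12 : dist z1.1 z0.1 < r/2 := hz1
        obtain ⟨ψ, hψ⟩ := hφ.extend z1.2 (r := r/2) (by linarith) (by
          intro w hw
          apply hb
          rw [Metric.mem_ball] at hw ⊢
          have := dist_triangle w z1.1 z0.1
          linarith)
        exact ⟨_, hψ ⟨z0.1, by rw [Metric.mem_ball, dist_comm]; exact h12⟩⟩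
      · rw [Metric.isOpen_iff]
        rintro z0 ⟨φ, hφ⟩
        obtain ⟨r, hr, hb⟩ := hball z0.1 z0.2
        obtain ⟨ψ, hψ⟩ := hφ.extend z0.2 hr hb
        exact ⟨r, hr, fun z1 hz1 => ⟨_, hψ ⟨z1.1, hz1⟩⟩⟩
    have := hcl.eq_univ ⟨⟨(0, -M), hB.lo _ (by rw [pr_snd])⟩, _, AF.low hB le_rfl⟩
    have h2 : (⟨z, hz⟩ : Vt V) ∈ (univ : Set (Vt V)) := mem_univ _
    rw [← this] at h2
    exact h2
  choose φ hφ using hex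
  refine ⟨fun x => φ x.1.1 x.1.2 x.2, ?_, fun z o => (hφ _ _).ang o, fun z o hz => ?_⟩
  · rw [continuous_iff_continuousAt]
    rintro ⟨z0, o0⟩
    obtain ⟨r, hr, hb⟩ := Metric.isOpen_iff.1 hB.op' z0.1 z0.2
    obtain ⟨ψ, hψ⟩ := (hφ z0.1 z0.2).extend z0.2 hr hb
    have ho : IsOpen {x : Vt V × Ct V | x.1.1 ∈ Metric.ball z0.1 r} :=
      Metric.isOpen_ball.preimage (by fun_prop)
    have hc : ContinuousOn (fun x : Vt V × Ct V => φ x.1.1 x.1.2 x.2) {x : Vt V × Ct V | x.1.1 ∈ Metric.ball z0.1 r} := by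
      rw [continuousOn_iff_continuous_domRestrict]
      have : (domRestrict {x : Vt V × Ct V | x.1.1 ∈ Metric.ball z0.1 r} fun x : Vt V × Ct V => φ x.1.1 x.1.2 x.2) =
          fun x => ψ (⟨x.1.1.1, x.2⟩, x.1.2) := by
        funext x
        exact congrFun ((hφ _ _).unique hB (hψ ⟨x.1.1.1, x.2⟩)) x.1.2
      rw [this]
      fun_prop
    exact hc.continuousAt (ho.mem_nhds (by simp [hr]))
  · have := (hφ z.1 z.2).unique hB (AF.low hB hz)
    rw [this]
    exact dn_range _

end

set_option linter.all false
noncomputable section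
open MeasureTheory Set Filter Topology Function

lemma BD.shift {V M} (hB : BD V M) {θ} (h : TH V M θ) (z : Vt V) (o : Ct V) (n : ℤ) (z' : Vt V) (o' : Ct V)
    (hz : z'.1 = z.1 + ((n:ℝ),0)) (ho : o'.1 = o.1 + ((n:ℝ),0)) : θ (z', o') = θ (z, o) := by
  have hpc : PreconnectedSpace (Vt V) := Subtype.preconnectedSpace hB.preconn
  have hcθ := h.cont
  let τ : Vt V → Vt V := fun w => ⟨w.1 + ((n:ℝ),0), by rw [pr_add_int]; exact w.2⟩
  have hτ : Continuous τ := by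
    apply Continuous.subtype_mk; fun_prop
  have e : z' = τ z := Subtype.ext hz
  let w0 : Vt V := ⟨(0, -M), hB.lo _ (by rw [pr_snd])⟩
  have hu : ∀ w : Vt V, ∃ m : ℤ, θ (τ w, o') = θ (w, o) + m := fun w => by
    refine (h.ang w o).unique ?_
    have := h.ang (τ w) o'
    have e2 : (τ w).1 - o'.1 = w.1 - o.1 := by rw [ho]; simp [τ]
    rwa [e2] at this
  have := ang_unique (θ := fun w => θ (w, o)) (θ' := fun w => θ (τ w, o')) (by fun_prop) (by fun_prop) hu w0 z
  have l1 := h.low w0 o le_rfl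
  have l2 := h.low (τ w0) o' (by simp [τ, w0])
  obtain ⟨m, hm⟩ := hu w0
  have m1 : (-1:ℝ) < m := by linarith
  have m2 : (m:ℝ) < 1 := by linarith
  have m1 : -1 < m := by exact_mod_cast m1
  have m2 : m < 1 := by exact_mod_cast m2
  have : m = 0 := by omega
  subst this
  simp at hm
  rw [e]
  linarith

lemma BD.pos {V M} (hB : BD V M) {θ} (h : TH V M θ) (T : TwistLift) (hinv : ∀ z, T.f z ∈ V ↔ z ∈ V)
    (z : Vt V) (o : Ct V) : 0 < θ (z, o) := by
  have hpc : PreconnectedSpace (Vt V) := Subtype.preconnectedSpace hB.preconn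
  have hcθ := h.cont
  have hinv' : ∀ p, pr (T.F p) ∈ V ↔ pr p ∈ V := fun p => by rw [← T.f_pr]; exact hinv _
  let FV : Vt V → Vt V := fun w => ⟨T.F w.1, (hinv' _).2 w.2⟩
  let FC : Ct V → Ct V := fun w => ⟨T.F w.1, fun hh => w.2 ((hinv' _).1 hh)⟩
  have hFV : Continuous FV := Continuous.subtype_mk (T.contF.comp continuous_subtype_val) _
  -- equivariance
  have hgood : ∀ z o, Good (θ (z, o)) (θ (FV z, FC o)) := by
    intro z o
    obtain ⟨M', hM'⟩ := T.endF M
    let w0 : Vt V := ⟨(o.1.1, min (-M) (-M')), hB.lo _ (by rw [pr_snd]; exact min_le_left _ _)⟩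
    refine good_conn (X := Vt V) (θ := fun w => θ (w, o)) (θ' := fun w => θ (FV w, FC o)) (by fun_prop) (by fun_prop)
      (fun w => h.ang w o) (fun w => h.ang (FV w) (FC o)) (fun w => T.allowed (fun e => ?_)) w0 ?_ z
    · have := w.2; rw [e] at this; exact o.2 this
    · have l1 := h.low w0 o (min_le_left _ _)
      have l2 := h.low (FV w0) (FC o) ((hM' _).2 (min_le_right _ _))
      have e1 : IsAng (θ (w0, o)) (w0.1 - o.1) := h.ang w0 o
      have hw0 : (w0.1 - o.1).1 = 0 := by simp [w0]
      have hhalf : θ (w0, o) = 1/2 := by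
        rcases lt_trichotomy (θ (w0, o)) (1/2) with hh | hh | hh
        · have := isAng_left e1 0 (by simp; linarith) (by simp; linarith)
          linarith
        · exact hh
        · have := isAng_right e1 1 (by simp; linarith) (by simp; linarith)
          linarith
      obtain ⟨n, hn⟩ := exists_good (T.allowed (p := o.1) (q := w0.1) (fun e => by
        have := w0.2; rw [e] at this; exact o.2 this)) e1 (h.ang (FV w0) (FC o))
      have hfl : ⌊2 * θ (w0, o)⌋ = 1 := by rw [hhalf]; norm_num
      obtain ⟨g1, g2, g3⟩ := good_floor hn
      rw [hfl] at g1 g2 g3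
      have g4 := g3 (by rw [hhalf]; norm_num)
      push_cast at g1 g4
      have m1 : (-1:ℝ) < n := by linarith
      have m2 : (n:ℝ) < 1 := by linarith
      have m1 : -1 < n := by exact_mod_cast m1
      have m2 : n < 1 := by exact_mod_cast m2
      have : n = 0 := by omega
      subst this
      simpa using hn
  -- the sets
  set Dt : Set (Vt V) := {z | ∃ o, θ (z, o) ≤ 0} with hDt
  set Et : Set (Vt V) := {z | ∃ o, θ (z, o) < 0} with hEt
  have hEo : IsOpen Et := by
    have : Et = ⋃ o, {z | θ (z, o) < 0} := by ext; simp [hEt]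
    rw [this]
    exact isOpen_iUnion fun o => isOpen_lt (by fun_prop) continuous_const
  have hDc : IsOpen Dtᶜ := by
    rw [isOpen_iff_mem_nhds]
    intro z0 hz0
    have hz0' : ∀ o, 0 < θ (z0, o) := by
      intro o; by_contra hh; exact hz0 ⟨o, not_lt.1 hh⟩
    -- bounded connected set
    obtain ⟨r, hr, hb⟩ := Metric.isOpen_iff.1 hB.op' z0.1 z0.2
    obtain ⟨w0, hw0l, hw0⟩ : ∃ w0 : Vt V, w0.1.2 ≤ -M ∧ JoinedIn (pr ⁻¹' V) w0.1 z0.1 := by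
      refine ⟨⟨(0, -M), hB.lo _ (by rw [pr_snd])⟩, le_rfl, ?_⟩
      have hco : IsConnected (pr ⁻¹' V) := ⟨⟨z0.1, z0.2⟩, hB.preconn⟩
      exact (hB.op'.isConnected_iff_isPathConnected.1 hco).joinedIn _ (hB.lo _ (by rw [pr_snd])) _ z0.2
    obtain ⟨c, hc⟩ := hw0
    have hbd : Bornology.IsBounded (range c ∪ Metric.ball z0.1 r) :=
      (isCompact_range c.continuous).isBounded.union Metric.isBounded_ball
    obtain ⟨R, hR⟩ := hbd.exists_norm_le
    have hfar : ∀ z : Vt V, z.1 ∈ Metric.ball z0.1 r → ∀ o : Ct V, (R < |o.1.1| ∨ R < o.1.2) → 0 < θ (z, o) := by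
      intro z hz o ho
      by_contra hneg
      push Not at hneg
      set Q : Set Pl := range c ∪ Metric.ball z0.1 r with hQ
      have hQV : Q ⊆ pr ⁻¹' V := union_subset (by rintro _ ⟨t, rfl⟩; exact hc t) hb
      have hQc : IsPreconnected Q := by
        refine IsPreconnected.union z0.1 ⟨1, c.target⟩ (Metric.mem_ball_self hr) (isPreconnected_range c.continuous) ?_
        exact (convex_ball _ _).isPreconnected
      have hpq : PreconnectedSpace Q := Subtype.preconnectedSpace hQc
      let j : Q → Vt V := fun q => ⟨q.1, hQV q.2⟩
      have hj : Continuous j := Continuous.subtype_mk continuous_subtype_val _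
      have hcj : Continuous fun q => θ (j q, o) := by fun_prop
      have l0 := (h.low w0 o hw0l).1
      obtain ⟨q, hq⟩ := mem_range_of_exists_le_of_exists_ge (c := (0:ℝ)) hcj ⟨⟨z.1, Or.inr hz⟩, hneg⟩
        ⟨⟨w0.1, Or.inl ⟨0, c.source⟩⟩, by
          show 0 ≤ θ (w0, o)
          linarith⟩
      obtain ⟨e1, e2⟩ := isAng_int (h.ang (j q) o) 0 (by simpa using hq)
      have hqn := hR q.1 q.2
      have n1 := norm_fst_le q.1
      have n2 := norm_snd_le q.1
      rw [Real.norm_eq_abs] at n1 n2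
      have e1 : (q.1 - o.1).1 = 0 := e1
      have e2 : 0 < (q.1 - o.1).2 := e2
      simp only [Prod.fst_sub, Prod.snd_sub] at e1 e2
      rcases ho with ho | ho
      · rw [show o.1.1 = q.1.1 by linarith] at ho
        linarith
      · have := le_abs_self q.1.2
        linarith
    -- compactness
    set K : Set (Ct V) := {o | |o.1.1| ≤ R ∧ o.1.2 ≤ R} with hK
    have hKc : IsCompact K := by
      have hemb : IsClosedEmbedding (Subtype.val : Ct V → Pl) :=
        (hB.op'.isClosed_compl).isClosedEmbedding_subtypeVal
      have hbox : IsCompact (Icc (-R) R ×ˢ Icc (-M) R : Set Pl) := isCompact_Icc.prod isCompact_Icc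
      have := hemb.isCompact_preimage hbox
      convert this using 1
      ext o
      constructor
      · rintro ⟨h1, h2⟩
        exact ⟨abs_le.1 h1, (hB.lowC o.2).le, h2⟩
      · rintro ⟨h1, h2⟩
        exact ⟨abs_le.2 h1, h2.2⟩
    have hev := hKc.eventually_forall_of_forall_eventually (x₀ := z0) (P := fun z o => 0 < θ (z, o)) (fun o _ =>
      hcθ.continuousAt.eventually (isOpen_Ioi.mem_nhds (hz0' o)))
    have hbn : ∀ᶠ z : Vt V in 𝓝 z0, z.1 ∈ Metric.ball z0.1 r :=
      continuous_subtype_val.continuousAt.eventually (Metric.ball_mem_nhds _ hr)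
    filter_upwards [hev, hbn] with z h1 h2
    rintro ⟨o, ho⟩
    by_cases hoK : o ∈ K
    · have := h1 o hoK; linarith
    · have := hfar z h2 o (by
        by_contra hh; push Not at hh; exact hoK hh)
      linarith
  have hDE : ∀ z ∈ Dt, FV z ∈ Et := fun z ⟨o, ho⟩ => ⟨FC o, good_le_zero (hgood z o) ho⟩
  have hED : Et ⊆ Dt := fun z ⟨o, ho⟩ => ⟨o, ho.le⟩
  -- down in the annulus
  have hshD : ∀ z z' : Vt V, pr z.1 = pr z'.1 → (z ∈ Dt → z' ∈ Dt) ∧ (z ∈ Et → z' ∈ Et) := by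
    intro z z' e
    obtain ⟨n, hn⟩ := pr_eq_iff.1 e
    constructor <;>
    · rintro ⟨o, ho⟩
      refine ⟨⟨o.1 + ((n:ℝ),0), by rw [pr_add_int]; exact o.2⟩, ?_⟩
      rw [hB.shift h z o n z' _ hn rfl]
      exact ho
  let ι : Vt V → Ann := fun z => pr z.1
  have hιo : IsOpenMap ι := pr_open.comp hB.op'.isOpenEmbedding_subtypeVal.isOpenMap
  set D : Set Ann := ι '' Dt with hD
  set E : Set Ann := ι '' Et with hE
  have hEopen : IsOpen E := hιo _ hEo
  have hmemD : ∀ z : Vt V, ι z ∈ D ↔ z ∈ Dt := fun z =>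
    ⟨fun ⟨w, hw, e⟩ => (hshD w z e).1 hw, fun hz => ⟨z, hz, rfl⟩⟩
  have hmemE : ∀ z : Vt V, ι z ∈ E ↔ z ∈ Et := fun z =>
    ⟨fun ⟨w, hw, e⟩ => (hshD w z e).2 hw, fun hz => ⟨z, hz, rfl⟩⟩
  have hVD : V \ D = ι '' Dtᶜ := by
    ext w
    constructor
    · rintro ⟨h1, h2⟩
      obtain ⟨p, rfl⟩ := pr_surj w
      exact ⟨⟨p, h1⟩, fun hh => h2 ((hmemD ⟨p, h1⟩).2 hh), rfl⟩
    · rintro ⟨q, hq, rfl⟩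
      exact ⟨q.2, fun hh => hq ((hmemD q).1 hh)⟩
  have hVDo : IsOpen (V \ D) := by rw [hVD]; exact hιo _ hDc
  have hDV : D ⊆ V := by rintro _ ⟨q, -, rfl⟩; exact q.2
  have hDmeas : MeasurableSet D := by
    have : D = V \ (V \ D) := by rw [diff_diff_cancel_left hDV]
    rw [this]
    exact hB.op.measurableSet.diff hVDo.measurableSet
  have hsubf : D ⊆ T.f ⁻¹' E := by
    rintro _ ⟨q, hq, rfl⟩
    show T.f (pr q.1) ∈ E
    rw [T.f_pr]
    exact (hmemE (FV q)).2 (hDE q hq)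
  have hEsub : E ⊆ D := image_mono hED
  have hfin : volume D ≠ ⊤ := by
    have hs : D ⊆ (univ : Set (AddCircle (1:ℝ))) ×ˢ Icc (-M) M := by
      rintro _ ⟨q, ⟨o, ho⟩, rfl⟩
      refine ⟨mem_univ _, ?_, ?_⟩
      · show -M ≤ (pr q.1).2
        rw [pr_snd]
        by_contra hh
        have := (h.low q o (by linarith)).1
        linarith
      · show (pr q.1).2 ≤ M
        rw [pr_snd]; exact (hB.hiV q.2).le
    refine ne_top_of_le_ne_top ?_ (measure_mono hs)
    show (Measure.prod volume volume) _ ≠ ⊤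
    rw [Measure.prod_prod]
    exact ENNReal.mul_ne_top (measure_ne_top _ _) (by simp)
  have hnull : volume (T.f ⁻¹' E \ D) = 0 := by
    have hm : volume (T.f ⁻¹' E) = volume E := T.meas E hEopen.measurableSet
    rw [measure_sdiff hsubf hDmeas.nullMeasurableSet hfin, hm]
    exact tsub_eq_zero_of_le (measure_mono hEsub)
  have hopen2 : IsOpen (T.f ⁻¹' E \ D) := by
    have : T.f ⁻¹' E \ D = T.f ⁻¹' E ∩ (V \ D) := by
      ext w
      constructor
      · rintro ⟨h1, h2⟩
        exact ⟨h1, (hinv w).1 (hDV (hEsub h1)), h2⟩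
      · rintro ⟨h1, h2⟩
        exact ⟨h1, h2.2⟩
    rw [this]
    exact (hEopen.preimage T.f_cont).inter hVDo
  have hemp : T.f ⁻¹' E \ D = ∅ := by
    by_contra hne
    have := hopen2.measure_pos volume (nonempty_iff_ne_empty.2 hne)
    rw [hnull] at this
    exact lt_irrefl _ this
  have hDeq : D = T.f ⁻¹' E := Subset.antisymm hsubf (diff_eq_empty.1 hemp)
  have hDopen : IsOpen D := by rw [hDeq]; exact hEopen.preimage T.f_cont
  have hDt : IsClopen Dt := by
    refine ⟨⟨hDc⟩, ?_⟩
    have : Dt = ι ⁻¹' D := by ext z; exact (hmemD z).symm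
    rw [this]
    exact hDopen.preimage (pr_cont.comp continuous_subtype_val)
  by_contra hneg
  have huniv := hDt.eq_univ ⟨z, o, not_lt.1 hneg⟩
  have : (⟨(0, -M), hB.lo _ (by rw [pr_snd])⟩ : Vt V) ∈ Dt := by rw [huniv]; trivial
  obtain ⟨o', ho'⟩ := this
  have := (h.low ⟨(0, -M), hB.lo _ (by rw [pr_snd])⟩ o' le_rfl).1
  linarith

end

set_option linter.all false
noncomputable section
open MeasureTheory Set Filter Topology Function

lemma NoCpt.preim {C : Set Ann} (h : NoCpt C) (e : Ann ≃ₜ Ann) : NoCpt (e ⁻¹' C) := by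
  intro K hK hKc hcl
  have := h (e '' K) (by rintro _ ⟨k, hk, rfl⟩; exact hK hk) (hKc.image e.continuous) (by
    have : C \ e '' K = e '' (e ⁻¹' C \ K) := by
      rw [image_sdiff e.injective, image_preimage_eq _ e.surjective]
    rw [this]
    exact e.isClosedMap _ hcl)
  exact image_eq_empty.1 this

def rhoH : Ann ≃ₜ Ann := (Homeomorph.neg _).prodCongr (Homeomorph.refl _)

lemma rhoH_pr (p : Pl) : rhoH (pr p) = pr (sgn2 (-1) 1 p) := by
  unfold rhoH pr sgn2
  ext <;> simp

lemma sgn2_invol (p : Pl) : sgn2 (-1) 1 (sgn2 (-1) 1 p) = p := by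
  ext <;> simp [sgn2]

lemma sgn2_cont : Continuous (sgn2 (-1) 1) := by unfold sgn2; fun_prop

lemma BD.refl {V M} (hB : BD V M) : BD (rhoH ⁻¹' V) M where
  op := hB.op.preimage rhoH.continuous
  conn := by
    have : rhoH ⁻¹' V = rhoH.symm '' V := (rhoH.symm.image_eq_preimage_symm V).symm
    rw [this]
    exact hB.conn.image _ rhoH.symm.continuous.continuousOn
  hi z hz := hB.hi _ hz
  lo z hz := hB.lo _ hz
  nc := by rw [← preimage_compl]; exact hB.nc.preim rhoH

lemma IsAng.refl {a u} (h : IsAng a u) : IsAng (1 - a) (sgn2 (-1) 1 u) := by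
  obtain ⟨r, hr, rfl⟩ := h
  refine ⟨r, hr, ?_⟩
  have e : 2 * Real.pi * (1 - a) = 2 * Real.pi - 2 * Real.pi * a := by ring
  unfold dirv
  rw [e, Real.sin_two_pi_sub, Real.cos_two_pi_sub]
  ext <;> simp [sgn2]

lemma BD.lt_one {V M} (hB : BD V M) {θ} (h : TH V M θ) (T : TwistLift) (hinv : ∀ z, T.f z ∈ V ↔ z ∈ V)
    (z : Vt V) (o : Ct V) : θ (z, o) < 1 := by
  have hc := h.cont
  let jV : Vt (rhoH ⁻¹' V) → Vt V := fun w => ⟨sgn2 (-1) 1 w.1, by have := w.2; rwa [mem_preimage, rhoH_pr] at this⟩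
  let jC : Ct (rhoH ⁻¹' V) → Ct V := fun w => ⟨sgn2 (-1) 1 w.1, by have := w.2; rwa [mem_preimage, rhoH_pr] at this⟩
  have cV : Continuous jV := Continuous.subtype_mk (sgn2_cont.comp continuous_subtype_val) _
  have cC : Continuous jC := Continuous.subtype_mk (sgn2_cont.comp continuous_subtype_val) _
  have hθ' : TH (rhoH ⁻¹' V) M (fun x => 1 - θ (jV x.1, jC x.2)) := by
    refine ⟨by fun_prop, fun z o => ?_, fun z o hz => ?_⟩
    · have := (h.ang (jV z) (jC o)).refl
      convert this using 1
      ext <;> simp [jV, jC, sgn2]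
      ring
    · have := h.low (jV z) (jC o) (by simpa [jV, sgn2] using hz)
      constructor <;> linarith
  have hginv : ∀ w, T.g w ∈ V ↔ w ∈ V := fun w => by
    rw [← hinv, T.fg]
  have := hB.refl.pos hθ' T.refl (fun w => by
    obtain ⟨p, rfl⟩ := pr_surj w
    rw [T.refl.f_pr, mem_preimage, mem_preimage, rhoH_pr, rhoH_pr]
    show pr (sgn2 (-1) 1 (sgn2 (-1) 1 (T.G (sgn2 (-1) 1 p)))) ∈ V ↔ _
    rw [sgn2_invol, ← T.g_pr, hginv])
    ⟨sgn2 (-1) 1 z.1, by rw [mem_preimage, rhoH_pr, sgn2_invol]; exact z.2⟩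
    ⟨sgn2 (-1) 1 o.1, by rw [mem_preimage, rhoH_pr, sgn2_invol]; exact o.2⟩
  simp only [jV, jC, sgn2_invol] at this
  linarith

lemma BD.upward {V M} (hB : BD V M) (T : TwistLift) (hinv : ∀ z, T.f z ∈ V ↔ z ∈ V)
    {x y y' : ℝ} (h : pr (x, y) ∉ V) (hy : y ≤ y') : pr (x, y') ∉ V := by
  intro hV
  have hlt : y < y' := lt_of_le_of_ne hy (fun e => h (e ▸ hV))
  obtain ⟨θ, hθ⟩ := hB.exists_TH
  have h0 := hB.pos hθ T hinv ⟨_, hV⟩ ⟨_, h⟩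
  have h1 := hB.lt_one hθ T hinv ⟨_, hV⟩ ⟨_, h⟩
  have ha := hθ.ang ⟨_, hV⟩ ⟨_, h⟩
  set a := θ (⟨_, hV⟩, ⟨_, h⟩)
  have e : ((x, y') - (x, y) : Pl).1 = 0 := by simp
  have e2 : 0 < ((x, y') - (x, y) : Pl).2 := by simp; exact hlt
  rcases lt_trichotomy a (1/2) with hh | hh | hh
  · have := isAng_left ha 0 (by simp; linarith) (by simp; linarith)
    linarith
  · have := (isAng_down ha 0 (by simp; linarith)).2
    linarith
  · have := isAng_right ha 1 (by simp; linarith) (by simp; linarith)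
    linarith

/-- one-sided upper semicontinuity, right side -/
lemma usc_right {φ : ℝ → ℝ} {H : Pl → Pl} (hH : Continuous H)
    (hpr : ∀ p : Pl, φ p.1 ≤ p.2 → φ (H p).1 ≤ (H p).2) (x0 : ℝ) (p : Pl) (hp : φ p.1 ≤ p.2)
    (hHp : H p = (x0, φ x0)) (hm : StrictMono fun y => (H (p.1, y)).1) {ε : ℝ} (hε : 0 < ε) :
    ∃ x1 > x0, ∀ x ∈ Ico x0 x1, φ x < φ x0 + ε := by
  have hc : Continuous fun y => H (p.1, y) := by fun_prop
  have h0 : H (p.1, p.2) = (x0, φ x0) := hHp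
  have hev : ∀ᶠ y in 𝓝 p.2, (H (p.1, y)).2 < φ x0 + ε := by
    have : Tendsto (fun y => (H (p.1, y)).2) (𝓝 p.2) (𝓝 (H (p.1, p.2)).2) :=
      (Continuous.snd hc).continuousAt
    rw [h0] at this
    exact this.eventually (gt_mem_nhds (by simpa using hε))
  obtain ⟨δ, hδ, hb⟩ := Metric.eventually_nhds_iff.1 hev
  have h1 : (H (p.1, p.2)).1 < (H (p.1, p.2 + δ/2)).1 := hm (by linarith)
  refine ⟨(H (p.1, p.2 + δ/2)).1, by rw [h0] at h1; exact h1, fun x hx => ?_⟩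
  obtain ⟨y, hy, hyx⟩ := intermediate_value_Icc (show p.2 ≤ p.2 + δ/2 by linarith)
    (f := fun y => (H (p.1, y)).1) (Continuous.fst hc).continuousOn
    (show x ∈ Icc (H (p.1, p.2)).1 (H (p.1, p.2 + δ/2)).1 by rw [h0]; exact ⟨hx.1, hx.2.le⟩)
  have h2 := hpr (p.1, y) (hp.trans hy.1)
  simp only at hyx
  rw [hyx] at h2
  have h3 := hb (show dist y p.2 < δ by rw [Real.dist_eq, abs_of_nonneg] <;> linarith [hy.1, hy.2])
  linarith

lemma usc_left {φ : ℝ → ℝ} {H : Pl → Pl} (hH : Continuous H)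
    (hpr : ∀ p : Pl, φ p.1 ≤ p.2 → φ (H p).1 ≤ (H p).2) (x0 : ℝ) (p : Pl) (hp : φ p.1 ≤ p.2)
    (hHp : H p = (x0, φ x0)) (hm : StrictAnti fun y => (H (p.1, y)).1) {ε : ℝ} (hε : 0 < ε) :
    ∃ x1 < x0, ∀ x ∈ Ioc x1 x0, φ x < φ x0 + ε := by
  have hH' : Continuous fun p : Pl => sgn2 (-1) 1 (H (sgn2 (-1) 1 p)) := sgn2_cont.comp (hH.comp sgn2_cont)
  obtain ⟨x1, h1, h2⟩ := usc_right (φ := fun x => φ (-x)) (H := fun p => sgn2 (-1) 1 (H (sgn2 (-1) 1 p)))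
    hH' (fun q hq => by
      have := hpr (sgn2 (-1) 1 q) (by simpa [sgn2] using hq)
      simpa [sgn2] using this) (-x0) (sgn2 (-1) 1 p) (by simpa [sgn2] using hp) (by
      simp only [sgn2_invol, hHp]; simp [sgn2]) (by
      intro a b hab
      have := hm hab
      simp [sgn2] at this ⊢
      exact this) hε
  refine ⟨-x1, by linarith, fun x hx => ?_⟩
  have := h2 (-x) ⟨by linarith [hx.2], by linarith [hx.1]⟩
  simpa using this

theorem birkhoff (T : TwistLift) {V : Set Ann} {M : ℝ} (hB : BD V M) (hinv : ∀ z, T.f z ∈ V ↔ z ∈ V) :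
    ∃ φ : ℝ → ℝ, Continuous φ ∧ (∀ x, φ (x + 1) = φ x) ∧ (∀ p : Pl, pr p ∈ V ↔ p.2 < φ p.1) ∧
      ∀ x, (T.F (x, φ x)).2 = φ (T.F (x, φ x)).1 := by
  set A : ℝ → Set ℝ := fun x => {y | pr (x, y) ∉ V} with hA
  have hAne : ∀ x, (A x).Nonempty := fun x => ⟨M, hB.hi _ (by rw [pr_snd])⟩
  have hAb : ∀ x, BddBelow (A x) := fun x => ⟨-M, fun y hy => (hB.lowC (o := (x, y)) hy).le⟩
  have hAc : ∀ x, IsClosed (A x) := fun x => hB.op.isClosed_compl.preimage (pr_cont.comp (by fun_prop))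
  set φ : ℝ → ℝ := fun x => sInf (A x) with hφ
  have hφA : ∀ x, φ x ∈ A x := fun x => (hAc x).csInf_mem (hAne x) (hAb x)
  have hC : ∀ p : Pl, pr p ∉ V ↔ φ p.1 ≤ p.2 := fun p =>
    ⟨fun h => csInf_le (hAb _) h, fun h => hB.upward T hinv (hφA p.1) h⟩
  have hV : ∀ p : Pl, pr p ∈ V ↔ p.2 < φ p.1 := fun p => by
    rw [← not_le, ← hC, not_not]
  have hinvF : ∀ p : Pl, φ (T.F p).1 ≤ (T.F p).2 ↔ φ p.1 ≤ p.2 := fun p => by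
    rw [← hC, ← hC, ← T.f_pr, hinv]
  have hinvG : ∀ p : Pl, φ (T.G p).1 ≤ (T.G p).2 ↔ φ p.1 ≤ p.2 := fun p => by
    rw [← hinvF, T.FG]
  have hcont : Continuous φ := by
    rw [continuous_iff_continuousAt]
    intro x0
    refine tendsto_order.2 ⟨fun y hy => ?_, fun y hy => ?_⟩
    · have h1 : IsOpen {x : ℝ | pr (x, y) ∈ V} := hB.op.preimage (pr_cont.comp (by fun_prop))
      filter_upwards [h1.mem_nhds ((hV (x0, y)).2 hy)] with x hx using (hV (x, y)).1 hx
    · have hp0 : φ (x0, φ x0).1 ≤ ((x0, φ x0) : Pl).2 := le_rfl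
      obtain ⟨x1, h1, h2⟩ := usc_right T.contF (fun p => (hinvF p).2) x0 (T.G (x0, φ x0)) ((hinvG _).2 hp0)
        (T.FG _) (T.tw _) (sub_pos.2 hy)
      obtain ⟨x2, h3, h4⟩ := usc_left T.contG (fun p => (hinvG p).2) x0 (T.F (x0, φ x0)) ((hinvF _).2 hp0)
        (T.GF _) (T.itw _) (sub_pos.2 hy)
      filter_upwards [Ioo_mem_nhds h3 h1] with x hx
      rcases le_total x x0 with hh | hh
      · have := h4 x ⟨hx.1, hh⟩; linarith
      · have := h2 x ⟨hh, hx.2⟩; linarith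
  refine ⟨φ, hcont, fun x => ?_, hV, fun x => ?_⟩
  · have : A (x + 1) = A x := by
      ext y
      have := pr_add_int (x, y) 1
      simp only [Int.cast_one, Prod.mk_add_mk, add_zero] at this
      simp only [hA, mem_setOf_eq, this]
    simp only [hφ, this]
  · refine le_antisymm ?_ ((hinvF _).2 le_rfl)
    by_contra hlt
    push Not at hlt
    have hcF := T.contF
    have hev : ∀ᶠ y in 𝓝 (φ x), φ (T.F (x, y)).1 < (T.F (x, y)).2 :=
      ContinuousAt.eventually_lt (Continuous.continuousAt (by fun_prop)) (Continuous.continuousAt (by fun_prop)) hlt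
    obtain ⟨y, hy, hy2⟩ := (((hev.filter_mono nhdsWithin_le_nhds : ∀ᶠ y in 𝓝[<] (φ x), _).and self_mem_nhdsWithin)).exists
    have := (hinvF _).1 hy.le
    exact absurd this (not_le.2 hy2)

end

set_option linter.all false
noncomputable section
open MeasureTheory Set Filter Topology Function

lemma curve_sep {γ : C(AddCircle (1:ℝ), Ann)} (hγ : EssentialCurve γ) :
    ∃ Z Z' : Set Ann, IsOpen Z ∧ IsOpen Z' ∧ Disjoint Z Z' ∧ Z ∪ Z' = (range γ)ᶜ ∧
      ∃ M : ℝ, (∀ z : Ann, M ≤ z.2 → z ∈ Z') ∧ (∀ z : Ann, z.2 ≤ -M → z ∈ Z) := by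
  obtain ⟨s, d, hs, h1, h2⟩ := lift_curve γ
  have hd := essential_deg hγ hs h1 h2
  have cq : Continuous (fun x : ℝ => (x : AddCircle (1:ℝ))) := circ_quot.continuous
  have cz := zeta_cont
  set c : ℝ → Ann := fun x => γ (x : AddCircle (1:ℝ)) with hc
  have hcc : Continuous c := γ.continuous.comp cq
  have hcp : ∀ x, c (x+1) = c x := by
    intro x
    simp only [hc]
    congr 1
    exact AddCircle.coe_add_period (1:ℝ) x
  have hdeg : Deg (fun x => zeta (c x)) d := by
    refine (zeta_deg (s := s) (y := fun x => (c x).2) hs (by fun_prop) h2 (fun x => by rw [hcp])).congr fun x => ?_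
    rw [h1]
  have hrc : IsCompact (range γ) := isCompact_range γ.continuous
  have hro : IsOpen (range γ)ᶜ := hrc.isClosed.isOpen_compl
  have hclop : IsClopen {o : ((range γ)ᶜ : Set Ann) | Deg (fun x => zeta (c x) - zeta o.1) 0} := by
    refine Deg.isClopen (X := ((range γ)ᶜ : Set Ann)) (fun o x => zeta (c x) - zeta o.1) (by unfold uncurry; fun_prop)
      (fun o x => by simp only [hcp]) (fun o x => ?_) 0
    intro e
    have := zeta_inj (sub_eq_zero.1 e)
    exact o.2 ⟨_, this⟩
  obtain ⟨M, hM⟩ := hrc.isBounded.exists_norm_le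
  have hM' : ∀ x, |(c x).2| ≤ M := fun x => (norm_snd_le (c x)).trans (hM _ ⟨_, rfl⟩)
  refine ⟨Subtype.val '' {o : ((range γ)ᶜ : Set Ann) | Deg (fun x => zeta (c x) - zeta o.1) 0},
    Subtype.val '' {o : ((range γ)ᶜ : Set Ann) | Deg (fun x => zeta (c x) - zeta o.1) 0}ᶜ,
    hro.isOpenMap_subtype_val _ hclop.2, hro.isOpenMap_subtype_val _ hclop.compl.2, ?_, ?_, M + 1, ?_, ?_⟩
  · rw [disjoint_image_iff Subtype.val_injective]
    exact disjoint_compl_right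
  · rw [← image_union, union_compl_self, image_univ, Subtype.range_val]
  · intro z hz
    have hzr : z ∉ range γ := by
      intro hh
      have := (le_abs_self z.2).trans ((norm_snd_le z).trans (hM z hh))
      linarith
    refine ⟨⟨z, hzr⟩, ?_, rfl⟩
    intro h0
    have := deg_high hcc hcp hdeg z (fun x => by have := (abs_le.1 (hM' x)).2; linarith)
    exact hd (this.unique h0)
  · intro z hz
    have hzr : z ∉ range γ := by
      intro hh
      have := (neg_abs_le z.2)
      have h2 : |z.2| ≤ M := ((norm_snd_le z).trans (hM z hh))
      linarith
    refine ⟨⟨z, hzr⟩, ?_, rfl⟩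
    exact deg_low hcc hcp z (fun x => by have := (abs_le.1 (hM' x)).1; linarith)

instance annConn : ConnectedSpace Ann := by
  have : ConnectedSpace (AddCircle (1:ℝ)) := circ_quot.surjective.connectedSpace circ_quot.continuous
  infer_instance

lemma conn_union {U L : Set Ann} (hU : IsConnected U) (hL : IsClosed L) (hV : IsOpen (U ∪ L)) :
    IsConnected (U ∪ L) := by
  refine ⟨hU.nonempty.mono subset_union_left, ?_⟩
  have key : ∀ A B : Set Ann, IsOpen A → IsOpen B → Disjoint A B → A ∪ B = U ∪ L → U ⊆ A → B = ∅ := by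
    intro A B hA hB hd he hUA
    have hBL : B = L \ A := by
      ext w
      constructor
      · intro hw
        have : w ∈ U ∪ L := he ▸ Or.inr hw
        have hwA : w ∉ A := fun h => disjoint_left.1 hd h hw
        exact ⟨this.resolve_left fun h => hwA (hUA h), hwA⟩
      · rintro ⟨h1, h2⟩
        have : w ∈ A ∪ B := he ▸ Or.inr h1
        exact this.resolve_left h2
    have hcl : IsClopen B := ⟨by rw [hBL]; exact hL.sdiff hA, hB⟩
    rcases isClopen_iff.1 hcl with h | h
    · exact h
    · exfalso
      obtain ⟨u, hu⟩ := hU.nonempty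
      exact disjoint_left.1 hd (hUA hu) (h ▸ mem_univ u)
  intro A B hA hB hsub hAn hBn
  by_contra hne
  rw [not_nonempty_iff_eq_empty] at hne
  set A' := (U ∪ L) ∩ A with hA'
  set B' := (U ∪ L) ∩ B with hB'
  have hd : Disjoint A' B' := by
    rw [disjoint_left]
    rintro w ⟨h1, h2⟩ ⟨-, h3⟩
    have : w ∈ (U ∪ L) ∩ (A ∩ B) := ⟨h1, h2, h3⟩
    rw [hne] at this; exact this
  have he : A' ∪ B' = U ∪ L := by
    rw [hA', hB', ← inter_union_distrib_left]
    exact inter_eq_left.2 hsub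
  have hA'o := hV.inter hA
  have hB'o := hV.inter hB
  rcases hU.isPreconnected.subset_or_subset hA'o hB'o hd (by rw [he]; exact subset_union_left) with h | h
  · exact hBn.ne_empty (key A' B' hA'o hB'o hd he h)
  · exact hAn.ne_empty (key B' A' hB'o hA'o hd.symm (by rw [union_comm]; exact he) h)

lemma ann_compact {K : Set Ann} (hK : IsClosed K) {R : ℝ} (hR : ∀ z ∈ K, |z.2| ≤ R) : IsCompact K := by
  have : IsCompact ((univ : Set (AddCircle (1:ℝ))) ×ˢ Icc (-R) R) := isCompact_univ.prod isCompact_Icc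
  exact this.of_isClosed_subset hK fun z hz => ⟨mem_univ _, abs_le.1 (hR z hz)⟩

/-- lower version of the Birkhoff lemma -/
lemma birkhoff_low (T : TwistLift) {L : Set Ann} {M : ℝ} (hB : BD ((Homeomorph.neg Ann) ⁻¹' Lᶜ) M)
    (hinv : ∀ z, T.f z ∈ L ↔ z ∈ L) :
    ∃ φ : ℝ → ℝ, Continuous φ ∧ (∀ x, φ (x + 1) = φ x) ∧ (∀ p : Pl, pr p ∈ L ↔ p.2 ≤ φ p.1) ∧
      ∀ x, (T.F (x, φ x)).2 = φ (T.F (x, φ x)).1 := by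
  obtain ⟨φ, h1, h2, h3, h4⟩ := birkhoff T.negc hB (fun z => by
    obtain ⟨p, rfl⟩ := pr_surj z
    rw [T.negc.f_pr]
    show -pr (-T.F (-p)) ∉ L ↔ -pr p ∉ L
    rw [← pr_neg, ← pr_neg, neg_neg, ← T.f_pr, hinv])
  refine ⟨fun x => -φ (-x), by fun_prop, fun x => ?_, fun p => ?_, fun x => ?_⟩
  · have := h2 (-(x+1))
    rw [show -(x+1) + 1 = -x by ring] at this
    simp only [this]
  · have := h3 (-p)
    have e : pr (-p) ∈ (Homeomorph.neg Ann) ⁻¹' Lᶜ ↔ pr p ∉ L := by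
      show -pr (-p) ∉ L ↔ _
      rw [← pr_neg, neg_neg]
    rw [e] at this
    rw [← not_iff_not, this]
    simp only [Prod.snd_neg, Prod.fst_neg, not_le]
    constructor <;> intro h <;> linarith
  · have := h4 (-x)
    have e : T.negc.F (-x, φ (-x)) = - T.F (x, -φ (-x)) := by
      show - T.F (-(-x, φ (-x))) = _
      simp
    rw [e] at this
    simp only [Prod.snd_neg, Prod.fst_neg] at this
    simp only
    linarith

theorem structure_U (T : TwistLift) {U : Set Ann} (hUo : IsOpen U) (hUc : IsConnected U)
    (hUh : Nonempty (U ≃ₜ Ann)) (hUb : Bornology.IsBounded U) (hUe : EssentialSet U)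
    (hinv : ∀ z, T.f z ∈ U ↔ z ∈ U) :
    ∃ φm φp : ℝ → ℝ, Continuous φm ∧ Continuous φp ∧ (∀ x, φm (x+1) = φm x) ∧ (∀ x, φp (x+1) = φp x) ∧
      (∀ x, φm x < φp x) ∧ (∀ p : Pl, pr p ∈ U ↔ φm p.1 < p.2 ∧ p.2 < φp p.1) ∧
      (∀ x, (T.F (x, φm x)).2 = φm (T.F (x, φm x)).1) ∧ ∀ x, (T.F (x, φp x)).2 = φp (T.F (x, φp x)).1 := by
  have hNC := ann_noCpt hUo hUb hUh hUe
  obtain ⟨γ, hγ, hγU⟩ := hUe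
  obtain ⟨Z, Z', hZ, hZ', hd, hun, M0, hM1, hM2⟩ := curve_sep hγ
  obtain ⟨R, hR⟩ := hUb.exists_norm_le
  have hR' : ∀ z ∈ U, |z.2| ≤ R := fun z hz => (norm_snd_le z).trans (hR z hz)
  set M := max M0 (R + 1) with hM
  have hC : IsClosed Uᶜ := hUo.isClosed_compl
  set Up : Set Ann := Uᶜ ∩ Z' with hUp
  set L : Set Ann := Uᶜ ∩ Z with hL
  have hor : ∀ z, z ∉ U → z ∈ Z ∨ z ∈ Z' := fun z hz => by
    have : z ∈ Z ∪ Z' := by rw [hun]; exact fun h => hz (hγU h)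
    exact this
  have hUL : Up ∪ L = Uᶜ := by
    ext z
    constructor
    · rintro (h | h) <;> exact h.1
    · intro h
      rcases hor z h with h' | h'
      · exact Or.inr ⟨h, h'⟩
      · exact Or.inl ⟨h, h'⟩
  have hdUL : ∀ z, z ∈ Up → z ∉ L := fun z h1 h2 => disjoint_left.1 hd h2.2 h1.2
  have hUpc : IsClosed Up := by
    have : Up = Uᶜ \ Z := by
      ext z
      exact ⟨fun h => ⟨h.1, fun hz => disjoint_left.1 hd hz h.2⟩, fun h => ⟨h.1, (hor z h.1).resolve_left h.2⟩⟩
    rw [this]; exact hC.sdiff hZ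
  have hLc : IsClosed L := by
    have : L = Uᶜ \ Z' := by
      ext z
      exact ⟨fun h => ⟨h.1, fun hz => disjoint_left.1 hd h.2 hz⟩, fun h => ⟨h.1, (hor z h.1).resolve_right h.2⟩⟩
    rw [this]; exact hC.sdiff hZ'
  have hhi : ∀ z : Ann, M ≤ z.2 → z ∈ Up := by
    intro z hz
    refine ⟨fun h => ?_, hM1 z ((le_max_left _ _).trans hz)⟩
    have h1 := (le_abs_self z.2).trans (hR' z h)
    have h2 := (le_max_right M0 (R+1)).trans hz
    linarith
  have hlo : ∀ z : Ann, z.2 ≤ -M → z ∈ L := by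
    intro z hz
    have h0 : M0 ≤ M := le_max_left _ _
    refine ⟨fun h => ?_, hM2 z (by linarith)⟩
    have h1 := (neg_abs_le z.2)
    have h2 := (hR' z h)
    have h3 := (le_max_right M0 (R+1))
    linarith
  obtain ⟨M', hM'⟩ := T.endF M
  have hfhi : ∀ z : Ann, M' ≤ z.2 → T.f z ∈ Up := by
    intro z hz
    obtain ⟨p, rfl⟩ := pr_surj z
    rw [T.f_pr]
    exact hhi _ ((hM' p).1 hz)
  have hflo : ∀ z : Ann, z.2 ≤ -M' → T.f z ∈ L := by
    intro z hz
    obtain ⟨p, rfl⟩ := pr_surj z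
    rw [T.f_pr]
    exact hlo _ ((hM' p).2 hz)
  have hfor : ∀ z, z ∉ U → T.f z ∈ Up ∨ T.f z ∈ L := fun z hz => by
    have : T.f z ∈ Up ∪ L := by rw [hUL]; exact fun h => hz ((hinv z).1 h)
    exact this
  have hor2 : ∀ z, z ∉ U → z ∈ Up ∨ z ∈ L := fun z hz => by
    have : z ∈ Up ∪ L := by rw [hUL]; exact hz
    exact this
  have hK1 : Up ∩ T.f ⁻¹' L = ∅ := by
    have hcl : IsClosed (Up ∩ T.f ⁻¹' L) := hUpc.inter (hLc.preimage T.f_cont)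
    refine hNC _ (fun z hz => hz.1.1) (ann_compact hcl (R := max M M') fun z hz => ?_) ?_
    · rw [abs_le]
      have a1 : z.2 < M' := by
        by_contra h
        exact hdUL _ (hfhi z (not_lt.1 h)) hz.2
      have a2 : -M < z.2 := by
        by_contra h
        exact hdUL _ hz.1 (hlo z (not_lt.1 h))
      have b1 := le_max_left M M'
      have b2 := le_max_right M M'
      constructor <;> linarith
    · have : Uᶜ \ (Up ∩ T.f ⁻¹' L) = L ∪ (Up ∩ T.f ⁻¹' Up) := by
        ext z
        constructor
        · rintro ⟨h1, h2⟩
          rcases hor2 z h1 with h | h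
          · rcases hfor z h1 with h' | h'
            · exact Or.inr ⟨h, h'⟩
            · exact absurd ⟨h, h'⟩ h2
          · exact Or.inl h
        · rintro (h | h)
          · exact ⟨h.1, fun h' => hdUL _ h'.1 h⟩
          · exact ⟨h.1.1, fun h' => hdUL _ h.2 h'.2⟩
      rw [this]
      exact hLc.union (hUpc.inter (hUpc.preimage T.f_cont))
  have hK2 : L ∩ T.f ⁻¹' Up = ∅ := by
    have hcl : IsClosed (L ∩ T.f ⁻¹' Up) := hLc.inter (hUpc.preimage T.f_cont)
    refine hNC _ (fun z hz => hz.1.1) (ann_compact hcl (R := max M M') fun z hz => ?_) ?_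
    · rw [abs_le]
      have a1 : z.2 < M := by
        by_contra h
        exact hdUL _ (hhi z (not_lt.1 h)) hz.1
      have a2 : -M' < z.2 := by
        by_contra h
        exact hdUL _ hz.2 (hflo z (not_lt.1 h))
      have b1 := le_max_left M M'
      have b2 := le_max_right M M'
      constructor <;> linarith
    · have : Uᶜ \ (L ∩ T.f ⁻¹' Up) = Up ∪ (L ∩ T.f ⁻¹' L) := by
        ext z
        constructor
        · rintro ⟨h1, h2⟩
          rcases hor2 z h1 with h | h
          · exact Or.inl h
          · rcases hfor z h1 with h' | h'
            · exact absurd ⟨h, h'⟩ h2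
            · exact Or.inr ⟨h, h'⟩
        · rintro (h | h)
          · exact ⟨h.1, fun h' => hdUL _ h h'.1⟩
          · exact ⟨h.1.1, fun h' => hdUL _ h'.2 h.2⟩
      rw [this]
      exact hUpc.union (hLc.inter (hLc.preimage T.f_cont))
  have hUU : ∀ z, z ∈ Up → T.f z ∈ Up := fun z hz => (hfor z hz.1).resolve_right fun h => by
    have : z ∈ Up ∩ T.f ⁻¹' L := ⟨hz, h⟩
    rw [hK1] at this; exact this
  have hLL : ∀ z, z ∈ L → T.f z ∈ L := fun z hz => (hfor z hz.1).resolve_left fun h => by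
    have : z ∈ L ∩ T.f ⁻¹' Up := ⟨hz, h⟩
    rw [hK2] at this; exact this
  have hUpinv : ∀ z, T.f z ∈ Up ↔ z ∈ Up := fun z => ⟨fun h => by
    have hz : z ∉ U := fun hh => h.1 ((hinv z).2 hh)
    exact (hor2 z hz).resolve_right fun h' => hdUL _ h (hLL z h'), hUU z⟩
  have hLinv : ∀ z, T.f z ∈ L ↔ z ∈ L := fun z => ⟨fun h => by
    have hz : z ∉ U := fun hh => h.1 ((hinv z).2 hh)
    exact (hor2 z hz).resolve_left fun h' => hdUL _ (hUU z h') h, hLL z⟩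
  have hVe : Upᶜ = U ∪ L := by
    ext z
    constructor
    · intro h
      by_cases hz : z ∈ U
      · exact Or.inl hz
      · exact Or.inr ((hor2 z hz).resolve_left h)
    · rintro (h | h) h'
      · exact h'.1 h
      · exact hdUL _ h' h
  have hVe2 : Lᶜ = U ∪ Up := by
    ext z
    constructor
    · intro h
      by_cases hz : z ∈ U
      · exact Or.inl hz
      · exact Or.inr ((hor2 z hz).resolve_right h)
    · rintro (h | h) h'
      · exact h'.1 h
      · exact hdUL _ h h'
  have hncU : NoCpt Up := by
    intro K hK hKc hKcl
    refine hNC K (fun z hz => (hK hz).1) hKc ?_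
    have : Uᶜ \ K = L ∪ (Up \ K) := by
      rw [← hUL, union_sdiff_distrib, union_comm]
      congr 1
      refine sdiff_eq_left.2 (disjoint_left.2 fun z h1 h2 => hdUL _ (hK h2) h1)
    rw [this]
    exact hLc.union hKcl
  have hncL : NoCpt L := by
    intro K hK hKc hKcl
    refine hNC K (fun z hz => (hK hz).1) hKc ?_
    have : Uᶜ \ K = Up ∪ (L \ K) := by
      rw [← hUL, union_sdiff_distrib]
      congr 1
      refine sdiff_eq_left.2 (disjoint_left.2 fun z h1 h2 => hdUL _ h1 (hK h2))
    rw [this]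
    exact hUpc.union hKcl
  have hBp : BD Upᶜ M := by
    refine ⟨hUpc.isOpen_compl, ?_, fun z hz h => h (hhi z hz), fun z hz h => hdUL _ h (hlo z hz), by rw [compl_compl]; exact hncU⟩
    have := hUpc.isOpen_compl
    rw [hVe] at this ⊢
    exact conn_union hUc hLc this
  have hBm : BD ((Homeomorph.neg Ann) ⁻¹' Lᶜ) M := by
    refine ⟨hLc.isOpen_compl.preimage (Homeomorph.neg Ann).continuous, ?_, fun z hz h => h (hlo (-z) ?_),
      fun z hz h => hdUL _ (hhi (-z) ?_) h, ?_⟩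
    · have h1 := hLc.isOpen_compl
      have h2 : IsConnected Lᶜ := by
        rw [hVe2] at h1 ⊢
        exact conn_union hUc hUpc h1
      have : (Homeomorph.neg Ann) ⁻¹' Lᶜ = (Homeomorph.neg Ann).symm '' Lᶜ := ((Homeomorph.neg Ann).symm.image_eq_preimage_symm _).symm
      rw [this]
      exact h2.image _ (Homeomorph.neg Ann).symm.continuous.continuousOn
    · simp; linarith
    · simp; linarith
    · rw [← preimage_compl, compl_compl]
      exact hncL.preim _
  obtain ⟨φp, p1, p2, p3, p4⟩ := birkhoff T hBp (fun z => by
    rw [mem_compl_iff, mem_compl_iff, hUpinv])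
  obtain ⟨φm, m1, m2, m3, m4⟩ := birkhoff_low T hBm hLinv
  have p3' : ∀ p : Pl, pr p ∈ Up ↔ φp p.1 ≤ p.2 := fun p => by
    rw [← not_lt, ← p3, mem_compl_iff, not_not]
  refine ⟨φm, φp, m1, p1, m2, p2, fun x => ?_, fun p => ?_, m4, p4⟩
  · by_contra h
    exact hdUL _ ((p3' (x, φp x)).2 le_rfl) ((m3 (x, φp x)).2 (not_lt.1 h))
  · constructor
    · intro h
      constructor
      · by_contra hh
        exact ((m3 p).2 (not_lt.1 hh)).1 h
      · by_contra hh
        exact ((p3' p).2 (not_lt.1 hh)).1 h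
    · rintro ⟨h1, h2⟩
      by_contra h
      rcases hor2 _ h with h' | h'
      · exact absurd ((p3' p).1 h') (not_le.2 h2)
      · exact absurd ((m3 p).1 h') (not_le.2 h1)

theorem IsotopySetup.backward (S : IsotopySetup) (ht : S.PosTwist)
    (hpres : MeasurePreserving S.f volume volume) (U : Set Ann)
    (hUo : IsOpen U) (hUc : IsConnected U)
    (hUh : Nonempty (U ≃ₜ Ann)) (hUb : Bornology.IsBounded U) (hUe : EssentialSet U)
    (hUinv : S.f '' U = U) (hae : ∀ᵐ z ∂volume, z ∈ U → S.Torsion z 0) : C0IntegrableOn S.f U := by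
  have hinv : ∀ z, S.f z ∈ U ↔ z ∈ U := fun z => by
    conv_lhs => rw [← hUinv]
    exact S.f_inj.mem_set_image
  obtain ⟨φm, φp, m1, p1, m2, p2, hlt, hU, m4, p4⟩ := structure_U (S.twistLift ht hpres) hUo hUc hUh hUb hUe
    (by rw [S.twistLift_f]; exact hinv)
  obtain ⟨R, hR⟩ := hUb.exists_norm_le
  refine Strip.foliate (S := S) (φm := φm) (φp := φp) ⟨m1, p1, m2, p2, hlt, ⟨fun p => ?_, ⟨R, fun p hp => ?_⟩, fun p hp n hn => ?_⟩, m4, p4⟩ ht hpres U hU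
  · show (φm (S.F p).1 < (S.F p).2 ∧ (S.F p).2 < φp (S.F p).1) ↔ _
    rw [← hU]
    show _ ↔ (φm p.1 < p.2 ∧ p.2 < φp p.1)
    rw [← hU, ← hinv (pr p), ← S.lift_f]
    rfl
  · have := hR _ ((hU p).2 hp)
    have h2 := (norm_snd_le (pr p)).trans this
    rwa [pr_snd] at h2
  · exact S.noconj ht hpres U hUo hUb hUinv hae p ((hU p).2 hp) n hn

end

set_option linter.all false
noncomputable section
open MeasureTheory Set Filter Topology Function

instance annLPC : LocallyPathConnectedSpace Ann :=
  pr_quot.isQuotientMap.locallyPathConnectedSpace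

lemma leaf_graph (T : TwistLift) {γ : C(AddCircle (1:ℝ), Ann)} (hγ : EssentialCurve γ)
    (hinv : T.f '' range γ = range γ) :
    ∃ φ : ℝ → ℝ, Continuous φ ∧ (∀ x, φ (x+1) = φ x) ∧ (∀ z ∈ range γ, ∃ x, z = pr (x, φ x)) ∧
      ∀ x, (T.F (x, φ x)).2 = φ (T.F (x, φ x)).1 := by
  obtain ⟨Z, Z', hZ, hZ', hd, hun, M, hM1, hM2⟩ := curve_sep hγ
  set Γ := range γ with hΓ
  have hΓc : IsCompact Γ := isCompact_range γ.continuous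
  have hΓo : IsOpen Γᶜ := hΓc.isClosed.isOpen_compl
  have hZΓ : ∀ z ∈ Z, z ∈ Γᶜ := fun z hz => hun ▸ Or.inl hz
  set z0 : Ann := pr (0, -M) with hz0
  have hz0Z : z0 ∈ Z := hM2 z0 (by rw [hz0, pr_snd])
  set V := connectedComponentIn Γᶜ z0 with hV
  have hVo : IsOpen V := hΓo.connectedComponentIn
  have hVs : V ⊆ Γᶜ := connectedComponentIn_subset _ _
  have hz0V : z0 ∈ V := mem_connectedComponentIn (hZΓ _ hz0Z)
  have hVc : IsPreconnected V := isPreconnected_connectedComponentIn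
  have hVZ : V ⊆ Z := hVc.subset_left_of_subset_union hZ hZ' hd (by rw [hun]; exact hVs) ⟨z0, hz0V, hz0Z⟩
  have hlow : {z : Ann | z.2 ≤ -M} ⊆ V := by
    have e : {z : Ann | z.2 ≤ -M} = pr '' {p : Pl | p.2 ≤ -M} := by
      ext z
      constructor
      · intro h
        obtain ⟨p, rfl⟩ := pr_surj z
        exact ⟨p, h, rfl⟩
      · rintro ⟨p, h, rfl⟩; exact h
    have hc : IsPreconnected {z : Ann | z.2 ≤ -M} := by
      rw [e]
      refine IsPreconnected.image ?_ _ pr_cont.continuousOn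
      refine Convex.isPreconnected ?_
      exact convex_halfSpace_le (f := fun p : Pl => p.2) (LinearMap.isLinear (LinearMap.snd ℝ ℝ ℝ)) (-M)
    exact hc.subset_connectedComponentIn (by simp [hz0]) fun z hz => hZΓ z (hM2 z hz)
  have hfΓ : ∀ z, T.f z ∈ Γ ↔ z ∈ Γ := by
    intro z
    constructor
    · intro h
      rw [← hinv] at h
      obtain ⟨w, hw, e⟩ := h
      have : w = z := by rw [← T.gf w, e, T.gf]
      exact this ▸ hw
    · intro h; rw [← hinv]; exact ⟨z, h, rfl⟩
  have hfV : ∀ z ∈ V, T.f z ∈ V := by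
    intro z hz
    obtain ⟨M', hM'⟩ := T.endF M
    set q : Pl := (0, min (-M) (-M')) with hq
    have hqV : pr q ∈ V := hlow (show (pr q).2 ≤ -M from min_le_left _ _)
    have hfq : T.f (pr q) ∈ V := by
      rw [T.f_pr]
      exact hlow (show (pr (T.F q)).2 ≤ -M from (hM' q).2 (min_le_right _ _))
    have e : V = connectedComponentIn Γᶜ (T.f (pr q)) := connectedComponentIn_eq hfq
    rw [e]
    refine (hVc.image _ T.f_cont.continuousOn).subset_connectedComponentIn ⟨_, hqV, rfl⟩ ?_ ⟨z, hz, rfl⟩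
    rintro _ ⟨w, hw, rfl⟩ h
    exact hVs hw ((hfΓ w).1 h)
  have hgV : ∀ z ∈ V, T.g z ∈ V := by
    intro z hz
    obtain ⟨M', hM'⟩ := T.endG M
    set q : Pl := (0, min (-M) (-M')) with hq
    have hqV : pr q ∈ V := hlow (show (pr q).2 ≤ -M from min_le_left _ _)
    have hfq : T.g (pr q) ∈ V := by
      rw [T.g_pr]
      exact hlow (show (pr (T.G q)).2 ≤ -M from (hM' q).2 (min_le_right _ _))
    have e : V = connectedComponentIn Γᶜ (T.g (pr q)) := connectedComponentIn_eq hfq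
    rw [e]
    refine (hVc.image _ T.g_cont.continuousOn).subset_connectedComponentIn ⟨_, hqV, rfl⟩ ?_ ⟨z, hz, rfl⟩
    rintro _ ⟨w, hw, rfl⟩ h
    have := (hfΓ (T.g w)).2 h
    rw [T.fg] at this
    exact hVs hw this
  have hWo : IsOpen (Γᶜ \ V) := by
    rw [isOpen_iff_mem_nhds]
    rintro w ⟨hw, hwV⟩
    have h1 : connectedComponentIn Γᶜ w ∈ 𝓝 w := hΓo.connectedComponentIn.mem_nhds (mem_connectedComponentIn hw)
    refine mem_of_superset h1 fun v hv => ⟨connectedComponentIn_subset _ _ hv, fun hvV => hwV ?_⟩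
    rw [hV, connectedComponentIn_eq hvV, ← connectedComponentIn_eq hv]
    exact mem_connectedComponentIn hw
  have hhi : ∀ z : Ann, M ≤ z.2 → z ∉ V := fun z hz h => disjoint_left.1 hd (hVZ h) (hM1 z hz)
  have hΓV : ∀ z ∈ Γ, z ∈ Vᶜ := fun z hz h => hVs h hz
  have hΓne : Γ.Nonempty := range_nonempty γ
  have hclop : ∀ B ⊆ Vᶜ, IsClosed B → IsClosed (Vᶜ \ B) → Disjoint B Γ → B = ∅ := by
    intro B hB h1 h2 h3
    have e : B = (Γᶜ \ V) ∩ (Vᶜ \ B)ᶜ := by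
      ext w
      constructor
      · intro hw
        exact ⟨⟨fun h => disjoint_left.1 h3 hw h, hB hw⟩, fun h => h.2 hw⟩
      · rintro ⟨⟨-, h⟩, h'⟩
        by_contra hn
        exact h' ⟨h, hn⟩
    have ho : IsOpen B := by rw [e]; exact hWo.inter h2.isOpen_compl
    rcases isClopen_iff.1 ⟨h1, ho⟩ with h | h
    · exact h
    · exfalso
      obtain ⟨w, hw⟩ := hΓne
      exact disjoint_left.1 h3 (h ▸ mem_univ w) hw
  have hnc : NoCpt Vᶜ := by
    intro K hK hKc hKcl
    have hpre : IsPreconnected Γ := by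
      have : ConnectedSpace (AddCircle (1:ℝ)) := circ_quot.surjective.connectedSpace circ_quot.continuous
      exact isPreconnected_range γ.continuous
    by_cases hdis : Disjoint K Γ
    · exact hclop K hK hKc.isClosed hKcl hdis
    · exfalso
      have hdis2 : Disjoint (Vᶜ \ K) Γ := by
        by_contra hn
        rw [not_disjoint_iff] at hn hdis
        obtain ⟨a, ha, ha'⟩ := hdis
        obtain ⟨b, hb, hb'⟩ := hn
        obtain ⟨c, -, h1, h2⟩ := isPreconnected_closed_iff.1 hpre K (Vᶜ \ K) hKc.isClosed hKcl (fun w hw => by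
          by_cases h : w ∈ K
          · exact Or.inl h
          · exact Or.inr ⟨hΓV w hw, h⟩) ⟨a, ha', ha⟩ ⟨b, hb', hb⟩
        exact h2.2 h1
      have he := hclop (Vᶜ \ K) diff_subset hKcl (by
        have : Vᶜ \ (Vᶜ \ K) = K := by
          ext w
          constructor
          · rintro ⟨h1, h2⟩
            by_contra h
            exact h2 ⟨h1, h⟩
          · intro h; exact ⟨hK h, fun h' => h'.2 h⟩
        rw [this]; exact hKc.isClosed) hdis2
      obtain ⟨R, hR⟩ := hKc.isBounded.exists_norm_le
      set w : Ann := pr (0, max M (R+1)) with hw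
      have hwK : w ∈ K := by
        by_contra h
        have : w ∈ Vᶜ \ K := ⟨hhi w (le_max_left _ _), h⟩
        rw [he] at this; exact this
      have h1 := (le_abs_self w.2).trans ((norm_snd_le w).trans (hR w hwK))
      have h2 : R + 1 ≤ w.2 := le_max_right _ _
      linarith
  have hBD : BD V M := ⟨hVo, ⟨⟨z0, hz0V⟩, hVc⟩, hhi, fun z hz => hlow hz, hnc⟩
  obtain ⟨φ, f1, f2, f3, f4⟩ := birkhoff T hBD (fun z => ⟨fun h => by
    have := hgV _ h
    rwa [T.gf] at this, hfV z⟩)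
  refine ⟨φ, f1, f2, ?_, f4⟩
  have hgr : ∀ x, pr (x, φ x) ∈ Γ := by
    intro x
    by_contra h
    have hm : pr (x, φ x) ∈ Γᶜ \ V := ⟨h, fun h' => lt_irrefl _ ((f3 _).1 h')⟩
    have hc : Continuous fun t : ℝ => pr (x, t) := pr_cont.comp (by fun_prop)
    have hnb : ∀ᶠ t in 𝓝 (φ x), pr (x, t) ∈ Γᶜ \ V := hc.continuousAt.eventually (hWo.mem_nhds hm)
    obtain ⟨t, ht1, ht2⟩ := ((hnb.filter_mono nhdsWithin_le_nhds).and (self_mem_nhdsWithin (s := Iio (φ x)))).exists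
    exact ht1.2 ((f3 (x,t)).2 ht2)
  obtain ⟨q, -, hq⟩ := graph_essential f1 f2
  have hqΓ : ∀ a, q a ∈ Γ := by
    intro a
    obtain ⟨x, rfl⟩ := QuotientAddGroup.mk_surjective a
    have := hgr x
    rw [← hq] at this
    exact this
  choose h hh using hqΓ
  have hhc : Continuous h := by
    rw [hγ.1.continuous_iff]
    have : (γ ∘ h) = q := funext hh
    rw [this]; exact q.continuous
  obtain ⟨s', d', hs', h1', h2'⟩ := lift_curve ⟨fun a => (h a, (0:ℝ)), by fun_prop⟩
  obtain ⟨s, d, hs, h1, h2⟩ := lift_curve γ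
  have hs'h : ∀ x : ℝ, ((s' x : ℝ) : AddCircle (1:ℝ)) = h x := fun x => congrArg Prod.fst (h1' x)
  have cq : Continuous (fun x : ℝ => (x : AddCircle (1:ℝ))) := circ_quot.continuous
  have hd' : d' ≠ 0 := by
    rintro rfl
    have hper : ∀ x, s' (x+1) = s' x := fun x => by rw [h2']; simp
    have D0 : Deg (fun x => zeta (pr (s (s' x), (γ ((s' x : ℝ) : AddCircle (1:ℝ))).2))) 0 :=
      zeta_deg (s := fun x => s (s' x)) (y := fun x => (γ ((s' x : ℝ) : AddCircle (1:ℝ))).2) (by fun_prop)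
        (by have := γ.continuous; fun_prop) (fun x => by simp [hper]) (fun x => by simp only [hper])
    have D1 : Deg (fun x => zeta (pr (x, φ x))) 1 :=
      zeta_deg (s := fun x => x) (y := φ) (by fun_prop) f1 (fun x => by simp) f2
    have := D0.unique (D1.congr fun x => by rw [h1, hs'h, hh, hq])
    exact absurd this (by norm_num)
  have hsurj : ∀ t : ℝ, ∃ x : ℝ, ∃ k : ℤ, s' x = t + k := by
    intro t
    have h01 : s' 1 = s' 0 + d' := by have := h2' 0; rwa [zero_add] at this
    have hIVT := intermediate_value_uIcc (a := (0:ℝ)) (b := 1) hs'.continuousOn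
    rcases lt_or_gt_of_ne hd' with hneg | hpos
    · have hle : (d':ℝ) ≤ -1 := by exact_mod_cast (by omega : d' ≤ -1)
      have a1 := Int.floor_le (s' 0 - t)
      have a2 := Int.lt_floor_add_one (s' 0 - t)
      obtain ⟨x, -, hx⟩ := hIVT (show t + ⌊s' 0 - t⌋ ∈ uIcc (s' 0) (s' 1) by
        rw [h01, uIcc_of_ge (by linarith)]; constructor <;> linarith)
      exact ⟨x, _, hx⟩
    · have hle : (1:ℝ) ≤ d' := by exact_mod_cast (by omega : 1 ≤ d')
      have a1 := Int.ceil_lt_add_one (s' 0 - t)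
      have a2 := Int.le_ceil (s' 0 - t)
      obtain ⟨x, -, hx⟩ := hIVT (show t + ⌈s' 0 - t⌉ ∈ uIcc (s' 0) (s' 1) by
        rw [h01, uIcc_of_le (by linarith)]; constructor <;> linarith)
      exact ⟨x, _, hx⟩
  rintro _ ⟨a, rfl⟩
  obtain ⟨t, rfl⟩ := QuotientAddGroup.mk_surjective a
  obtain ⟨x, k, hx⟩ := hsurj t
  refine ⟨x, ?_⟩
  rw [← hq, ← hh, ← hs'h, hx]
  congr 1
  exact (congrArg Prod.fst (pr_add_int (t, 0) k)).symm

namespace IsotopySetup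
variable (S : IsotopySetup)

/-- a half-tangent direction along an invariant graph which stays on the right -/
lemma graph_dir {φ : ℝ → ℝ} (hc : Continuous φ) (hp : ∀ x, φ (x+1) = φ x)
    (hi : ∀ x, (S.F (x, φ x)).2 = φ (S.F (x, φ x)).1) (x : ℝ) :
    ∃ u : Pl, u ≠ 0 ∧ ∀ n, 0 ≤ (S.DN n (x, φ x) u).1 := by
  set e : ℕ → ℝ := fun i => 1 / ((i:ℝ) + 1) with he
  have he0 : ∀ i, 0 < e i := fun i => by simp only [he]; positivity
  have hel : Tendsto e atTop (𝓝 0) := tendsto_one_div_add_atTop_nhds_zero_nat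
  set v : ℕ → Pl := fun i => (x + e i, φ (x + e i)) - (x, φ x) with hv
  have hvne : ∀ i, v i ≠ 0 := fun i h => by
    have := congrArg Prod.fst h
    simp [hv] at this
    exact (he0 i).ne' this
  have hvl : Tendsto v atTop (𝓝 0) := by
    have hcc : Continuous fun t : ℝ => ((x + t, φ (x + t)) - (x, φ x) : Pl) := by fun_prop
    have := (hcc.tendsto 0).comp hel
    rw [show (((x + 0, φ (x + 0)) - (x, φ x) : Pl)) = 0 by simp] at this
    exact this
  obtain ⟨u, hu, a, ha, hlim⟩ := (isCompact_sphere (0:Pl) 1).tendsto_subseq (x := fun i => ‖v i‖⁻¹ • v i) (fun i => by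
    simp [norm_smul, inv_mul_cancel₀ (norm_ne_zero_iff.2 (hvne i))])
  refine ⟨u, ?_, fun n => ?_⟩
  · rintro rfl; simp at hu
  · have := (S.DN_has n (x, φ x)).hasFDerivWithinAt (s := univ) |>.lim (hvl.comp ha.tendsto_atTop) (.of_forall fun _ => mem_univ _)
      (c := fun i => ‖v (a i)‖⁻¹) hlim
    have h2 := (continuous_fst.tendsto _).comp this
    refine ge_of_tendsto' h2 fun i => ?_
    have e1 : (x, φ x) + v (a i) = (x + e (a i), φ (x + e (a i))) := by simp [hv]
    simp only [comp_apply, e1, Prod.smul_fst, Prod.fst_sub, smul_eq_mul]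
    refine mul_nonneg (by positivity) (sub_nonneg.2 ?_)
    exact (S.graph_mono hc hp hi n (by linarith [he0 (a i)])).1

lemma dir_pos (ht : S.PosTwist) {p u : Pl} (hu : u ≠ 0) (h : ∀ n, 0 ≤ (S.DN n p u).1) (n : ℕ) :
    0 < (S.DN (n+1) p u).1 := by
  refine lt_of_le_of_ne (h _) fun h0 => ?_
  have hne := S.DN_ne (n+1) p hu
  have hb := S.beta_pos ht (S.F^[n] p)
  have hj := S.jac_F_pos (S.F^[n] p)
  have hn := h n
  rcases lt_trichotomy (S.DN (n+1) p u).2 0 with h1 | h1 | h1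
  · have h3 := (S.allowed_lin ht (S.F^[n+1] p) (S.DN (n+1) p u)).2.1 h0.symm h1
    rw [← DN_succ_apply] at h3
    linarith [h (n+1+1)]
  · exact hne (Prod.ext h0.symm h1)
  · rw [DN_succ_apply] at h0 h1
    rw [lin_expand] at h0 h1
    unfold jac at hj
    simp only [Prod.fst_add, Prod.snd_add, Prod.smul_fst, Prod.smul_snd, smul_eq_mul] at h0 h1
    set L := fderiv ℝ S.F (S.F^[n] p)
    set w := S.DN n p u
    have e : w.1 * ((L (1,0)).1 * (L (0,1)).2 - (L (0,1)).1 * (L (1,0)).2) =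
      - (L (0,1)).1 * (w.1 * (L (1,0)).2 + w.2 * (L (0,1)).2) := by linear_combination (-(L (0,1)).2) * h0
    have h5 := mul_pos hb h1
    have h6 := mul_nonneg hn hj.le
    linarith

lemma lin_det (L : Pl →L[ℝ] Pl) (u w : Pl) :
    (L u).1 * (L w).2 - (L u).2 * (L w).1 = jac L * (u.1 * w.2 - u.2 * w.1) := by
  rw [lin_expand L u, lin_expand L w]
  unfold jac
  simp only [Prod.fst_add, Prod.snd_add, Prod.smul_fst, Prod.smul_snd, smul_eq_mul]
  ring

lemma absorb (ht : S.PosTwist) {p u w : Pl} (hu : u ≠ 0) (hw : w ≠ 0) (h : ∀ n, 0 ≤ (S.DN n p u).1)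
    (hdet : 0 ≤ u.1 * w.2 - u.2 * w.1) (n : ℕ) (hs : ¬ sd (S.DN (n+1) p w)) : ¬ sd (S.DN (n+1+1) p w) := by
  have hb := S.beta_pos ht (S.F^[n+1] p)
  have hp1 := S.dir_pos ht hu h n
  have hp2 := S.dir_pos ht hu h (n+1)
  have hwn := S.DN_ne (n+1) p hw
  have hd : 0 ≤ (S.DN (n+1) p u).1 * (S.DN (n+1) p w).2 - (S.DN (n+1) p u).2 * (S.DN (n+1) p w).1 := by
    rw [lin_det]; exact mul_nonneg (S.jac_DN_pos _ _).le hdet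
  rw [DN_succ_apply S (n+1) p u] at hp2
  rw [DN_succ_apply S (n+1) p w]
  set L := fderiv ℝ S.F (S.F^[n+1] p)
  set a := S.DN (n+1) p u
  set b := S.DN (n+1) p w
  unfold sd at hs
  push Not at hs
  have hb1 : 0 < b.1 := by
    refine lt_of_le_of_ne hs.1 fun h0 => ?_
    have h2 := hs.2 h0.symm
    rw [← h0] at hd
    have h3 : 0 ≤ b.2 := by
      by_contra hc
      push Not at hc
      have := mul_neg_of_pos_of_neg hp1 hc
      linarith
    exact hwn (Prod.ext h0.symm (le_antisymm h2 h3))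
  have e1 : a.1 * (L b).1 = b.1 * (L a).1 + (a.1 * b.2 - a.2 * b.1) * (L (0,1)).1 := by
    rw [lin_expand L a, lin_expand L b]
    simp only [Prod.fst_add, Prod.snd_add, Prod.smul_fst, Prod.smul_snd, smul_eq_mul]
    ring
  have e2 : 0 < a.1 * (L b).1 := by
    rw [e1]
    have := mul_pos hb1 hp2
    have := mul_nonneg hd hb.le
    linarith
  have e3 : 0 < (L b).1 := pos_of_mul_pos_right e2 hp1.le
  unfold sd
  push Not
  exact ⟨e3.le, fun h => absurd h e3.ne'⟩

open Classical in
lemma sc_le_two {p w : Pl} (h : ∀ n, ¬ sd (S.DN (n+1) p w) → ¬ sd (S.DN (n+1+1) p w)) (n : ℕ) : S.sc p w n ≤ 2 := by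
  have key : ∀ n, S.sc p w (n+1) ≤ 1 + if sd (S.DN (n+1) p w) then 0 else 1 := by
    intro n
    induction n with
    | zero =>
      rw [sc_succ]
      have : S.sc p w 0 = 0 := rfl
      rw [this]
      split_ifs <;> omega
    | succ k ih =>
      rw [sc_succ]
      have := h k
      by_cases h1 : sd (S.DN (k+1) p w) <;> by_cases h2 : sd (S.DN (k+1+1) p w) <;> simp [h1, h2] at * <;> omega
  cases n with
  | zero => exact Nat.zero_le _
  | succ k =>
    have := key k
    split_ifs at this <;> omega

open Classical in
lemma sc_neg (p : Pl) {w : Pl} (hw : w ≠ 0) (n : ℕ) : S.sc p (-w) n = S.sc p w n := by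
  unfold sc
  refine Finset.sum_congr rfl fun j _ => ?_
  have e1 := sd_neg (S.DN_ne j p hw)
  have e2 := sd_neg (S.DN_ne (j+1) p hw)
  rw [← map_neg] at e1 e2
  refine if_congr ?_ rfl rfl
  rw [e1, e2, not_iff_not]

theorem forward (ht : S.PosTwist) (hpres : MeasurePreserving S.f volume volume) (U : Set Ann)
    (hU : C0IntegrableOn S.f U) (z : Ann) (hz : z ∈ U) : S.Torsion z 0 := by
  obtain ⟨ι, γ, h1, h2, -⟩ := hU
  rw [← h2] at hz
  obtain ⟨i, hi⟩ := mem_iUnion.1 hz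
  obtain ⟨φ, f1, f2, f3, f4⟩ := leaf_graph (S.twistLift ht hpres) (h1 i).1 (by
    rw [S.twistLift_f]; exact (h1 i).2)
  obtain ⟨x, rfl⟩ := f3 z hi
  refine ⟨(x, φ x), rfl, (S.torsionLift_iff (S.twistLift ht hpres) rfl ht _).2 fun w hw => ?_⟩
  obtain ⟨u, hu, hun⟩ := S.graph_dir f1 f2 f4 x
  have hle : ∀ n, S.sc (x, φ x) w n ≤ 2 := by
    intro n
    rcases le_total 0 (u.1 * w.2 - u.2 * w.1) with hd | hd
    · exact S.sc_le_two (S.absorb ht hu hw hun hd) n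
    · rw [← S.sc_neg _ hw]
      exact S.sc_le_two (S.absorb ht hu (neg_ne_zero.2 hw) hun (by simp only [Prod.fst_neg, Prod.snd_neg]; linarith)) n
  refine squeeze_zero (fun n => by positivity) (fun n => ?_) (tendsto_const_div_atTop_nhds_zero_nat 2)
  have : (S.sc (x, φ x) w n : ℝ) ≤ 2 := by exact_mod_cast hle n
  gcongr

end IsotopySetup
end

/-- For a positive twist map preserving Lebesgue measure and an `f`-invariant
bounded essential open subannulus `U`, the restriction `f|U` is `C⁰`-integrable if and only if
for Lebesgue-almost every `z ∈ U` the asymptotic torsion exists and is zero. -/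
theorem statement3 (S : IsotopySetup) (htwist : S.PosTwist)
    (hpres : MeasurePreserving S.f volume volume)
    (U : Set Ann) (hUopen : IsOpen U) (hUconn : IsConnected U)
    (hUhomeo : Nonempty (U ≃ₜ Ann)) (hUbdd : Bornology.IsBounded U)
    (hUess : EssentialSet U) (hUinv : S.f '' U = U) :
    C0IntegrableOn S.f U ↔ (∀ᵐ z ∂volume, z ∈ U → S.Torsion z 0) := by
  exact ⟨fun h => Filter.Eventually.of_forall (S.forward htwist hpres U h),
    S.backward htwist hpres U hUopen hUconn hUhomeo hUbdd hUess hUinv⟩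

end
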